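/- Let p ∈ {2, 3, 5, 7, 13} be prime, and let c_n^{(p)} denote the n-th Fourier coefficient of the hauptmodul j_p(τ) of Γ₀(p). Then for every integer n ≥ -1, one has 2n·c_n^{(p)} = Σ_{r∈ℤ} t₂^{(p*)}(4n - r²) + (24(3 - p·σ₁(2/p))/(p-1))·σ₁^{(p)}(n), where σ₁(2/p) = 1 if p = 2 and 0 otherwise (so the coefficient is 24 for p = 2 and 72/(p-1) for p odd), and the sum over r is finite. -/

import Mathlib

open Complex Matrix

noncomputable section

/-- `SL(2, ℝ)`. -/
abbrev SL2R := Matrix.SpecialLinearGroup (Fin 2) ℝ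

/-- `q = e^{2πiz}` (also used as `ζ = e^{2πiz}`). -/
def qc (z : ℂ) : ℂ := Complex.exp (2 * Real.pi * Complex.I * z)

/-- The Dedekind eta function `η(z) = q^{1/24} ∏_{n ≥ 1} (1 - q^n)` (intended for `Im z > 0`). -/
def dedekindEta (z : ℂ) : ℂ :=
  Complex.exp (Real.pi * Complex.I * z / 12) *
    ∏' n : ℕ, (1 - Complex.exp (2 * Real.pi * Complex.I * ((n : ℂ) + 1) * z))

/-- The hauptmodul `j_N` of `Γ₀(N)` for `N ∈ {2, 3, 5, 7, 13, 6, 10}`. -/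
def jn (N : ℕ) (z : ℂ) : ℂ :=
  if N = 6 then (dedekindEta (2 * z) * dedekindEta (3 * z) ^ 3 / (dedekindEta z * dedekindEta (6 * z) ^ 3)) ^ 3 - 3
  else if N = 10 then dedekindEta (2 * z) * dedekindEta (5 * z) ^ 5 / (dedekindEta z * dedekindEta (10 * z) ^ 5) - 1
  else (dedekindEta z / dedekindEta ((N : ℂ) * z)) ^ (24 / (N - 1)) + 24 / ((N : ℂ) - 1)

/-- The hauptmodul `j_N^*` of the Fricke group `Γ₀^*(N)` for `N ∈ {2, 3, 5, 7, 13, 6, 10}`. -/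
def jnStar (N : ℕ) (z : ℂ) : ℂ :=
  if N = 6 then
    (dedekindEta z * dedekindEta (3 * z) / (dedekindEta (2 * z) * dedekindEta (6 * z))) ^ 6 + 6 +
      2 ^ 6 * (dedekindEta (2 * z) * dedekindEta (6 * z) / (dedekindEta z * dedekindEta (3 * z))) ^ 6
  else if N = 10 then
    (dedekindEta z * dedekindEta (5 * z) / (dedekindEta (2 * z) * dedekindEta (10 * z))) ^ 4 + 4 +
      2 ^ 4 * (dedekindEta (2 * z) * dedekindEta (10 * z) / (dedekindEta z * dedekindEta (5 * z))) ^ 4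
  else
    (dedekindEta z / dedekindEta ((N : ℂ) * z)) ^ (24 / (N - 1)) + 24 / ((N : ℂ) - 1) +
      (N : ℂ) ^ (12 / (N - 1)) * (dedekindEta ((N : ℂ) * z) / dedekindEta z) ^ (24 / (N - 1))

/-- `f` has the `q`-expansion `f(τ) = Σ_{n ≥ n₀} (a n) q^n` on the upper half-plane. -/
def HasQExp (f : ℂ → ℂ) (a : ℤ → ℂ) (n₀ : ℤ) : Prop :=
  (∀ n < n₀, a n = 0) ∧
    ∀ τ : ℂ, 0 < τ.im →
      HasSum (fun m : ℕ => a (n₀ + m) * qc τ ^ (n₀ + (m : ℤ))) (f τ)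

/-- `Γ₀(N)` viewed as a subgroup of `SL(2, ℝ)`. -/
def Gamma0SL2R (N : ℕ) : Subgroup SL2R :=
  (CongruenceSubgroup.Gamma0 N).map
    (Matrix.SpecialLinearGroup.map (Int.castRingHom ℝ))

/-- The set of Atkin–Lehner matrices `W_e` of level `N`:
`W_e = e^{-1/2} [[xe, y], [zN, we]]`, `x, y, z, w ∈ ℤ` (determinant `1` being automatic). -/
def atkinLehnerSet (N e : ℕ) : Set SL2R :=
  { g | ∃ x y z w : ℤ,
      g.1 = (Real.sqrt e)⁻¹ • !![(x : ℝ) * e, (y : ℝ); (z : ℝ) * N, (w : ℝ) * e] }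

/-- The Fricke group `Γ₀^*(N)`, generated by `Γ₀(N)` and all Atkin–Lehner involutions `W_e`
for `e ∣ N` with `gcd(e, N/e) = 1`. -/
def FrickeGroup (N : ℕ) : Subgroup SL2R :=
  Subgroup.closure
    ((Gamma0SL2R N : Set SL2R) ∪
      ⋃ e ∈ {e : ℕ | e ∣ N ∧ Nat.Coprime e (N / e)}, atkinLehnerSet N e)

/-- The Gram matrix of the integral binary quadratic form `[a, b, c]`. -/
def formMat (a b c : ℤ) : Matrix (Fin 2) (Fin 2) ℝ :=
  !![(a : ℝ), (b : ℝ) / 2; (b : ℝ) / 2, (c : ℝ)]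

/-- `𝒬_{d,N}`: positive definite integral binary quadratic forms `[a, b, c]` of
discriminant `-d` with `N ∣ a`. -/
def QdN (d : ℤ) (N : ℕ) : Set (Matrix (Fin 2) (Fin 2) ℝ) :=
  { M | ∃ a b c : ℤ, M = formMat a b c ∧ 0 < a ∧ b ^ 2 - 4 * a * c = -d ∧ (N : ℤ) ∣ a }

/-- `𝒬_{d,N,h}`: members of `𝒬_{d,N}` with `b ≡ h (mod 2N)`. -/
def QdNh (d : ℤ) (N : ℕ) (h : ℤ) : Set (Matrix (Fin 2) (Fin 2) ℝ) :=
  { M | ∃ a b c : ℤ, M = formMat a b c ∧ 0 < a ∧ b ^ 2 - 4 * a * c = -d ∧ (N : ℤ) ∣ a ∧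
      (b : ZMod (2 * N)) = (h : ZMod (2 * N)) }

/-- Orbit relation of the (right) action `Q ↦ Q ∘ g`, i.e. `M ↦ gᵀ M g`, of `Γ ≤ SL(2, ℝ)`
on a set `S` of Gram matrices of quadratic forms. -/
def formRel (Γ : Subgroup SL2R) (S : Set (Matrix (Fin 2) (Fin 2) ℝ)) (Q Q' : S) : Prop :=
  ∃ g ∈ Γ, Q'.1 = (g.1)ᵀ * Q.1 * g.1

/-- The CM point `α_Q` of a positive definite form (as a point of `ℂ`; it lies in the upper
half-plane): `α_Q = (-b + i √d) / (2a) = (-(b/2) + i √(det M)) / a`. -/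
def cmPointC (M : Matrix (Fin 2) (Fin 2) ℝ) : ℂ :=
  ((-(M 0 1) : ℝ) + Complex.I * Real.sqrt M.det) / ((M 0 0 : ℝ) : ℂ)

/-- The order of the stabilizer of the form `M` in `Γ/{±1}` (the stabilizer in `Γ` contains
`±1` and has twice the cardinality). -/
def stabOrder (Γ : Subgroup SL2R) (M : Matrix (Fin 2) (Fin 2) ℝ) : ℕ :=
  Nat.card { g : SL2R // g ∈ Γ ∧ (g.1)ᵀ * M * g.1 = M } / 2

/-- The modular trace `Σ_{Q ∈ S/Γ} f(α_Q) / |Γ̄_Q|`. -/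
def classTrace (Γ : Subgroup SL2R) (f : ℂ → ℂ)
    (S : Set (Matrix (Fin 2) (Fin 2) ℝ)) : ℂ :=
  ∑ᶠ O : Quot (formRel Γ S),
    f (cmPointC (Quot.out O).1) / (stabOrder Γ (Quot.out O).1 : ℂ)

/-- `t₂^{(N*)}(d)`, where `P` is the polynomial with `φ₂(j_N^*) = P(j_N^*)`;
includes the paper's conventions at nonpositive indices. -/
def t2Star (N : ℕ) (P : Polynomial ℂ) (d : ℤ) : ℂ :=
  if 0 < d then
    classTrace (FrickeGroup N) (fun z => Polynomial.eval (jnStar N z) P) (QdN d N)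
  else if d = 0 then (if N = 2 then 5 else if N = 6 ∨ N = 10 then 5 / 2 else 3)
  else if d = -1 then -1
  else if d = -4 then -2
  else 0

/-- `σ₁^{(N)}(x) = Σ_{d ∣ x, N ∤ d} d` for `x ∈ ℤ_{>0}`, `(N-1)/24` at `x = 0`, and `0`
off `ℤ_{≥0}`. -/
def sigmaN (N : ℕ) (x : ℚ) : ℂ :=
  if x = 0 then ((N : ℂ) - 1) / 24
  else if 0 < x ∧ x.den = 1 then
    ∑ d ∈ (Nat.divisors x.num.toNat).filter (fun d => ¬ N ∣ d), (d : ℂ)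
  else 0

/-- `σ₁(x) = Σ_{d ∣ x} d` for `x ∈ ℤ_{>0}` and `0` otherwise. -/
def sigmaQ (x : ℚ) : ℂ :=
  if 0 < x ∧ x.den = 1 then ∑ d ∈ Nat.divisors x.num.toNat, (d : ℂ) else 0

/-- A weakly holomorphic Jacobi form of weight `k` and index `m`. -/
structure WeakJacobiForm (k : ℤ) (m : ℕ) where
  toFun : ℂ → ℂ → ℂ
  holo : DifferentiableOn ℂ (fun p : ℂ × ℂ => toFun p.1 p.2)
      ({τ : ℂ | 0 < τ.im} ×ˢ (Set.univ : Set ℂ))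
  slash_inv : ∀ a b c d : ℤ, a * d - b * c = 1 → ∀ τ z : ℂ, 0 < τ.im →
    ((c : ℂ) * τ + d) ^ (-k) *
        Complex.exp (-(2 * Real.pi * Complex.I * m * c * z ^ 2) / ((c : ℂ) * τ + d)) *
        toFun (((a : ℂ) * τ + b) / ((c : ℂ) * τ + d)) (z / ((c : ℂ) * τ + d)) =
      toFun τ z
  elliptic : ∀ lm mu : ℤ, ∀ τ z : ℂ, 0 < τ.im →
    Complex.exp (2 * Real.pi * Complex.I * m * ((lm : ℂ) ^ 2 * τ + 2 * lm * z)) *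
        toFun τ (z + lm * τ + mu) = toFun τ z
  coeff : ℤ → ℤ → ℂ
  coeff_neg_finite : {n : ℤ | n < 0 ∧ ∃ r : ℤ, coeff n r ≠ 0}.Finite
  expansion : ∀ τ z : ℂ, 0 < τ.im →
    HasSum (fun p : ℤ × ℤ => coeff p.1 p.2 * qc τ ^ p.1 * qc z ^ p.2) (toFun τ z)

/-- Meromorphy of weight `k` at all cusps: at each cusp `γ∞`, the function `F|_k γ` has a
Fourier expansion in fractional powers of `q` with only finitely many negative terms. -/
def MeromAtCusps (k : ℤ) (F : ℂ → ℂ) : Prop :=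
  ∀ a b c d : ℤ, a * d - b * c = 1 →
    ∃ (M : ℕ) (cs : ℤ → ℂ) (n₀ : ℤ), 0 < M ∧
      ∀ τ : ℂ, 0 < τ.im →
        HasSum
          (fun j : ℕ => cs (n₀ + j) *
            Complex.exp (2 * Real.pi * Complex.I * τ / M) ^ (n₀ + (j : ℤ)))
          (((c : ℂ) * τ + d) ^ (-k) * F (((a : ℂ) * τ + b) / ((c : ℂ) * τ + d)))

/-- The Möbius action of an element of `SL(2, ℝ)` on `ℂ`. -/
def moebius (g : SL2R) (z : ℂ) : ℂ :=
  ((g.1 0 0 : ℝ) * z + ((g.1 0 1 : ℝ) : ℂ)) / ((g.1 1 0 : ℝ) * z + ((g.1 1 1 : ℝ) : ℂ))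

/-- A weakly holomorphic modular function on `Γ`: holomorphic on the upper half-plane,
`Γ`-invariant, with poles only at the cusps. -/
def IsWeaklyHolModularFn (Γ : Subgroup SL2R) (f : ℂ → ℂ) : Prop :=
  DifferentiableOn ℂ f {z : ℂ | 0 < z.im} ∧
    (∀ g ∈ Γ, ∀ z : ℂ, 0 < z.im → f (moebius g z) = f z) ∧
    MeromAtCusps 0 f

/-- The set `L_{h, d/4N}` of vectors
`X = [[b + h/2N, c/N], [-a, -(b + h/2N)]]`, `a, b, c ∈ ℤ`, of norm `q(X) = d/4N`. -/
def LhSet (N : ℕ) (h d : ℤ) : Set (Matrix (Fin 2) (Fin 2) ℝ) :=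
  { X | ∃ a b c : ℤ,
      X = !![(b : ℝ) + (h : ℝ) / (2 * N), (c : ℝ) / N;
             -(a : ℝ), -((b : ℝ) + (h : ℝ) / (2 * N))] ∧
      (2 * b * N + h) ^ 2 - 4 * a * c * N = -d }

/-- The map `X ↦ N ⬝ [[0,-1],[1,0]] ⬝ X` from vectors to Gram matrices of quadratic forms. -/
def vecToForm (N : ℕ) (X : Matrix (Fin 2) (Fin 2) ℝ) : Matrix (Fin 2) (Fin 2) ℝ :=
  (N : ℝ) • (!![(0 : ℝ), -1; 1, 0] * X)

/-- Orbit relation of `Γ` acting by conjugation `g.X = g X g⁻¹` on a set `S` of vectors. -/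
def vecRel (Γ : Subgroup SL2R) (S : Set (Matrix (Fin 2) (Fin 2) ℝ)) (X X' : S) : Prop :=
  ∃ g ∈ Γ, X'.1 = g.1 * X.1 * (g⁻¹).1

/-- The Heegner point `D_X ∈ ℍ` of a vector `X` of positive norm. -/
def heegnerC (X : Matrix (Fin 2) (Fin 2) ℝ) : ℂ :=
  ((X 0 0 / X 1 0 : ℝ) : ℂ) + Complex.I * Real.sqrt (X.det / (X 1 0) ^ 2)

/-- The order of the stabilizer of the vector `X` in `Γ/{±1}`. -/
def vecStabOrder (Γ : Subgroup SL2R) (X : Matrix (Fin 2) (Fin 2) ℝ) : ℕ :=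
  Nat.card { g : SL2R // g ∈ Γ ∧ g.1 * X * (g⁻¹).1 = X } / 2

/-- The modular trace `t_f(h, m) = Σ_{X ∈ Γ\L_{h,m}} f(D_X) / |Γ̄_X|`. -/
def vecTrace (Γ : Subgroup SL2R) (f : ℂ → ℂ) (S : Set (Matrix (Fin 2) (Fin 2) ℝ)) : ℂ :=
  ∑ᶠ O : Quot (vecRel Γ S), f (heegnerC (Quot.out O).1) / (vecStabOrder Γ (Quot.out O).1 : ℂ)

/-- The weight-2 Eisenstein series `E₂(z) = 1 - 24 Σ_{n ≥ 1} σ₁(n) qⁿ`. -/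
def E2 (z : ℂ) : ℂ :=
  1 - 24 * ∑' n : ℕ, (∑ d ∈ Nat.divisors (n + 1), (d : ℂ)) * qc z ^ (n + 1)

/-- `E₂^{(N)}(z) = N E₂(Nz) - E₂(z)`. -/
def E2N (N : ℕ) (z : ℂ) : ℂ := (N : ℂ) * E2 ((N : ℂ) * z) - E2 z

end

namespace TraceFormula

open Filter Topology Asymptotics

/-- Integral `2 × 2` matrices. -/
abbrev M2 := Matrix (Fin 2) (Fin 2) ℤ

/-- The automorphy factor `cz + d`. -/
noncomputable def mden (M : M2) (z : ℂ) : ℂ := (M 1 0 : ℂ) * z + (M 1 1 : ℂ)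

/-- The Möbius transformation `(az + b) / (cz + d)` of an integral matrix. -/
noncomputable def mob (M : M2) (z : ℂ) : ℂ := ((M 0 0 : ℂ) * z + (M 0 1 : ℂ)) / mden M z

/-- Membership in `Γ₀(p)`, for integral matrices. -/
def IsG0 (p : ℕ) (M : M2) : Prop := M.det = 1 ∧ (p : ℤ) ∣ M 1 0

/-- Membership in the set of elements of determinant `n` of the Eichler order of level `p`. -/
def IsR (p : ℕ) (n : ℤ) (M : M2) : Prop := M.det = n ∧ (p : ℤ) ∣ M 1 0

/-- The integral matrix of the Fricke involution. -/
def wMat (p : ℕ) : M2 := !![0, -1; (p : ℤ), 0]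

lemma mden_ne_zero {M : M2} (hM : 0 < M.det) {z : ℂ} (hz : 0 < z.im) : mden M z ≠ 0 := by
  intro h
  have him : (mden M z).im = 0 := by rw [h]; rfl
  have hre : (mden M z).re = 0 := by rw [h]; rfl
  simp only [mden, add_im, mul_im, intCast_re, intCast_im, zero_mul, add_zero, add_re,
    mul_re, sub_zero, mul_eq_zero, Int.cast_eq_zero] at him hre
  rcases him with hc | h0
  · have hd : M 1 1 = 0 := by simpa [hc] using hre
    rw [det_fin_two, hc, hd] at hM
    simp at hM
  · exact hz.ne' h0

lemma mob_im {M : M2} (hM : 0 < M.det) {z : ℂ} (hz : 0 < z.im) :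
    (mob M z).im = M.det * z.im / normSq (mden M z) := by
  have h := mden_ne_zero hM hz
  have h' : normSq (mden M z) ≠ 0 := by simpa using h
  rw [mob, div_im, det_fin_two]
  simp only [mden, add_im, mul_im, intCast_re, intCast_im, zero_mul, add_zero, add_re,
    mul_re, sub_zero]
  push_cast
  rw [← sub_div]
  congr 1
  ring

lemma mob_im_pos {M : M2} (hM : 0 < M.det) {z : ℂ} (hz : 0 < z.im) : 0 < (mob M z).im := by
  rw [mob_im hM hz]
  have h' : 0 < normSq (mden M z) := normSq_pos.2 (mden_ne_zero hM hz)
  have : (0 : ℝ) < M.det := by exact_mod_cast hM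
  positivity

lemma mden_mul (M : M2) {N : M2} (hN : 0 < N.det) {z : ℂ} (hz : 0 < z.im) :
    mden (M * N) z = mden M (mob N z) * mden N z := by
  have h := mden_ne_zero hN hz
  rw [mden, mden, mob, add_mul, mul_assoc, div_mul_cancel₀ _ h]
  simp only [mul_apply, Fin.sum_univ_two, mden]
  push_cast
  ring

lemma mob_mul (M : M2) {N : M2} (hN : 0 < N.det) {z : ℂ} (hz : 0 < z.im) :
    mob (M * N) z = mob M (mob N z) := by
  have h := mden_ne_zero hN hz
  rw [mob, mden_mul M hN hz, mob.eq_1 M (mob N z), ← mul_div_mul_right _ (mden M (mob N z)) h]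
  congr 1
  rw [mob.eq_1 N, add_mul, mul_assoc, div_mul_cancel₀ _ h]
  simp only [mul_apply, Fin.sum_univ_two, mden]
  push_cast
  ring

@[simp] lemma mob_one (z : ℂ) : mob 1 z = z := by simp [mob, mden]

lemma mob_neg (M : M2) (z : ℂ) : mob (-M) z = mob M z := by
  have : mden (-M) z = -mden M z := by simp [mden]; ring
  rw [mob, this, mob, ← neg_div_neg_eq]
  congr 1
  · simp; ring
  · simp

lemma hasDerivAt_mob {M : M2} (hM : 0 < M.det) {z : ℂ} (hz : 0 < z.im) :
    HasDerivAt (mob M) (M.det / mden M z ^ 2) z := by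
  have h := mden_ne_zero hM hz
  have h1 : HasDerivAt (fun z : ℂ => (M 0 0 : ℂ) * z + (M 0 1 : ℂ)) (M 0 0 : ℂ) z := by
    simpa using ((hasDerivAt_id z).const_mul (M 0 0 : ℂ)).add_const (M 0 1 : ℂ)
  have h2 : HasDerivAt (mden M) (M 1 0 : ℂ) z := by
    have := ((hasDerivAt_id z).const_mul (M 1 0 : ℂ)).add_const (M 1 1 : ℂ)
    rw [mul_one] at this
    exact this
  have := h1.div h2 h
  convert! this using 2
  rw [det_fin_two]
  simp only [mden]
  push_cast
  ring

lemma analyticAt_mob {M : M2} (hM : 0 < M.det) {z : ℂ} (hz : 0 < z.im) :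
    AnalyticAt ℂ (mob M) z := by
  have h := mden_ne_zero hM hz
  unfold mob
  refine AnalyticAt.div (by fun_prop) ?_ h
  unfold mden
  fun_prop

lemma isOpen_upper : IsOpen {z : ℂ | 0 < z.im} := isOpen_lt continuous_const continuous_im

lemma isPreconnected_upper : IsPreconnected {z : ℂ | 0 < z.im} :=
  (convex_halfSpace_im_gt 0).isPreconnected

namespace IsG0

variable {p : ℕ}

lemma det_pos {M : M2} (h : IsG0 p M) : 0 < M.det := by rw [h.1]; norm_num

lemma one : IsG0 p 1 := ⟨by simp, by simp⟩

lemma mul {M N : M2} (hM : IsG0 p M) (hN : IsG0 p N) : IsG0 p (M * N) := by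
  refine ⟨by rw [det_mul, hM.1, hN.1, mul_one], ?_⟩
  simp only [mul_apply, Fin.sum_univ_two]
  exact dvd_add (Dvd.dvd.mul_right hM.2 _) (Dvd.dvd.mul_left hN.2 _)

lemma neg {M : M2} (hM : IsG0 p M) : IsG0 p (-M) :=
  ⟨by rw [det_neg, hM.1]; simp, by simpa using hM.2⟩

lemma inv {M : M2} (hM : IsG0 p M) : IsG0 p M.adjugate := by
  refine ⟨by rw [det_adjugate, hM.1]; simp, ?_⟩
  rw [adjugate_fin_two]
  simpa using hM.2

lemma inv_mul {M : M2} (hM : IsG0 p M) : M.adjugate * M = 1 := by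
  rw [adjugate_mul, hM.1, one_smul]

lemma mul_inv {M : M2} (hM : IsG0 p M) : M * M.adjugate = 1 := by
  rw [mul_adjugate, hM.1, one_smul]

lemma mob_inv {M : M2} (hM : IsG0 p M) {z : ℂ} (hz : 0 < z.im) :
    mob M.adjugate (mob M z) = z := by
  rw [← mob_mul _ hM.det_pos hz, hM.inv_mul, mob_one]

end IsG0

lemma IsR.mul_left {p : ℕ} {n : ℤ} {γ M : M2} (hγ : IsG0 p γ) (hM : IsR p n M) :
    IsR p n (γ * M) := by
  refine ⟨by rw [det_mul, hM.1, hγ.1, one_mul], ?_⟩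
  simp only [mul_apply, Fin.sum_univ_two]
  exact dvd_add (Dvd.dvd.mul_right hγ.2 _) (Dvd.dvd.mul_left hM.2 _)

lemma IsR.mul_right {p : ℕ} {n : ℤ} {γ M : M2} (hM : IsR p n M) (hγ : IsG0 p γ) :
    IsR p n (M * γ) := by
  refine ⟨by rw [det_mul, hM.1, hγ.1, mul_one], ?_⟩
  simp only [mul_apply, Fin.sum_univ_two]
  exact dvd_add (Dvd.dvd.mul_right hM.2 _) (Dvd.dvd.mul_left hγ.2 _)

lemma det_wMat (p : ℕ) : (wMat p).det = p := by simp [wMat, det_fin_two]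

lemma mob_wMat (p : ℕ) (z : ℂ) : mob (wMat p) z = -1 / (p * z) := by simp [mob, mden, wMat]

lemma mob_wMat_wMat {p : ℕ} (hp : 0 < p) (z : ℂ) : mob (wMat p) (mob (wMat p) z) = z := by
  have : (p : ℂ) ≠ 0 := by exact_mod_cast hp.ne'
  rw [mob_wMat, mob_wMat]
  rcases eq_or_ne z 0 with rfl | hz
  · simp
  · field_simp

lemma mob_eq_coe_smul (g : SpecialLinearGroup (Fin 2) ℤ) (z : UpperHalfPlane) :
    ((g • z : UpperHalfPlane) : ℂ) = mob (g : M2) z := by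
  rw [UpperHalfPlane.coe_specialLinearGroup_apply]
  simp [mob, mden]

/-- A Siegel-type set for `Γ₀(p)`: every point is equivalent to a high point or to the image of a
high point under the Fricke involution. -/
lemma exists_reduction {p : ℕ} (hp : p.Prime) {z : ℂ} (hz : 0 < z.im) :
    ∃ γ : M2, IsG0 p γ ∧ ∃ v : ℂ, |v.re| ≤ 2 ∧ 1 / (2 * p : ℝ) ≤ v.im ∧
      (mob γ z = v ∨ mob γ z = mob (wMat p) v) := by
  obtain ⟨g, hg⟩ := ModularGroup.exists_smul_mem_fd ⟨z, hz⟩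
  set u := g • (⟨z, hz⟩ : UpperHalfPlane) with hu
  have hp0 : (0 : ℝ) < p := by exact_mod_cast hp.pos
  have hp1 : (1 : ℝ) ≤ p := by exact_mod_cast hp.one_le
  have huz : (u : ℂ) = mob (g : M2) z := by rw [hu, mob_eq_coe_smul]
  have hre : |(u : ℂ).re| ≤ 1 / 2 := hg.2
  have him : 1 / 2 ≤ (u : ℂ).im := by
    have h1 := ModularGroup.three_le_four_mul_im_sq_of_mem_fd hg
    have h2 : 0 < u.im := u.2
    have h3 : (1 : ℝ) / 2 ≤ u.im := by nlinarith
    exact h3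
  have hdet : (g : M2).det = 1 := g.2
  have hdet' : (g : M2) 0 0 * (g : M2) 1 1 - (g : M2) 0 1 * (g : M2) 1 0 = 1 := by
    rw [← det_fin_two]; exact hdet
  by_cases hc : (p : ℤ) ∣ (g : M2) 1 0
  · refine ⟨g, ⟨hdet, hc⟩, u, hre.trans (by norm_num), ?_, Or.inl huz.symm⟩
    refine le_trans ?_ him
    rw [div_le_div_iff₀ (by positivity) (by norm_num)]
    linarith
  · have hcop : IsCoprime ((g : M2) 1 0) (p : ℤ) := by
      rw [isCoprime_comm]
      exact (Nat.prime_iff_prime_int.1 hp).coprime_iff_not_dvd.2 hc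
    obtain ⟨x, y, hxy⟩ := hcop
    -- `j` solves `d + j c = 0` modulo `p`
    set j : ℤ := (-((g : M2) 0 0 * x)) % p with hj
    have hj0 : 0 ≤ j := Int.emod_nonneg _ (by exact_mod_cast hp.pos.ne')
    have hjp : j < p := Int.emod_lt_of_pos _ (by exact_mod_cast hp.pos)
    have hdvd : (p : ℤ) ∣ (g : M2) 0 0 + j * (g : M2) 1 0 := by
      obtain ⟨m, hm⟩ : ∃ m, j = -((g : M2) 0 0 * x) + p * m :=
        ⟨-(-((g : M2) 0 0 * x) / p), by
          have := Int.emod_add_mul_ediv (-((g : M2) 0 0 * x)) p; rw [hj]; linarith⟩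
      refine ⟨(g : M2) 0 0 * y + m * (g : M2) 1 0, ?_⟩
      rw [hm]
      linear_combination (-(g : M2) 0 0) * hxy
    set A : M2 := !![0, -1; 1, j] with hA
    have hAdet : A.det = 1 := by simp [hA, det_fin_two]
    refine ⟨A * g, ⟨by rw [det_mul, hAdet, hdet, one_mul], ?_⟩, ((u : ℂ) + j) / p, ?_, ?_, ?_⟩
    · simpa [hA, mul_apply, Fin.sum_univ_two] using hdvd
    · have : (((u : ℂ) + j) / p).re = ((u : ℂ).re + j) / p := by
        have : ((p : ℂ)) = ((p : ℝ) : ℂ) := by simp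
        rw [this, div_ofReal_re]; simp
      rw [this, abs_div, abs_of_pos hp0, div_le_iff₀ hp0]
      have h1 : (j : ℝ) ≤ p := by exact_mod_cast hjp.le
      have h2 : (0 : ℝ) ≤ j := by exact_mod_cast hj0
      have := abs_add_le (u : ℂ).re (j : ℝ)
      rw [abs_of_nonneg h2] at this
      linarith
    · have : (((u : ℂ) + j) / p).im = (u : ℂ).im / p := by
        have : ((p : ℂ)) = ((p : ℝ) : ℂ) := by simp
        rw [this, div_ofReal_im]; simp
      rw [this, div_le_div_iff₀ (by positivity) hp0]
      nlinarith
    · right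
      rw [mob_mul _ (by rw [hdet]; norm_num) hz, ← huz, mob_wMat]
      have : (p : ℂ) ≠ 0 := by exact_mod_cast hp.pos.ne'
      rw [mul_div_cancel₀ _ this]
      simp [mob, mden, hA]

lemma finite_matrix_of_bound (L : ℝ) : {M : M2 | ∀ i j, |((M i j : ℤ) : ℝ)| ≤ L}.Finite := by
  have h : {M : M2 | ∀ i j, |((M i j : ℤ) : ℝ)| ≤ L} ⊆
      Set.pi Set.univ (fun _ : Fin 2 => Set.pi Set.univ
        (fun _ : Fin 2 => Set.Icc (-⌈L⌉) ⌈L⌉)) := by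
    intro M hM i _ j _
    have h1 := (abs_le.1 (hM i j))
    have h2 := Int.le_ceil L
    constructor
    · have : (-(⌈L⌉ : ℤ) : ℝ) ≤ (M i j : ℝ) := by linarith
      exact_mod_cast this
    · have : (M i j : ℝ) ≤ (⌈L⌉ : ℝ) := by linarith
      exact_mod_cast this
  exact (Set.Finite.pi fun _ => Set.Finite.pi fun _ => Set.finite_Icc _ _).subset h

/-- Discreteness of the set of integral matrices of fixed determinant. -/
lemma finite_mob_inter {n : ℤ} (hn : 0 < n) {K : Set ℂ} (hK : IsCompact K)
    (hK' : ∀ z ∈ K, 0 < z.im) :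
    {M : M2 | M.det = n ∧ ∃ z ∈ K, mob M z ∈ K}.Finite := by
  rcases K.eq_empty_or_nonempty with rfl | hne
  · simp
  obtain ⟨B, hB⟩ := hK.isBounded.exists_norm_le
  obtain ⟨z₀, hz₀, hmin⟩ := hK.exists_isMinOn hne continuous_im.continuousOn
  set ε := z₀.im with hε
  have hεpos : 0 < ε := hK' _ hz₀
  have hεle : ∀ z ∈ K, ε ≤ z.im := fun z hz => hmin hz
  have hB0 : 0 < B := lt_of_lt_of_le hεpos ((le_abs_self _).trans
    ((abs_im_le_norm z₀).trans (hB _ hz₀)))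
  have hnR : (0 : ℝ) < n := by exact_mod_cast hn
  set D := Real.sqrt (n * B / ε) with hD
  have hD0 : 0 ≤ D := Real.sqrt_nonneg _
  -- bound for one row of the matrix
  have row : ∀ (a b : ℤ) (z : ℂ) (R : ℝ), z ∈ K → 0 ≤ R → ‖(a : ℂ) * z + b‖ ≤ R →
      |(a : ℝ)| ≤ R / ε + R + R / ε * B ∧ |(b : ℝ)| ≤ R / ε + R + R / ε * B := by
    intro a b z R hz hR h
    have h1 : |(a : ℝ)| ≤ R / ε := by
      rw [le_div_iff₀ hεpos]
      have := (abs_im_le_norm ((a : ℂ) * z + b)).trans h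
      simp only [add_im, mul_im, intCast_re, intCast_im, zero_mul, add_zero, abs_mul] at this
      refine le_trans ?_ this
      exact mul_le_mul_of_nonneg_left ((hεle z hz).trans (le_abs_self _)) (abs_nonneg _)
    have h2 : |(b : ℝ)| ≤ R + R / ε * B := by
      have : ‖(b : ℂ)‖ ≤ ‖(a : ℂ) * z + b‖ + ‖(a : ℂ) * z‖ := by
        have := norm_sub_le ((a : ℂ) * z + b) ((a : ℂ) * z)
        simpa using this
      rw [norm_mul] at this
      simp only [norm_intCast] at this
      have h3 := mul_le_mul h1 (hB z hz) (norm_nonneg z) (by positivity)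
      linarith
    have h4 : 0 ≤ R / ε := by positivity
    have h5 : 0 ≤ R / ε * B := by positivity
    constructor <;> linarith
  set R := D + B * D with hR
  have hR0 : 0 ≤ R := by positivity
  refine (finite_matrix_of_bound (R / ε + R + R / ε * B)).subset ?_
  rintro M ⟨hdet, z, hz, hMz⟩
  have hMpos : 0 < M.det := by rw [hdet]; exact hn
  have hzpos := hK' z hz
  have hden : ‖mden M z‖ ≤ D := by
    rw [hD]
    apply Real.le_sqrt_of_sq_le
    have h1 := mob_im hMpos hzpos
    have h2 : 0 < normSq (mden M z) := normSq_pos.2 (mden_ne_zero hMpos hzpos)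
    rw [eq_div_iff h2.ne', hdet] at h1
    rw [← normSq_eq_norm_sq, le_div_iff₀ hεpos]
    have h3 := mul_le_mul_of_nonneg_right (hεle _ hMz) h2.le
    have h4 : z.im ≤ B := (le_abs_self _).trans ((abs_im_le_norm z).trans (hB z hz))
    have h5 := mul_le_mul_of_nonneg_left h4 hnR.le
    nlinarith
  have hnum : ‖(M 0 0 : ℂ) * z + (M 0 1 : ℂ)‖ ≤ B * D := by
    have : (M 0 0 : ℂ) * z + (M 0 1 : ℂ) = mob M z * mden M z := by
      rw [mob, div_mul_cancel₀ _ (mden_ne_zero hMpos hzpos)]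
    rw [this, norm_mul]
    exact mul_le_mul (hB _ hMz) hden (norm_nonneg _) hB0.le
  have hBD : 0 ≤ B * D := by positivity
  have r1 := row _ _ z R hz hR0 (hnum.trans (by linarith))
  have r2 := row _ _ z R hz hR0 (le_trans (show ‖(M 1 0 : ℂ) * z + (M 1 1 : ℂ)‖ ≤ D from hden)
    (by linarith))
  intro i j
  fin_cases i <;> fin_cases j
  exacts [r1.1, r1.2, r2.1, r2.2]

lemma exists_compact_nhds {z w : ℂ} (hz : 0 < z.im) (hw : 0 < w.im) :
    ∃ K : Set ℂ, IsCompact K ∧ K ∈ 𝓝 z ∧ K ∈ 𝓝 w ∧ ∀ u ∈ K, 0 < u.im := by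
  obtain ⟨K₁, h1, h2, h3⟩ := local_compact_nhds (isOpen_upper.mem_nhds hz)
  obtain ⟨K₂, h1', hsub, h3'⟩ := local_compact_nhds (isOpen_upper.mem_nhds hw)
  refine ⟨K₁ ∪ K₂, h3.union h3', mem_of_superset h1 Set.subset_union_left,
    mem_of_superset h1' Set.subset_union_right, ?_⟩
  rintro u (hu | hu)
  exacts [h2 hu, hsub hu]

/-- Near `(z, w)`, matrices of determinant `n` only relate points if they map `z` to `w`. -/
lemma eventually_mob_eq {n : ℤ} (hn : 0 < n) {z w : ℂ} (hz : 0 < z.im) (hw : 0 < w.im) :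
    ∀ᶠ x in 𝓝 z ×ˢ 𝓝 w, ∀ M : M2, M.det = n → mob M x.1 = x.2 → mob M z = w := by
  obtain ⟨K, hK, hKz, hKw, hK'⟩ := exists_compact_nhds hz hw
  have hfin := finite_mob_inter hn hK hK'
  have h1 : ∀ᶠ x in 𝓝 z ×ˢ 𝓝 w,
      ∀ M ∈ {M : M2 | M.det = n ∧ ∃ z ∈ K, mob M z ∈ K}, mob M x.1 = x.2 → mob M z = w := by
    rw [hfin.eventually_all]
    rintro M ⟨hM, -⟩
    by_cases h : mob M z = w
    · exact Eventually.of_forall fun _ _ => h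
    · have hcont : ContinuousAt (mob M) z := (hasDerivAt_mob (by rw [hM]; exact hn) hz).continuousAt
      have h2 : ∀ᶠ x in 𝓝 z ×ˢ 𝓝 w, mob M x.1 ≠ x.2 := by
        rw [← nhds_prod_eq]
        have h3 : ContinuousAt (fun x : ℂ × ℂ => mob M x.1 - x.2) (z, w) :=
          (ContinuousAt.comp (x := (z, w)) (f := Prod.fst) (g := mob M)
            hcont continuousAt_fst).sub continuousAt_snd
        filter_upwards [h3.eventually_ne (sub_ne_zero.2 h)] with x hx using sub_ne_zero.1 hx
      filter_upwards [h2] with x hx h'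
      exact absurd h' hx
  filter_upwards [h1, (eventually_mem_set.2 hKz).prod_mk (eventually_mem_set.2 hKw)] with x hx hx'
    M hM hMx
  exact hx M ⟨hM, x.1, hx'.1, by rw [hMx]; exact hx'.2⟩ hMx

lemma finite_fixing {n : ℤ} (hn : 0 < n) {z : ℂ} (hz : 0 < z.im) :
    {M : M2 | M.det = n ∧ mob M z = z}.Finite := by
  refine (finite_mob_inter hn (isCompact_singleton (x := z)) (by simpa using hz)).subset ?_
  rintro M ⟨h1, h2⟩
  exact ⟨h1, z, rfl, h2⟩

/-- The filter of neighbourhoods of the cusp `i∞`. -/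
abbrev cusp : Filter ℂ := comap Complex.im atTop

instance cusp_neBot : cusp.NeBot := by
  refine comap_neBot fun s hs => ?_
  obtain ⟨a, ha⟩ := mem_atTop_sets.1 hs
  exact ⟨⟨0, a⟩, ha a le_rfl⟩

lemma eventually_cusp_im (B : ℝ) : ∀ᶠ τ in cusp, B < τ.im :=
  tendsto_comap.eventually (eventually_gt_atTop B)

lemma eventually_cusp_iff {P : ℂ → Prop} :
    (∀ᶠ τ in cusp, P τ) ↔ ∃ B : ℝ, ∀ τ : ℂ, B < τ.im → P τ := by
  constructor
  · intro h
    obtain ⟨s, hs, h'⟩ := (eventually_comap.1 h).exists_mem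
    obtain ⟨a, ha⟩ := mem_atTop_sets.1 hs
    exact ⟨a, fun τ hτ => h' _ (ha _ hτ.le) τ rfl⟩
  · rintro ⟨B, hB⟩
    filter_upwards [eventually_cusp_im B] with τ hτ using hB τ hτ

lemma qc_ne_zero (z : ℂ) : qc z ≠ 0 := exp_ne_zero _

lemma norm_qc (z : ℂ) : ‖qc z‖ = Real.exp (-2 * Real.pi * z.im) := by
  rw [qc, norm_exp]
  congr 1
  simp

lemma qc_add (z w : ℂ) : qc (z + w) = qc z * qc w := by
  rw [qc, qc, qc, ← exp_add]; ring_nf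

lemma qc_intCast (n : ℤ) : qc n = 1 := by
  rw [qc]; convert exp_int_mul_two_pi_mul_I n using 2; ring

lemma qc_add_int (z : ℂ) (n : ℤ) : qc (z + n) = qc z := by rw [qc_add, qc_intCast, mul_one]

lemma qc_nat_mul (n : ℕ) (z : ℂ) : qc (n * z) = qc z ^ n := by
  rw [qc, qc, ← Complex.exp_nat_mul]; ring_nf

lemma tendsto_qc : Tendsto qc cusp (𝓝 0) := by
  rw [tendsto_zero_iff_norm_tendsto_zero]
  simp only [norm_qc]
  refine Real.tendsto_exp_atBot.comp ?_
  refine Tendsto.const_mul_atTop_of_neg (by nlinarith [Real.pi_pos]) tendsto_comap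

lemma exists_qc_eq {x : ℂ} (hx : x ≠ 0) : ∃ z : ℂ, qc z = x := by
  refine ⟨log x / (2 * Real.pi * I), ?_⟩
  have : (2 * Real.pi * I : ℂ) ≠ 0 := by simp [Real.pi_ne_zero]
  rw [qc, mul_div_cancel₀ _ this, exp_log hx]

lemma qc_eq_iff {z w : ℂ} : qc z = qc w ↔ ∃ n : ℤ, z = w + n := by
  rw [qc, qc, exp_eq_exp_iff_exists_int]
  have : (2 * Real.pi * I : ℂ) ≠ 0 := by simp [Real.pi_ne_zero]
  refine exists_congr fun n => ?_
  constructor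
  · intro h
    apply mul_left_cancel₀ this
    rw [h]; ring
  · rintro rfl; ring

/-- `F = c q^{-A} exp (u q + (L/2) q² + o(q²))` at the cusp `i∞`, with `c ≠ 0`. -/
def HasJ (F : ℂ → ℂ) (A : ℤ) (c u L : ℂ) : Prop :=
  c ≠ 0 ∧ ∃ ε : ℂ → ℂ, Tendsto (fun τ => ε τ / qc τ ^ 2) cusp (𝓝 0) ∧
    ∀ᶠ τ in cusp, F τ = c * qc τ ^ (-A) * exp (u * qc τ + L / 2 * qc τ ^ 2 + ε τ)

/-- `F = c q^{-A} exp (u q + (L/2) q² + o(q²))` at the cusp `i∞`, for some `c ≠ 0` and `u`. -/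
def HasL2 (F : ℂ → ℂ) (A : ℤ) (L : ℂ) : Prop := ∃ c u : ℂ, HasJ F A c u L

namespace HasJ

variable {F G : ℂ → ℂ} {A B : ℤ} {c u c' u' L M : ℂ}

lemma mul (hF : HasJ F A c u L) (hG : HasJ G B c' u' M) :
    HasJ (fun τ => F τ * G τ) (A + B) (c * c') (u + u') (L + M) := by
  obtain ⟨hc, ε, hε, h⟩ := hF
  obtain ⟨hc', ε', hε', h'⟩ := hG
  refine ⟨mul_ne_zero hc hc', fun τ => ε τ + ε' τ, ?_, ?_⟩
  · simpa only [add_div, add_zero] using hε.add hε'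
  · filter_upwards [h, h'] with τ h1 h2
    rw [h1, h2, neg_add, zpow_add₀ (qc_ne_zero τ), show (u + u') * qc τ + (L + M) / 2 * qc τ ^ 2 +
      (ε τ + ε' τ) = (u * qc τ + L / 2 * qc τ ^ 2 + ε τ) + (u' * qc τ + M / 2 * qc τ ^ 2 + ε' τ)
      by ring, Complex.exp_add (u * qc τ + L / 2 * qc τ ^ 2 + ε τ)]
    ring

lemma inv (hF : HasJ F A c u L) : HasJ (fun τ => (F τ)⁻¹) (-A) c⁻¹ (-u) (-L) := by
  obtain ⟨hc, ε, hε, h⟩ := hF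
  refine ⟨inv_ne_zero hc, fun τ => -ε τ, ?_, ?_⟩
  · simpa only [neg_div, neg_zero] using hε.neg
  · filter_upwards [h] with τ h1
    rw [h1, show -u * qc τ + -L / 2 * qc τ ^ 2 + -ε τ =
      -(u * qc τ + L / 2 * qc τ ^ 2 + ε τ) by ring, exp_neg, mul_inv, mul_inv, ← _root_.zpow_neg]

lemma const {a : ℂ} (ha : a ≠ 0) : HasJ (fun _ => a) 0 a 0 0 :=
  ⟨ha, fun _ => 0, by simp, Eventually.of_forall fun τ => by simp⟩

lemma zpow_qc (A : ℤ) : HasJ (fun τ => qc τ ^ (-A)) A 1 0 0 :=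
  ⟨one_ne_zero, fun _ => 0, by simp, Eventually.of_forall fun τ => by simp⟩

lemma div (hF : HasJ F A c u L) (hG : HasJ G B c' u' M) :
    HasJ (fun τ => F τ / G τ) (A - B) (c / c') (u - u') (L - M) := by
  simpa only [div_eq_mul_inv, sub_eq_add_neg] using hF.mul hG.inv

lemma pow (hF : HasJ F A c u L) (n : ℕ) :
    HasJ (fun τ => F τ ^ n) (n * A) (c ^ n) (n * u) (n * L) := by
  induction n with
  | zero => simpa using const one_ne_zero
  | succ n ih =>
    have := ih.mul hF
    simp only [← pow_succ] at this
    convert this using 1 <;> push_cast <;> ring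

lemma congr (hF : HasJ F A c u L) (h : ∀ᶠ τ in cusp, G τ = F τ) : HasJ G A c u L := by
  obtain ⟨hc, ε, hε, h'⟩ := hF
  refine ⟨hc, ε, hε, ?_⟩
  filter_upwards [h, h'] with τ h1 h2
  rw [h1, h2]

lemma eventually_ne (hF : HasJ F A c u L) : ∀ᶠ τ in cusp, F τ ≠ 0 := by
  obtain ⟨hc, ε, hε, h⟩ := hF
  filter_upwards [h] with τ h1
  rw [h1]
  exact mul_ne_zero (mul_ne_zero hc (zpow_ne_zero _ (qc_ne_zero τ))) (exp_ne_zero _)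

end HasJ

namespace HasL2

variable {F G : ℂ → ℂ} {A B : ℤ} {L M : ℂ}

lemma mul (hF : HasL2 F A L) (hG : HasL2 G B M) :
    HasL2 (fun τ => F τ * G τ) (A + B) (L + M) := by
  obtain ⟨c, u, h⟩ := hF
  obtain ⟨c', u', h'⟩ := hG
  exact ⟨_, _, h.mul h'⟩

lemma inv (hF : HasL2 F A L) : HasL2 (fun τ => (F τ)⁻¹) (-A) (-L) := by
  obtain ⟨c, u, h⟩ := hF
  exact ⟨_, _, h.inv⟩

lemma const {a : ℂ} (ha : a ≠ 0) : HasL2 (fun _ => a) 0 0 := ⟨_, _, HasJ.const ha⟩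

lemma div (hF : HasL2 F A L) (hG : HasL2 G B M) :
    HasL2 (fun τ => F τ / G τ) (A - B) (L - M) := by
  simpa only [div_eq_mul_inv, sub_eq_add_neg] using hF.mul hG.inv

lemma pow (hF : HasL2 F A L) (n : ℕ) : HasL2 (fun τ => F τ ^ n) (n * A) (n * L) := by
  obtain ⟨c, u, h⟩ := hF
  exact ⟨_, _, h.pow n⟩

lemma prod {ι : Type*} (s : Finset ι) {F : ι → ℂ → ℂ} {A : ι → ℤ} {L : ι → ℂ}
    (h : ∀ i ∈ s, HasL2 (F i) (A i) (L i)) :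
    HasL2 (fun τ => ∏ i ∈ s, F i τ) (∑ i ∈ s, A i) (∑ i ∈ s, L i) := by
  classical
  induction s using Finset.induction_on with
  | empty => simpa using const one_ne_zero
  | insert a s ha ih =>
    simp only [Finset.prod_insert ha, Finset.sum_insert ha]
    exact (h a (Finset.mem_insert_self a s)).mul
      (ih fun i hi => h i (Finset.mem_insert_of_mem hi))

lemma congr (hF : HasL2 F A L) (h : ∀ᶠ τ in cusp, G τ = F τ) : HasL2 G A L := by
  obtain ⟨c, u, h'⟩ := hF
  exact ⟨_, _, h'.congr h⟩

end HasL2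

lemma tendsto_qc_sq_coeff {a b : ℂ} {ε : ℂ → ℂ} (hε : Tendsto (fun τ => ε τ / qc τ ^ 2) cusp (𝓝 0)) :
    Tendsto (fun τ => a * qc τ + b * qc τ ^ 2 + ε τ) cusp (𝓝 0) := by
  have h1 : Tendsto ε cusp (𝓝 0) := by
    have := hε.mul (tendsto_qc.pow 2)
    simp only [zero_mul] at this
    refine this.congr fun τ => ?_
    rw [div_mul_cancel₀ _ (pow_ne_zero 2 (qc_ne_zero τ))]
  have := ((tendsto_qc.const_mul a).add ((tendsto_qc.pow 2).const_mul b)).add h1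
  simpa using this

/-- Uniqueness of second order expansions at the cusp. -/
lemma taylor_unique {a b d : ℂ} {ε : ℂ → ℂ} (hε : Tendsto (fun τ => ε τ / qc τ ^ 2) cusp (𝓝 0))
    (h : ∀ᶠ τ in cusp, a + b * qc τ + d * qc τ ^ 2 + ε τ = 0) : a = 0 ∧ b = 0 ∧ d = 0 := by
  have ha : a = 0 := by
    have h1 : Tendsto (fun τ => a + (b * qc τ + d * qc τ ^ 2 + ε τ)) cusp (𝓝 (a + 0)) :=
      (tendsto_qc_sq_coeff hε).const_add a
    have h2 : Tendsto (fun τ => a + (b * qc τ + d * qc τ ^ 2 + ε τ)) cusp (𝓝 0) :=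
      tendsto_const_nhds.congr' (by filter_upwards [h] with τ hτ; rw [← hτ]; ring)
    simpa using tendsto_nhds_unique h1 h2
  subst ha
  have hb : b = 0 := by
    have h1 : Tendsto (fun τ => b + d * qc τ + ε τ / qc τ ^ 2 * qc τ) cusp
        (𝓝 (b + d * 0 + 0 * 0)) :=
      ((tendsto_qc.const_mul d).const_add b).add (hε.mul tendsto_qc)
    have h2 : Tendsto (fun τ => b + d * qc τ + ε τ / qc τ ^ 2 * qc τ) cusp (𝓝 0) := by
      refine tendsto_const_nhds.congr' ?_
      filter_upwards [h] with τ hτ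
      have hq := qc_ne_zero τ
      field_simp
      linear_combination -hτ
    simpa using tendsto_nhds_unique h1 h2
  subst hb
  refine ⟨rfl, rfl, ?_⟩
  have h1 : Tendsto (fun τ => d + ε τ / qc τ ^ 2) cusp (𝓝 (d + 0)) := hε.const_add d
  have h2 : Tendsto (fun τ => d + ε τ / qc τ ^ 2) cusp (𝓝 0) := by
    refine tendsto_const_nhds.congr' ?_
    filter_upwards [h] with τ hτ
    have hq := qc_ne_zero τ
    field_simp
    linear_combination -hτ
  simpa using tendsto_nhds_unique h1 h2

lemma tendsto_norm_qc_zpow_neg {A : ℤ} (hA : A < 0) : Tendsto (fun τ => qc τ ^ (-A)) cusp (𝓝 0) := by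
  obtain ⟨m, rfl⟩ : ∃ m : ℕ, A = -(m + 1 : ℕ) := ⟨(-A - 1).toNat, by push_cast; omega⟩
  simp only [neg_neg, zpow_natCast]
  simpa using tendsto_qc.pow (m + 1)

lemma HasJ.unique {F : ℂ → ℂ} {A B : ℤ} {c u c' u' L M : ℂ} (hF : HasJ F A c u L)
    (hG : HasJ F B c' u' M) : A = B ∧ c = c' ∧ u = u' ∧ L = M := by
  have hFG : HasJ (fun _ => 1) (A - B) (c / c') (u - u') (L - M) := by
    refine (hF.div hG).congr ?_
    filter_upwards [hF.eventually_ne] with τ h1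
    rw [div_self h1]
  -- only the exponent `0` is compatible with the constant function
  have key : ∀ {A : ℤ} {c u L : ℂ}, HasJ (fun _ => 1) A c u L → ¬ A < 0 := by
    rintro A c u L ⟨hc, ε, hε, h⟩ hA
    have h1 : Tendsto (fun τ => c * qc τ ^ (-A) * exp (u * qc τ + L / 2 * qc τ ^ 2 + ε τ)) cusp
        (𝓝 (c * 0 * exp 0)) :=
      ((tendsto_norm_qc_zpow_neg hA).const_mul c).mul
        ((continuous_exp.tendsto 0).comp (tendsto_qc_sq_coeff hε))
    have h2 := h1.congr' (h.mono fun τ hτ => hτ.symm)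
    simpa using tendsto_nhds_unique h2 tendsto_const_nhds
  have hAB : A - B = 0 := by
    have h1 := key hFG
    have h2 := key (by simpa using hFG.inv : HasJ (fun _ => 1) (B - A) (c' / c) (u' - u) (M - L))
    omega
  rw [hAB] at hFG
  obtain ⟨hc, ε, hε, h⟩ := hFG
  have hlim := tendsto_qc_sq_coeff (a := u - u') (b := (L - M) / 2) hε
  simp only [neg_zero, zpow_zero, mul_one] at h
  have hc1 : c / c' = 1 := by
    have h1 := ((continuous_exp.tendsto 0).comp hlim).const_mul (c / c')
    have h2 := h1.congr' (h.mono fun τ hτ => hτ.symm)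
    simpa using (tendsto_nhds_unique h2 tendsto_const_nhds)
  rw [hc1] at h
  have hz : ∀ᶠ τ in cusp, 0 + (u - u') * qc τ + (L - M) / 2 * qc τ ^ 2 + ε τ = 0 := by
    filter_upwards [h, hlim.eventually (Metric.ball_mem_nhds 0 one_pos)] with τ h1 h2
    rw [one_mul] at h1
    have h3 := exp_eq_one_iff.1 h1.symm
    obtain ⟨n, hn⟩ := h3
    rw [zero_add]
    have h2' : ‖(u - u') * qc τ + (L - M) / 2 * qc τ ^ 2 + ε τ‖ < 1 := by simpa using h2
    rw [hn] at h2' ⊢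
    have hn0 : n = 0 := by
      by_contra hne
      have : (1 : ℝ) ≤ |(n : ℝ)| := by exact_mod_cast Int.one_le_abs hne
      simp only [norm_mul, norm_intCast, norm_real, norm_I, mul_one, Complex.norm_ofNat,
        Real.norm_eq_abs, abs_of_pos Real.pi_pos] at h2'
      nlinarith [Real.pi_gt_three]
    simp [hn0]
  obtain ⟨-, h1, h2⟩ := taylor_unique hε hz
  exact ⟨by omega, (div_eq_one_iff_eq hG.1).1 hc1, sub_eq_zero.1 h1,
    sub_eq_zero.1 (by simpa using h2)⟩

lemma HasL2.unique {F : ℂ → ℂ} {A B : ℤ} {L M : ℂ} (hF : HasL2 F A L) (hG : HasL2 F B M) :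
    A = B ∧ L = M := by
  obtain ⟨c, u, h⟩ := hF
  obtain ⟨c', u', h'⟩ := hG
  exact ⟨(h.unique h').1, (h.unique h').2.2.2⟩

lemma hasJ_of_taylor {F ε : ℂ → ℂ} {A : ℤ} {c f₁ f₂ : ℂ} (hc : c ≠ 0)
    (hε : Tendsto (fun τ => ε τ / qc τ ^ 2) cusp (𝓝 0))
    (h : ∀ᶠ τ in cusp, F τ = c * qc τ ^ (-A) * (1 + f₁ * qc τ + f₂ * qc τ ^ 2 + ε τ)) :
    HasJ F A c f₁ (2 * f₂ - f₁ ^ 2) := by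
  set y : ℂ → ℂ := fun τ => f₁ * qc τ + f₂ * qc τ ^ 2 + ε τ with hy
  have hy0 : Tendsto y cusp (𝓝 0) := tendsto_qc_sq_coeff hε
  have hysmall : ∀ᶠ τ in cusp, ‖y τ‖ < 1 / 2 := by
    filter_upwards [hy0.eventually (Metric.ball_mem_nhds 0 (show (0 : ℝ) < 1 / 2 by norm_num))]
      with τ hτ
    simpa using hτ
  set a : ℂ → ℂ := fun τ => y τ / qc τ with ha
  have ha' : ∀ τ, a τ = f₁ + f₂ * qc τ + ε τ / qc τ ^ 2 * qc τ := by
    intro τ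
    have := qc_ne_zero τ
    rw [ha, hy]; field_simp
  have halim : Tendsto a cusp (𝓝 f₁) := by
    have : Tendsto (fun τ => f₁ + f₂ * qc τ + ε τ / qc τ ^ 2 * qc τ) cusp
        (𝓝 (f₁ + f₂ * 0 + 0 * 0)) :=
      ((tendsto_qc.const_mul _).const_add _).add (hε.mul tendsto_qc)
    simp only [mul_zero, add_zero] at this
    exact this.congr fun τ => (ha' τ).symm
  refine ⟨hc, fun τ => log (1 + y τ) - (f₁ * qc τ + (2 * f₂ - f₁ ^ 2) / 2 * qc τ ^ 2),
    ?_, ?_⟩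
  · set r : ℂ → ℂ := fun τ => (log (1 + y τ) - (y τ - y τ ^ 2 / 2)) / qc τ ^ 2 with hr
    have hrlim : Tendsto r cusp (𝓝 0) := by
      have hb : Tendsto (fun τ => ‖a τ‖ ^ 2 * ‖y τ‖) cusp (𝓝 0) := by
        have := (halim.norm.pow 2).mul hy0.norm
        simpa using this
      refine squeeze_zero_norm' ?_ hb
      filter_upwards [hysmall] with τ hτ
      have h1 := norm_log_sub_logTaylor_le 2 (lt_trans hτ (by norm_num))
      have h2 : logTaylor 3 (y τ) = y τ - y τ ^ 2 / 2 := by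
        simp [logTaylor, Finset.sum_range_succ]; ring
      rw [h2] at h1
      have hq : 0 < ‖qc τ‖ := norm_pos_iff.2 (qc_ne_zero τ)
      rw [hr, norm_div, norm_pow, ha, norm_div, div_le_iff₀ (by positivity)]
      have h3 : (1 - ‖y τ‖)⁻¹ ≤ 2 := by
        rw [inv_le_comm₀ (by linarith) (by norm_num)]; linarith
      have h4 : (‖y τ‖ / ‖qc τ‖) ^ 2 * ‖y τ‖ * ‖qc τ‖ ^ 2 = ‖y τ‖ ^ 3 := by field_simp
      rw [h4]
      refine h1.trans ?_
      have h5 : 0 ≤ ‖y τ‖ ^ 3 := by positivity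
      norm_num
      nlinarith
    have hlim : Tendsto (fun τ => ε τ / qc τ ^ 2 - (a τ ^ 2 - f₁ ^ 2) / 2 + r τ) cusp
        (𝓝 (0 - (f₁ ^ 2 - f₁ ^ 2) / 2 + 0)) :=
      (hε.sub (((halim.pow 2).sub_const _).div_const 2)).add hrlim
    simp only [sub_self, zero_div, add_zero] at hlim
    refine hlim.congr fun τ => ?_
    have hq := qc_ne_zero τ
    rw [hr, ha]
    simp only [hy]
    field_simp
    ring
  · filter_upwards [h, hysmall] with τ h1 h2
    have h3 : 1 + y τ ≠ 0 := by
      intro h0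
      have : y τ = -1 := by linear_combination h0
      rw [this] at h2
      norm_num at h2
    rw [h1, show f₁ * qc τ + (2 * f₂ - f₁ ^ 2) / 2 * qc τ ^ 2 +
      (log (1 + y τ) - (f₁ * qc τ + (2 * f₂ - f₁ ^ 2) / 2 * qc τ ^ 2)) = log (1 + y τ) by ring,
      exp_log h3, hy]
    ring

lemma dedekindEta_eq (z : ℂ) : dedekindEta z = ModularForm.eta z := by
  rw [dedekindEta, ModularForm.eta, Function.Periodic.qParam]
  congr 1
  · congr 1; push_cast; ring
  · exact tprod_congr fun n => by rw [ModularForm.eta_q_eq_cexp]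

lemma dedekindEta_ne_zero {z : ℂ} (hz : 0 < z.im) : dedekindEta z ≠ 0 := by
  rw [dedekindEta_eq]; exact ModularForm.eta_ne_zero hz

lemma differentiableAt_dedekindEta {z : ℂ} (hz : 0 < z.im) :
    DifferentiableAt ℂ dedekindEta z := by
  rw [show dedekindEta = ModularForm.eta from funext dedekindEta_eq]
  exact ModularForm.differentiableAt_eta_of_mem_upperHalfPlaneSet hz

lemma sqrt_sq' {z : ℂ} (hz : z ≠ 0) : z.sqrt ^ 2 = z := by
  rw [sqrt_eq_exp hz, ← Complex.exp_nat_mul]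
  convert exp_log hz using 2
  push_cast
  ring

lemma dedekindEta_S_sq {z : ℂ} (hz : 0 < z.im) :
    dedekindEta (-1 / z) ^ 2 = -I * z * dedekindEta z ^ 2 := by
  have h := ModularForm.eta_comp_eq_csqrt_I_inv hz
  simp only [Function.comp_apply, Pi.smul_apply, Pi.mul_apply, smul_eq_mul] at h
  rw [dedekindEta_eq, dedekindEta_eq, h, mul_pow, mul_pow, inv_pow, sqrt_sq' I_ne_zero, sqrt_sq' (by rintro rfl; simp at hz), inv_I]
  ring

lemma dedekindEta_T (z : ℂ) :
    dedekindEta (z + 1) = exp (Real.pi * I / 12) * dedekindEta z := by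
  rw [dedekindEta, dedekindEta, ← mul_assoc, ← Complex.exp_add]
  congr 1
  · congr 1; ring
  · refine tprod_congr fun n => ?_
    congr 1
    have h : 2 * (Real.pi : ℂ) * I * ((n : ℂ) + 1) * (z + 1) =
        2 * Real.pi * I * ((n : ℂ) + 1) * z + (n + 1 : ℕ) * (2 * Real.pi * I) := by push_cast; ring
    rw [h, Complex.exp_add, exp_nat_mul_two_pi_mul_I, mul_one]

lemma pow_val_add {m : ℕ} [NeZero m] {ζ : ℂ} (hζ : ζ ^ m = 1) (x y : ZMod m) :
    ζ ^ (x + y).val = ζ ^ x.val * ζ ^ y.val := by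
  rw [ZMod.val_add, ← pow_add, ← pow_eq_pow_mod _ hζ]

/-- The multiplier system of `η ^ (2w)`, with `w m = 12`, factors through reduction modulo `m` as
soon as there is a compatible function `f` on matrices modulo `m`. -/
lemma dedekindEta_pow_mob {m w : ℕ} [NeZero m] (hmw : m * w = 12)
    (f : ZMod m → ZMod m → ZMod m → ZMod m → ZMod m) (s : ZMod m) {ζ : ℂ}
    (hζ : exp (Real.pi * I / 12) ^ (2 * w) = ζ) (hs : (-I) ^ w = ζ ^ s.val)
    (hf1 : f 1 0 0 1 = 0)
    (hfT : ∀ a b c d : ZMod m, a * d - b * c = 1 → f (a + c) (b + d) c d = f a b c d + 1)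
    (hfS : ∀ a b c d : ZMod m, a * d - b * c = 1 → f (-c) (-d) a b = f a b c d + s)
    (γ : M2) (hγ : γ.det = 1) {z : ℂ} (hz : 0 < z.im) :
    dedekindEta (mob γ z) ^ (2 * w) =
      ζ ^ (f (γ 0 0) (γ 0 1) (γ 1 0) (γ 1 1)).val * mden γ z ^ w * dedekindEta z ^ (2 * w) := by
  have hζm : ζ ^ m = 1 := by
    rw [← hζ, ← pow_mul, ← Complex.exp_nat_mul, show 2 * w * m = 24 by linarith]
    convert exp_two_pi_mul_I using 2
    push_cast
    ring
  have hone : ∀ x : ZMod m, ζ ^ (x + 1).val = ζ ^ x.val * ζ := by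
    intro x
    rw [pow_val_add hζm, ZMod.val_one_eq_one_mod, ← pow_eq_pow_mod _ hζm, pow_one]
  set Pr : M2 → Prop := fun γ => ∀ z : ℂ, 0 < z.im →
    dedekindEta (mob γ z) ^ (2 * w) =
      ζ ^ (f (γ 0 0) (γ 0 1) (γ 1 0) (γ 1 1)).val * mden γ z ^ w * dedekindEta z ^ (2 * w) with hPr
  have hdetm : ∀ γ : M2, γ.det = 1 →
      ((γ 0 0 : ℤ) : ZMod m) * (γ 1 1 : ℤ) - (γ 0 1 : ℤ) * (γ 1 0 : ℤ) = 1 := by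
    intro γ this
    rw [det_fin_two] at this
    exact_mod_cast congrArg (Int.cast : ℤ → ZMod m) this
  have hT : ∀ γ : M2, γ.det = 1 → (Pr (!![1, 1; 0, 1] * γ) ↔ Pr γ) := by
    intro γ hdet
    refine forall₂_congr fun z hz => ?_
    have hd : 0 < γ.det := by rw [hdet]; norm_num
    have hden : mden (!![1, 1; 0, 1] * γ) z = mden γ z := by
      simp [mden, mul_apply, Fin.sum_univ_two]
    have hmob : mob (!![1, 1; 0, 1] * γ) z = mob γ z + 1 := by
      rw [mob_mul _ hd hz]
      simp [mob, mden]
    have he : (!![1, 1; 0, 1] * γ : M2) 0 0 = γ 0 0 + γ 1 0 ∧ (!![1, 1; 0, 1] * γ : M2) 0 1 = γ 0 1 + γ 1 1 ∧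
        (!![1, 1; 0, 1] * γ : M2) 1 0 = γ 1 0 ∧ (!![1, 1; 0, 1] * γ : M2) 1 1 = γ 1 1 := by
      simp [mul_apply, Fin.sum_univ_two]
    rw [hden, hmob, he.1, he.2.1, he.2.2.1, he.2.2.2, dedekindEta_T, mul_pow, hζ]
    push_cast
    rw [hfT _ _ _ _ (hdetm γ hdet), hone]
    have hζ0 : ζ ≠ 0 := by rw [← hζ]; exact pow_ne_zero _ (exp_ne_zero _)
    constructor
    · intro h
      apply mul_left_cancel₀ hζ0
      rw [h]; ring
    · intro h
      rw [h]; ring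
  have hS : ∀ γ : M2, γ.det = 1 → (Pr (!![0, -1; 1, 0] * γ) ↔ Pr γ) := by
    intro γ hdet
    refine forall₂_congr fun z hz => ?_
    have hd : 0 < γ.det := by rw [hdet]; norm_num
    have hγz : 0 < (mob γ z).im := mob_im_pos hd hz
    have hγz0 : mob γ z ≠ 0 := by intro h; rw [h] at hγz; simp at hγz
    have hden : mden (!![0, -1; 1, 0] * γ) z =
        mob γ z * mden γ z := by
      rw [mob, div_mul_cancel₀ _ (mden_ne_zero hd hz)]
      simp [mden, mul_apply, Fin.sum_univ_two]
    have hmob : mob (!![0, -1; 1, 0] * γ) z = -1 / mob γ z := by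
      rw [mob_mul _ hd hz]
      simp [mob, mden]
    have he : (!![0, -1; 1, 0] * γ : M2) 0 0 = -γ 1 0 ∧ (!![0, -1; 1, 0] * γ : M2) 0 1 = -γ 1 1 ∧
        (!![0, -1; 1, 0] * γ : M2) 1 0 = γ 0 0 ∧ (!![0, -1; 1, 0] * γ : M2) 1 1 = γ 0 1 := by
      simp [mul_apply, Fin.sum_univ_two]
    rw [hden, hmob, he.1, he.2.1, he.2.2.1, he.2.2.2, pow_mul, dedekindEta_S_sq hγz, mul_pow,
      mul_pow, ← pow_mul, hs]
    push_cast
    rw [hfS _ _ _ _ (hdetm γ hdet), pow_val_add hζm, mul_pow]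
    have hζ0 : ζ ≠ 0 := by rw [← hζ]; exact pow_ne_zero _ (exp_ne_zero _)
    constructor
    · intro h
      apply mul_left_cancel₀ (mul_ne_zero (pow_ne_zero s.val hζ0) (pow_ne_zero w hγz0))
      rw [h]; ring
    · intro h
      rw [h]; ring
  have hall : ∀ γ : SpecialLinearGroup (Fin 2) ℤ, Pr γ.1 := by
    intro γ
    have hγ : γ ∈ Subgroup.closure {ModularGroup.S, ModularGroup.T} := by
      simp [SpecialLinearGroup.SL2Z_generators]
    induction hγ using Subgroup.closure_induction_left with
    | one =>
      intro z hz
      simp [mob, mden, hf1]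
    | mul_left x hx y hy ih =>
      rcases hx with rfl | rfl
      · exact (hS y.1 y.2).2 ih
      · exact (hT y.1 y.2).2 ih
    | inv_mul_cancel x hx y hy ih =>
      rcases hx with rfl | rfl
      · have h := mul_inv_cancel_left ModularGroup.S y
        exact (hS _ (ModularGroup.S⁻¹ * y).2).1 (by rw [← h] at ih; exact ih)
      · have h := mul_inv_cancel_left ModularGroup.T y
        exact (hT _ (ModularGroup.T⁻¹ * y).2).1 (by rw [← h] at ih; exact ih)
  exact hall ⟨γ, hγ⟩ z hz

lemma im_natCast_mul {p : ℕ} (hp : 0 < p) {z : ℂ} (hz : 0 < z.im) : 0 < ((p : ℂ) * z).im := by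
  have : (0 : ℝ) < p := by exact_mod_cast hp
  simpa using mul_pos this hz

/-- The conjugate of an element of `Γ₀(p)` by `z ↦ p z`. -/
lemma exists_conj {p : ℕ} {γ : M2} (hγ : IsG0 p γ) :
    ∃ c : ℤ, γ 1 0 = p * c ∧ (!![γ 0 0, p * γ 0 1; c, γ 1 1] : M2).det = 1 ∧
      ∀ z : ℂ, (p : ℂ) * mob γ z = mob !![γ 0 0, p * γ 0 1; c, γ 1 1] (p * z) ∧
        mden !![γ 0 0, p * γ 0 1; c, γ 1 1] (p * z) = mden γ z := by
  obtain ⟨c, hc⟩ := hγ.2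
  refine ⟨c, hc, ?_, fun z => ?_⟩
  · have := hγ.1
    rw [det_fin_two, hc] at this
    rw [det_fin_two]
    simp only [of_apply, cons_val', cons_val_zero, cons_val_one, cons_val_fin_one]
    linarith
  · have h1 : mden !![γ 0 0, p * γ 0 1; c, γ 1 1] (p * z) = mden γ z := by
      simp [mden, hc]; ring
    refine ⟨?_, h1⟩
    rw [mob, mob, h1, ← mul_div_assoc]
    congr 1
    simp
    ring

lemma eta_quotient_invariant {p m w : ℕ} [NeZero m] (hp : 0 < p) (hpm : (p : ZMod m) = 1)
    (hmw : m * w = 12)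
    (f : ZMod m → ZMod m → ZMod m → ZMod m → ZMod m) (s : ZMod m) {ζ : ℂ}
    (hζ : exp (Real.pi * I / 12) ^ (2 * w) = ζ) (hs : (-I) ^ w = ζ ^ s.val)
    (hf1 : f 1 0 0 1 = 0)
    (hfT : ∀ a b c d : ZMod m, a * d - b * c = 1 → f (a + c) (b + d) c d = f a b c d + 1)
    (hfS : ∀ a b c d : ZMod m, a * d - b * c = 1 → f (-c) (-d) a b = f a b c d + s)
    {γ : M2} (hγ : IsG0 p γ) {z : ℂ} (hz : 0 < z.im) :
    (dedekindEta (mob γ z) / dedekindEta (p * mob γ z)) ^ (2 * w) =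
      (dedekindEta z / dedekindEta (p * z)) ^ (2 * w) := by
  obtain ⟨c, hc, hdet, hconj⟩ := exists_conj hγ
  have h1 := dedekindEta_pow_mob hmw f s hζ hs hf1 hfT hfS γ hγ.1 hz
  have h2 := dedekindEta_pow_mob hmw f s hζ hs hf1 hfT hfS _ hdet (im_natCast_mul hp hz)
  rw [← (hconj z).1, (hconj z).2] at h2
  rw [div_pow, div_pow, h1, h2]
  have hsame : f (γ 0 0) (γ 0 1) (γ 1 0) (γ 1 1) =
      f ((!![γ 0 0, p * γ 0 1; c, γ 1 1] : M2) 0 0) ((!![γ 0 0, p * γ 0 1; c, γ 1 1] : M2) 0 1)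
        ((!![γ 0 0, p * γ 0 1; c, γ 1 1] : M2) 1 0) ((!![γ 0 0, p * γ 0 1; c, γ 1 1] : M2) 1 1) := by
    simp [hc, hpm]
  rw [← hsame]
  have hζ0 : ζ ≠ 0 := by rw [← hζ]; exact pow_ne_zero _ (exp_ne_zero _)
  exact mul_div_mul_left _ _ (mul_ne_zero (pow_ne_zero _ hζ0)
    (pow_ne_zero _ (mden_ne_zero hγ.det_pos hz)))

lemma exp_pi_div_twelve_pow (n : ℕ) :
    exp (Real.pi * I / 12) ^ n = exp (n * (Real.pi * I / 12)) := by rw [Complex.exp_nat_mul]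

lemma eta_quotient_pow_24 {p : ℕ} (hp : 0 < p) {γ : M2} (hγ : IsG0 p γ) {z : ℂ} (hz : 0 < z.im) :
    (dedekindEta (mob γ z) / dedekindEta (p * mob γ z)) ^ 24 =
      (dedekindEta z / dedekindEta (p * z)) ^ 24 := by
  refine eta_quotient_invariant (m := 1) (w := 12) (ζ := 1) hp (Subsingleton.elim _ _) rfl
    (fun _ _ _ _ => 0) 0 ?_ ?_ rfl (by decide) (by decide) hγ hz
  · rw [exp_pi_div_twelve_pow]
    convert exp_two_pi_mul_I using 2
    push_cast; ring
  · rw [one_pow, show 12 = 4 * 3 from rfl, pow_mul, Even.neg_pow (by decide), I_pow_four, one_pow]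

lemma eta_quotient_pow_12 {p : ℕ} (hp : p % 2 = 1) {γ : M2} (hγ : IsG0 p γ) {z : ℂ}
    (hz : 0 < z.im) :
    (dedekindEta (mob γ z) / dedekindEta (p * mob γ z)) ^ 12 =
      (dedekindEta z / dedekindEta (p * z)) ^ 12 := by
  refine eta_quotient_invariant (m := 2) (w := 6) (ζ := -1) (by omega)
    (by rw [← ZMod.natCast_mod, hp]; rfl) rfl
    (fun a b c d => (a + d) * c + b * d * (c + 1) + c) 1 ?_ ?_ (by decide) (by decide) (by decide)
    hγ hz
  · rw [exp_pi_div_twelve_pow]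
    convert exp_pi_mul_I using 2
    push_cast; ring
  · rw [show (1 : ZMod 2).val = 1 from rfl, pow_one, Even.neg_pow (by decide),
      show 6 = 4 + 2 from rfl, pow_add, I_pow_four, I_sq, one_mul]

lemma eta_quotient_pow_8 {p : ℕ} (hp : p % 3 = 1) {γ : M2} (hγ : IsG0 p γ) {z : ℂ}
    (hz : 0 < z.im) :
    (dedekindEta (mob γ z) / dedekindEta (p * mob γ z)) ^ 8 =
      (dedekindEta z / dedekindEta (p * z)) ^ 8 := by
  refine eta_quotient_invariant (m := 3) (w := 4) (by omega)
    (by rw [← ZMod.natCast_mod, hp]; rfl) rfl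
    (fun a b c d => (a + d) * c - b * d * (c * c - 1)) 0 rfl ?_ (by decide) (by decide) (by decide)
    hγ hz
  rw [ZMod.val_zero, pow_zero, Even.neg_pow (by decide), I_pow_four]

lemma eta_quotient_pow_6 {p : ℕ} (hp : p % 4 = 1) {γ : M2} (hγ : IsG0 p γ) {z : ℂ}
    (hz : 0 < z.im) :
    (dedekindEta (mob γ z) / dedekindEta (p * mob γ z)) ^ 6 =
      (dedekindEta z / dedekindEta (p * z)) ^ 6 := by
  refine eta_quotient_invariant (m := 4) (w := 3) (ζ := I) (by omega)
    (by rw [← ZMod.natCast_mod, hp]; rfl) rfl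
    (fun a b c d => if 2 * c = 0 then (a + d) * c - b * d * (c * c - 1) + 3 * d - 3 - 3 * c * d
      else (a + d) * c - b * d * (c * c - 1) - 3 * c) 1 ?_ ?_ (by decide) (by decide) (by decide)
    hγ hz
  · rw [exp_pi_div_twelve_pow]
    convert exp_pi_div_two_mul_I using 2
    push_cast; ring
  · rw [show (1 : ZMod 4).val = 1 from rfl, pow_one, Odd.neg_pow (by decide), I_pow_three, neg_neg]

/-- A power series agrees with its second Taylor polynomial up to third order. -/
lemma exists_taylor_bound {a : ℕ → ℂ} {r : ℝ} (hr : 0 < r)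
    (ha : Summable fun m => a m * (r : ℂ) ^ m) :
    ∃ K : ℝ, 0 ≤ K ∧ ∀ x s : ℂ, ‖x‖ ≤ r / 2 → HasSum (fun m => a m * x ^ m) s →
      ‖s - (a 0 + a 1 * x + a 2 * x ^ 2)‖ ≤ K * ‖x‖ ^ 3 := by
  obtain ⟨B, hB⟩ := ha.norm.tendsto_atTop_zero.bddAbove_range
  have hB' : ∀ m, ‖a m‖ ≤ B / r ^ m := by
    intro m
    rw [le_div_iff₀ (by positivity)]
    have := hB ⟨m, rfl⟩
    simpa [norm_mul, abs_of_pos hr] using this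
  have hB0 : 0 ≤ B := (norm_nonneg _).trans (by simpa using hB' 0)
  refine ⟨2 * B / r ^ 3, by positivity, fun x s hx hs => ?_⟩
  have h3 := (hasSum_nat_add_iff' 3).2 hs
  simp only [Finset.sum_range_succ, Finset.sum_range_zero, zero_add, pow_zero, mul_one, pow_one]
    at h3
  rw [← h3.tsum_eq]
  have hx2 : ‖x‖ / r ≤ 1 / 2 := by rw [div_le_iff₀ hr]; linarith
  have hg : HasSum (fun m => B * (‖x‖ / r) ^ 3 * (1 / 2 : ℝ) ^ m) (B * (‖x‖ / r) ^ 3 * 2) :=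
    hasSum_geometric_two.mul_left _
  refine (tsum_of_norm_bounded hg fun m => ?_).trans (le_of_eq ?_)
  · rw [norm_mul, norm_pow]
    calc ‖a (m + 3)‖ * ‖x‖ ^ (m + 3) ≤ B / r ^ (m + 3) * ‖x‖ ^ (m + 3) := by
          gcongr; exact hB' _
      _ = B * (‖x‖ / r) ^ 3 * (‖x‖ / r) ^ m := by rw [div_pow, div_pow, pow_add, pow_add]; field_simp
      _ ≤ B * (‖x‖ / r) ^ 3 * (1 / 2 : ℝ) ^ m := by gcongr
  · rw [div_pow]; ring

/-- Euler's product. -/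
noncomputable def eulerProd (x : ℂ) : ℂ := ∏' n : ℕ, (1 - x ^ (n + 1))

lemma norm_eulerProd_sub {x : ℂ} (hx : ‖x‖ ≤ 1 / 2) :
    ‖eulerProd x - (1 - x - x ^ 2)‖ ≤ 9 * ‖x‖ ^ 3 := by
  have hm := ModularForm.multipliable_one_sub_pow (q := x) (by linarith)
  have hgeo : HasSum (fun n : ℕ => ‖x‖ ^ 3 * (1 / 2 : ℝ) ^ n) (‖x‖ ^ 3 * 2) :=
    hasSum_geometric_two.mul_left _
  have hfin : ∀ N : ℕ, ‖∏ n ∈ Finset.range N, (1 - x ^ (n + 3)) - 1‖ ≤ 4 * ‖x‖ ^ 3 := by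
    intro N
    have h1 := Finset.norm_prod_one_add_sub_one_le (Finset.range N) fun n => -x ^ (n + 3)
    simp only [← sub_eq_add_neg] at h1
    have h2 : ∑ n ∈ Finset.range N, ‖-x ^ (n + 3)‖ ≤ ‖x‖ ^ 3 * 2 := by
      refine le_trans (Finset.sum_le_sum fun n _ => ?_)
        (sum_le_hasSum (Finset.range N) (fun n _ => by positivity) hgeo)
      rw [norm_neg, norm_pow, pow_add, mul_comm]
      gcongr
    have h3 : ‖x‖ ^ 3 ≤ 1 / 8 := by
      calc ‖x‖ ^ 3 ≤ (1 / 2 : ℝ) ^ 3 := by gcongr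
        _ = 1 / 8 := by norm_num
    have h0 : 0 ≤ ‖x‖ ^ 3 := by positivity
    refine h1.trans ((sub_le_sub_right (Real.exp_le_exp.2 h2) 1).trans ?_)
    have h4 := Real.abs_exp_sub_one_le (x := ‖x‖ ^ 3 * 2)
      (by rw [abs_of_nonneg (by positivity)]; linarith)
    rw [abs_of_nonneg (show 0 ≤ ‖x‖ ^ 3 * 2 by positivity)] at h4
    have := (le_abs_self _).trans h4
    linarith
  have hlim : Tendsto (fun N => ∏ n ∈ Finset.range N, (1 - x ^ (n + 1))) atTop
      (𝓝 (eulerProd x)) := hm.hasProd.tendsto_prod_nat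
  have hb : ∀ N : ℕ, ‖∏ n ∈ Finset.range (N + 2), (1 - x ^ (n + 1)) - (1 - x - x ^ 2)‖ ≤
      9 * ‖x‖ ^ 3 := by
    intro N
    have e1 : ∏ n ∈ Finset.range (N + 2), (1 - x ^ (n + 1)) =
        (∏ n ∈ Finset.range N, (1 - x ^ (n + 3))) * ((1 - x) * (1 - x ^ 2)) := by
      rw [Finset.prod_range_succ', Finset.prod_range_succ']
      ring_nf
    set Q := ∏ n ∈ Finset.range N, (1 - x ^ (n + 3)) with hQ
    have e2 : Q * ((1 - x) * (1 - x ^ 2)) - (1 - x - x ^ 2) =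
        (Q - 1) * ((1 - x) * (1 - x ^ 2)) + x ^ 3 := by ring
    rw [e1, e2]
    have h1 : ‖(1 - x) * (1 - x ^ 2)‖ ≤ 2 := by
      rw [norm_mul]
      have h2 : ‖1 - x‖ ≤ 3 / 2 := (norm_sub_le _ _).trans (by rw [norm_one]; linarith)
      have h3 : ‖1 - x ^ 2‖ ≤ 5 / 4 := by
        refine (norm_sub_le _ _).trans ?_
        rw [norm_one, norm_pow]
        nlinarith [norm_nonneg x]
      nlinarith [norm_nonneg (1 - x), norm_nonneg (1 - x ^ 2)]
    refine (norm_add_le _ _).trans ?_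
    rw [norm_mul, norm_pow]
    have h4 := mul_le_mul (hfin N) h1 (norm_nonneg _) (by positivity)
    linarith
  exact le_of_tendsto ((((tendsto_add_atTop_iff_nat 2).2 hlim).sub_const _).norm)
    (Eventually.of_forall hb)

lemma dedekindEta_eq_eulerProd (z : ℂ) :
    dedekindEta z = exp (Real.pi * I * z / 12) * eulerProd (qc z) := by
  rw [dedekindEta, eulerProd]
  congr 1
  refine tprod_congr fun n => ?_
  rw [qc, ← Complex.exp_nat_mul]
  congr 2
  push_cast
  ring

lemma tendsto_div_sq_of_le {ε : ℂ → ℂ} {K : ℝ} (h : ∀ᶠ τ in cusp, ‖ε τ‖ ≤ K * ‖qc τ‖ ^ 3) :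
    Tendsto (fun τ => ε τ / qc τ ^ 2) cusp (𝓝 0) := by
  have h0 : Tendsto (fun τ => K * ‖qc τ‖) cusp (𝓝 0) := by
    simpa using tendsto_qc.norm.const_mul K
  refine squeeze_zero_norm' ?_ h0
  filter_upwards [h] with τ hτ
  have hq : 0 < ‖qc τ‖ := norm_pos_iff.2 (qc_ne_zero τ)
  rw [norm_div, norm_pow, div_le_iff₀ (by positivity)]
  linarith [hτ, show K * ‖qc τ‖ * ‖qc τ‖ ^ 2 = K * ‖qc τ‖ ^ 3 by ring]

lemma eventually_norm_qc_le {r : ℝ} (hr : 0 < r) : ∀ᶠ τ in cusp, ‖qc τ‖ ≤ r := by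
  filter_upwards [tendsto_qc.eventually (Metric.ball_mem_nhds 0 hr)] with τ hτ
  exact le_of_lt (by simpa using hτ)

lemma hasJ_eulerProd : HasJ (fun τ => eulerProd (qc τ)) 0 1 (-1) (-3) := by
  have h := hasJ_of_taylor (F := fun τ => eulerProd (qc τ)) (A := 0) (c := 1) (f₁ := -1)
    (f₂ := -1) (ε := fun τ => eulerProd (qc τ) - (1 - qc τ - qc τ ^ 2)) one_ne_zero ?_ ?_
  · convert h using 1; norm_num
  · refine tendsto_div_sq_of_le (K := 9) ?_
    filter_upwards [eventually_norm_qc_le (show (0 : ℝ) < 1 / 2 by norm_num)] with τ hτ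
    exact norm_eulerProd_sub hτ
  · refine Eventually.of_forall fun τ => ?_
    simp only [neg_zero, zpow_zero]
    ring

lemma hasJ_eulerProd_pow {p : ℕ} (hp : 2 ≤ p) :
    HasJ (fun τ => eulerProd (qc τ ^ p)) 0 1 0 (if p = 2 then -2 else 0) := by
  have h := hasJ_of_taylor (F := fun τ => eulerProd (qc τ ^ p)) (A := 0) (c := 1) (f₁ := 0)
    (f₂ := if p = 2 then -1 else 0)
    (ε := fun τ => eulerProd (qc τ ^ p) - (1 + (if p = 2 then -1 else 0) * qc τ ^ 2))
    one_ne_zero ?_ ?_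
  · convert h using 1; split_ifs <;> norm_num
  · refine tendsto_div_sq_of_le (K := 11) ?_
    filter_upwards [eventually_norm_qc_le (show (0 : ℝ) < 1 / 2 by norm_num)] with τ hτ
    set x := qc τ
    have hx0 := norm_nonneg x
    have hpow : ∀ m : ℕ, 3 ≤ m → ‖x‖ ^ m ≤ ‖x‖ ^ 3 := fun m hm =>
      pow_le_pow_of_le_one hx0 (by linarith) hm
    have hxp : ‖x ^ p‖ ≤ 1 / 2 := by
      rw [norm_pow]
      calc ‖x‖ ^ p ≤ ‖x‖ ^ 1 := pow_le_pow_of_le_one hx0 (by linarith) (by omega)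
        _ ≤ 1 / 2 := by rwa [pow_one]
    have h1 := norm_eulerProd_sub hxp
    have e : eulerProd (x ^ p) - (1 + (if p = 2 then -1 else 0) * x ^ 2) =
        (eulerProd (x ^ p) - (1 - x ^ p - (x ^ p) ^ 2)) -
          ((x ^ p) ^ 2 + (x ^ p + (if p = 2 then -1 else 0) * x ^ 2)) := by ring
    rw [e]
    refine (norm_sub_le _ _).trans ?_
    have h2 : ‖(x ^ p) ^ 2 + (x ^ p + (if p = 2 then -1 else 0) * x ^ 2)‖ ≤ 2 * ‖x‖ ^ 3 := by
      refine (norm_add_le _ _).trans ?_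
      have h3 : ‖(x ^ p) ^ 2‖ ≤ ‖x‖ ^ 3 := by
        rw [← pow_mul, norm_pow]; exact hpow _ (by omega)
      have h4 : ‖x ^ p + (if p = 2 then -1 else 0) * x ^ 2‖ ≤ ‖x‖ ^ 3 := by
        split_ifs with h
        · subst h; simp
        · rw [zero_mul, add_zero, norm_pow]; exact hpow _ (by omega)
      linarith
    have h5 : ‖x ^ p‖ ^ 3 ≤ ‖x‖ ^ 3 := by
      rw [norm_pow, ← pow_mul]; exact hpow _ (by omega)
    linarith
  · refine Eventually.of_forall fun τ => ?_
    simp only [neg_zero, zpow_zero]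
    ring

/-- The eta quotient `(η(z) / η(pz)) ^ (24 / (p - 1))`. -/
noncomputable def hm (p : ℕ) (z : ℂ) : ℂ := (dedekindEta z / dedekindEta (p * z)) ^ (24 / (p - 1))

/-- The cusp form `(η(z) η(pz)) ^ 24`. -/
noncomputable def etaProd (p : ℕ) (z : ℂ) : ℂ := (dedekindEta z * dedekindEta (p * z)) ^ 24

/-- The properties of the eta quotient `t = q⁻¹ - k + Σ_{n ≥ 1} c(n) qⁿ` and of the cusp form `D`
used in the sequel. -/
structure Haupt (p : ℕ) (k C : ℂ) (c : ℤ → ℂ) (t D G : ℂ → ℂ) : Prop where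
  prime : p.Prime
  C_ne : C ≠ 0
  diff_t : ∀ z : ℂ, 0 < z.im → DifferentiableAt ℂ t z
  t_ne : ∀ z : ℂ, 0 < z.im → t z ≠ 0
  inv : ∀ γ : M2, IsG0 p γ → ∀ z : ℂ, 0 < z.im → t (mob γ z) = t z
  fricke : ∀ z : ℂ, 0 < z.im → t (mob (wMat p) z) = C / t z
  qexp : ∀ z : ℂ, 0 < z.im → t z = (qc z)⁻¹ - k + qc z * G (qc z)
  series : ∃ ps : FormalMultilinearSeries ℂ ℂ ℂ, HasFPowerSeriesAt G ps 0 ∧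
    ∀ m : ℕ, ps.coeff m = c (m + 1)
  k_rel : k ^ 2 - 2 * c 1 = k * (3 - 2 * if p = 2 then 1 else 0)
  diff_D : ∀ z : ℂ, 0 < z.im → DifferentiableAt ℂ D z
  D_ne : ∀ z : ℂ, 0 < z.im → D z ≠ 0
  inv_D : ∀ γ : M2, IsG0 p γ → ∀ z : ℂ, 0 < z.im → D (mob γ z) = mden γ z ^ 24 * D z
  fricke_D : ∀ z : ℂ, 0 < z.im → D (mob (wMat p) z) = p ^ 12 * z ^ 24 * D z
  hasL2_D : HasL2 D (-(p + 1)) (-72 - 48 * if p = 2 then 1 else 0)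

lemma dedekindEta_pow_24_mob {M : M2} (hM : M.det = 1) {z : ℂ} (hz : 0 < z.im) :
    dedekindEta (mob M z) ^ 24 = mden M z ^ 12 * dedekindEta z ^ 24 := by
  have := dedekindEta_pow_mob (m := 1) (w := 12) (ζ := 1) rfl (fun _ _ _ _ => 0) 0
    (by rw [← Complex.exp_nat_mul, ← exp_two_pi_mul_I]; congr 1; push_cast; ring)
    (by rw [one_pow, show (12 : ℕ) = 4 * 3 from rfl, pow_mul, neg_pow, I_pow_four]; norm_num)
    rfl (by decide) (by decide) M hM hz
  simpa using this

lemma etaProd_mob {p : ℕ} (hp : 0 < p) {γ : M2} (hγ : IsG0 p γ) {z : ℂ} (hz : 0 < z.im) :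
    etaProd p (mob γ z) = mden γ z ^ 24 * etaProd p z := by
  obtain ⟨c, -, h1, h2⟩ := exists_conj hγ
  obtain ⟨h3, h4⟩ := h2 z
  rw [etaProd, etaProd, mul_pow, mul_pow, h3, dedekindEta_pow_24_mob hγ.1 hz,
    dedekindEta_pow_24_mob h1 (im_natCast_mul hp hz), h4]
  ring

lemma dedekindEta_wMat_sq {p : ℕ} (hp : 0 < p) {z : ℂ} (hz : 0 < z.im) :
    dedekindEta (mob (wMat p) z) ^ 2 = -I * (p * z) * dedekindEta (p * z) ^ 2 ∧
    dedekindEta (p * mob (wMat p) z) ^ 2 = -I * z * dedekindEta z ^ 2 := by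
  rw [mob_wMat]
  refine ⟨dedekindEta_S_sq (im_natCast_mul hp hz), ?_⟩
  rw [← dedekindEta_S_sq hz]
  congr 2
  have : (p : ℂ) ≠ 0 := by exact_mod_cast hp.ne'
  rcases eq_or_ne z 0 with rfl | h
  · simp
  · field_simp

lemma etaProd_wMat {p : ℕ} (hp : 0 < p) {z : ℂ} (hz : 0 < z.im) :
    etaProd p (mob (wMat p) z) = p ^ 12 * z ^ 24 * etaProd p z := by
  obtain ⟨h1, h2⟩ := dedekindEta_wMat_sq hp hz
  rw [etaProd, etaProd, show (24 : ℕ) = 2 * 12 from rfl, pow_mul, mul_pow, h1, h2]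
  have : (-I * (p * z) * dedekindEta (p * z) ^ 2 * (-I * z * dedekindEta z ^ 2)) ^ 12 =
    (I ^ 4) ^ 6 * (p ^ 12 * z ^ 24 * (dedekindEta z * dedekindEta (p * z)) ^ 24) := by ring
  rw [this, I_pow_four]; ring

lemma hm_wMat {p : ℕ} (hp : p ∈ ({2, 3, 5, 7, 13} : Set ℕ)) {z : ℂ} (hz : 0 < z.im) :
    hm p (mob (wMat p) z) = p ^ (12 / (p - 1)) / hm p z := by
  have hp0 : 0 < p := by rcases hp with rfl | rfl | rfl | rfl | rfl <;> norm_num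
  have he : 24 / (p - 1) = 2 * (12 / (p - 1)) := by
    rcases hp with rfl | rfl | rfl | rfl | rfl <;> norm_num
  obtain ⟨h1, h2⟩ := dedekindEta_wMat_sq hp0 hz
  have h3 := dedekindEta_ne_zero hz
  have h4 := dedekindEta_ne_zero (im_natCast_mul hp0 hz)
  have hz0 : z ≠ 0 := by rintro rfl; simp at hz
  rw [hm, hm, he, pow_mul, pow_mul, ← div_pow]
  congr 1
  rw [div_pow, h1, h2, div_pow]
  field_simp

lemma hm_mob {p : ℕ} (hp : p ∈ ({2, 3, 5, 7, 13} : Set ℕ)) {γ : M2} (hγ : IsG0 p γ) {z : ℂ}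
    (hz : 0 < z.im) : hm p (mob γ z) = hm p z := by
  unfold hm
  rcases hp with rfl | rfl | rfl | rfl | rfl
  · exact eta_quotient_pow_24 (by norm_num) hγ hz
  · exact eta_quotient_pow_12 (by norm_num) hγ hz
  · exact eta_quotient_pow_6 (by norm_num) hγ hz
  · have h := eta_quotient_pow_12 (by norm_num) hγ hz
    have h' := eta_quotient_pow_8 (by norm_num) hγ hz
    have hy : (dedekindEta z / dedekindEta ((7 : ℕ) * z)) ≠ 0 :=
      div_ne_zero (dedekindEta_ne_zero hz) (dedekindEta_ne_zero (im_natCast_mul (by norm_num) hz))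
    generalize dedekindEta z / dedekindEta ((7 : ℕ) * z) = y at *
    generalize dedekindEta (mob γ z) / dedekindEta ((7 : ℕ) * mob γ z) = x at *
    rw [show 24 / (7 - 1) = 4 from rfl]
    apply mul_right_cancel₀ (pow_ne_zero 8 hy)
    rw [← pow_add, ← h', ← pow_add]; exact h
  · have h := eta_quotient_pow_8 (by norm_num) hγ hz
    have h' := eta_quotient_pow_6 (by norm_num) hγ hz
    have hy : (dedekindEta z / dedekindEta ((13 : ℕ) * z)) ≠ 0 :=
      div_ne_zero (dedekindEta_ne_zero hz) (dedekindEta_ne_zero (im_natCast_mul (by norm_num) hz))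
    generalize dedekindEta z / dedekindEta ((13 : ℕ) * z) = y at *
    generalize dedekindEta (mob γ z) / dedekindEta ((13 : ℕ) * mob γ z) = x at *
    rw [show 24 / (13 - 1) = 2 from rfl]
    apply mul_right_cancel₀ (pow_ne_zero 6 hy)
    rw [← pow_add, ← h', ← pow_add]; exact h

lemma hm_ne_zero {p : ℕ} (hp : 0 < p) {z : ℂ} (hz : 0 < z.im) : hm p z ≠ 0 :=
  pow_ne_zero _ (div_ne_zero (dedekindEta_ne_zero hz) (dedekindEta_ne_zero (im_natCast_mul hp hz)))

lemma differentiableAt_dedekindEta_mul {p : ℕ} (hp : 0 < p) {z : ℂ} (hz : 0 < z.im) :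
    DifferentiableAt ℂ (fun z => dedekindEta (p * z)) z :=
  DifferentiableAt.fun_comp' (g := dedekindEta) (f := fun z => (p : ℂ) * z) z
    (differentiableAt_dedekindEta (im_natCast_mul hp hz)) (by fun_prop)

lemma differentiableAt_hm {p : ℕ} (hp : 0 < p) {z : ℂ} (hz : 0 < z.im) :
    DifferentiableAt ℂ (hm p) z :=
  ((differentiableAt_dedekindEta hz).div (differentiableAt_dedekindEta_mul hp hz)
    (dedekindEta_ne_zero (im_natCast_mul hp hz))).pow _

lemma differentiableAt_etaProd {p : ℕ} (hp : 0 < p) {z : ℂ} (hz : 0 < z.im) :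
    DifferentiableAt ℂ (etaProd p) z :=
  ((differentiableAt_dedekindEta hz).mul (differentiableAt_dedekindEta_mul hp hz)).pow _

lemma hasJ_etaProd {p : ℕ} (hp : 2 ≤ p) :
    HasL2 (etaProd p) (-(p + 1)) (-72 - 48 * if p = 2 then 1 else 0) := by
  have h := ((HasJ.zpow_qc (-((p : ℤ) + 1))).mul ((hasJ_eulerProd.mul (hasJ_eulerProd_pow hp)).pow 24))
  refine ⟨1 * (1 * 1) ^ 24, 0 + (24 : ℕ) * (-1 + 0), ?_⟩
  · convert h.congr (G := etaProd p) ?_ using 1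
    · ring
    · split_ifs <;> norm_num
    · refine Eventually.of_forall fun τ => ?_
      rw [etaProd, dedekindEta_eq_eulerProd, dedekindEta_eq_eulerProd, qc_nat_mul, neg_neg,
        show ((p : ℤ) + 1) = ((p + 1 : ℕ) : ℤ) by push_cast; ring, zpow_natCast, ← qc_nat_mul (p + 1)]
      rw [show ∀ a b c d : ℂ, (a * b * (c * d)) ^ 24 = (a * c) ^ 24 * (b * d) ^ 24 by
        intros; ring, ← Complex.exp_add, ← Complex.exp_nat_mul, qc]
      congr 2
      push_cast; ring

lemma hasJ_hm {p : ℕ} (hp : p ∈ ({2, 3, 5, 7, 13} : Set ℕ)) :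
    HasJ (hm p) 1 1 (-(24 / ((p : ℂ) - 1)))
      (-(24 / ((p : ℂ) - 1)) * (3 - 2 * if p = 2 then 1 else 0)) := by
  have hp2 : 2 ≤ p := by rcases hp with rfl | rfl | rfl | rfl | rfl <;> norm_num
  have he : (p - 1) * (24 / (p - 1)) = 24 := by
    rcases hp with rfl | rfl | rfl | rfl | rfl <;> norm_num
  have he' : ((p : ℂ) - 1) * (24 / (p - 1) : ℕ) = 24 := by
    have : (((p - 1) * (24 / (p - 1)) : ℕ) : ℂ) = 24 := by rw [he]; norm_num
    rwa [Nat.cast_mul, Nat.cast_sub (by omega), Nat.cast_one] at this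
  have hp1 : (p : ℂ) - 1 ≠ 0 := by intro h; rw [h] at he'; norm_num at he'
  have hk : ((24 / (p - 1) : ℕ) : ℂ) = 24 / ((p : ℂ) - 1) := by
    rw [eq_div_iff hp1, mul_comm]; exact he'
  have h := ((HasJ.zpow_qc 1).mul ((hasJ_eulerProd.div (hasJ_eulerProd_pow hp2)).pow (24 / (p - 1))))
  rw [hk] at h
  convert h.congr (G := hm p) ?_ using 1
  · simp
  · simp
  · ring
  · split_ifs <;> ring
  · refine Eventually.of_forall fun τ => ?_
    rw [hm, dedekindEta_eq_eulerProd, dedekindEta_eq_eulerProd, qc_nat_mul, mul_div_mul_comm, mul_pow,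
      ← Complex.exp_sub, ← Complex.exp_nat_mul, hk, _root_.zpow_neg_one, qc, ← Complex.exp_neg]
    congr 2
    field_simp
    ring

lemma hasFPowerSeriesAt_tsum {b : ℕ → ℂ} {r : ℝ} (hr : 0 < r)
    (hb : Summable fun m => b m * (r : ℂ) ^ m) :
    HasFPowerSeriesAt (fun x => ∑' m, b m * x ^ m) (FormalMultilinearSeries.ofScalars ℂ b) 0 := by
  have hrad : ((r.toNNReal : NNReal) : ENNReal) ≤ (FormalMultilinearSeries.ofScalars ℂ b).radius := by
    refine FormalMultilinearSeries.le_radius_of_summable _ ?_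
    refine hb.norm.congr fun m => ?_
    rw [FormalMultilinearSeries.ofScalars_norm, norm_mul, norm_pow]
    simp [abs_of_pos hr, hr.le]
  have h := (FormalMultilinearSeries.ofScalars ℂ b).hasFPowerSeriesOnBall
    (lt_of_lt_of_le (by simpa using hr) hrad)
  convert h.hasFPowerSeriesAt using 1
  funext x
  simp only [FormalMultilinearSeries.sum, FormalMultilinearSeries.ofScalars_apply_eq, smul_eq_mul]

lemma exists_haupt {p : ℕ} (hp : p ∈ ({2, 3, 5, 7, 13} : Set ℕ)) (hp' : p.Prime) {c : ℤ → ℂ}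
    (hc : HasQExp (jn p) c (-1)) :
    c (-1) = 1 ∧ c 0 = 0 ∧ ∃ G, Haupt p (24 / ((p : ℂ) - 1)) (p ^ (12 / (p - 1))) c (hm p) (etaProd p) G := by
  set k : ℂ := 24 / ((p : ℂ) - 1) with hk
  have hjn : ∀ z, jn p z = hm p z + k := by
    intro z
    have h6 : p ≠ 6 := by rcases hp with rfl | rfl | rfl | rfl | rfl <;> norm_num
    have h10 : p ≠ 10 := by rcases hp with rfl | rfl | rfl | rfl | rfl <;> norm_num
    simp only [jn, hm, h6, h10, if_false]
    rfl
  set a : ℕ → ℂ := fun m => c (m - 1) with ha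
  have hsum : ∀ τ : ℂ, 0 < τ.im → HasSum (fun m => a m * qc τ ^ m) (qc τ * (hm p τ + k)) := by
    intro τ hτ
    have := (hc.2 τ hτ).mul_left (qc τ)
    rw [hjn] at this
    refine (iff_of_eq (congrArg (HasSum · _) (funext fun m => ?_))).2 this
    simp only [ha]
    rw [zpow_add₀ (qc_ne_zero τ), _root_.zpow_neg_one, zpow_natCast, show (-1 + (m : ℤ)) = m - 1 by ring]
    have := qc_ne_zero τ
    field_simp
  have hJ := hasJ_hm hp
  rw [← hk] at hJ
  have hp0 : 0 < p := hp'.pos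
  obtain ⟨τ₀, hτ₀⟩ : ∃ τ : ℂ, qc τ = (1 / 2 : ℝ) := exists_qc_eq (by norm_num)
  have hτ₀' : 0 < τ₀.im := by
    by_contra! h
    have h1 := norm_qc τ₀
    rw [hτ₀] at h1
    have : (1 : ℝ) ≤ Real.exp (-2 * Real.pi * τ₀.im) :=
      Real.one_le_exp (by nlinarith [Real.pi_pos])
    rw [← h1] at this
    norm_num at this
  have hs₀ : Summable fun m => a m * ((1 / 2 : ℝ) : ℂ) ^ m := by
    have := (hsum τ₀ hτ₀').summable
    rwa [hτ₀] at this
  obtain ⟨K, -, hK⟩ := exists_taylor_bound (by norm_num) hs₀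
  set ε : ℂ → ℂ := fun τ => qc τ * (hm p τ + k) - (a 0 + a 1 * qc τ + a 2 * qc τ ^ 2) with hε
  have hε0 : Tendsto (fun τ => ε τ / qc τ ^ 2) cusp (𝓝 0) := by
    refine tendsto_div_sq_of_le (K := K) ?_
    filter_upwards [eventually_norm_qc_le (r := 1 / 2 / 2) (by norm_num), eventually_cusp_im 0] with τ h1 h2
    exact hK _ _ h1 (hsum τ h2)
  obtain ⟨-, ε', hε', hev⟩ := hJ
  have ha0 : a 0 = 1 := by
    have h1 : Tendsto (fun τ => qc τ * hm p τ) cusp (𝓝 1) := by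
      have h2 := (Complex.continuous_exp.tendsto _).comp (tendsto_qc_sq_coeff
        (a := -k) (b := -k * (3 - 2 * if p = 2 then 1 else 0) / 2) hε')
      rw [Complex.exp_zero] at h2
      refine h2.congr' ?_
      filter_upwards [hev] with τ h3
      have := qc_ne_zero τ
      rw [h3, _root_.zpow_neg_one]
      simp only [Function.comp]
      field_simp
    have h2 : Tendsto (fun τ => qc τ * hm p τ) cusp (𝓝 (a 0)) := by
      have h3 := (tendsto_qc_sq_coeff (a := a 1) (b := a 2) hε0).const_add (a 0)
      have h4 := h3.sub (tendsto_qc.mul_const k)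
      rw [add_zero, zero_mul, sub_zero] at h4
      refine h4.congr fun τ => ?_
      simp only [hε]; ring
    exact tendsto_nhds_unique h2 h1
  have hJ' : HasJ (hm p) 1 1 (a 1 - k) (2 * a 2 - (a 1 - k) ^ 2) := by
    refine hasJ_of_taylor one_ne_zero hε0 (Eventually.of_forall fun τ => ?_)
    have := qc_ne_zero τ
    simp only [hε, ha0]
    rw [_root_.zpow_neg_one]
    field_simp
    ring
  obtain ⟨-, -, h1, h2⟩ := (hasJ_hm hp).unique hJ'
  have ha1 : a 1 = 0 := by linear_combination -h1
  have hc1 : a 2 = c 1 := by simp [ha]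
  have hsG : ∀ x s : ℂ, x ≠ 0 → HasSum (fun m => a m * x ^ m) s →
      HasSum (fun m => c (m + 1 : ℕ) * x ^ m) ((s - 1) / x ^ 2) := by
    intro x s hx hs
    have h3 := ((hasSum_nat_add_iff' 2).2 hs).div_const (x ^ 2)
    simp only [Finset.sum_range_succ, Finset.sum_range_zero, ha0, ha1] at h3
    simp only [pow_zero, mul_one, zero_add, zero_mul, add_zero] at h3
    refine (iff_of_eq (congrArg (HasSum · _) (funext fun m => ?_))).2 h3
    simp only [ha]
    rw [show ((m + 2 : ℕ) : ℤ) - 1 = (m + 1 : ℕ) by push_cast; ring, pow_add]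
    field_simp
  refine ⟨by simpa [ha] using ha0, by simpa [ha] using ha1,
    fun x => ∑' m : ℕ, c (m + 1 : ℕ) * x ^ m, hp', ?_, fun z hz => differentiableAt_hm hp0 hz,
    fun z hz => hm_ne_zero hp0 hz, fun γ hγ z hz => hm_mob hp hγ hz, fun z hz => hm_wMat hp hz,
    ?_, ⟨_, hasFPowerSeriesAt_tsum (b := fun m => c (m + 1 : ℕ)) (r := 1 / 2) (by norm_num) ?_, ?_⟩,
    ?_, fun z hz => differentiableAt_etaProd hp0 hz, ?_, fun γ hγ z hz => etaProd_mob hp0 hγ hz,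
    fun z hz => etaProd_wMat hp0 hz, hasJ_etaProd hp'.two_le⟩
  · exact pow_ne_zero _ (by exact_mod_cast hp0.ne')
  · intro z hz
    have hq := qc_ne_zero z
    rw [(hsG _ _ hq (hsum z hz)).tsum_eq]
    field_simp
    ring
  · exact (hsG _ _ (by norm_num) hs₀.hasSum).summable
  · intro m
    rw [FormalMultilinearSeries.coeff_ofScalars]
    push_cast; rfl
  · rw [← hc1]
    rw [ha1] at h2
    linear_combination h2
  · intro z hz
    exact pow_ne_zero _ (mul_ne_zero (dedekindEta_ne_zero hz)
      (dedekindEta_ne_zero (im_natCast_mul hp0 hz)))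

/-- Holomorphic functions on the upper half-plane that are invariant under `Γ₀(p)`. -/
structure IsMod (p : ℕ) (f : ℂ → ℂ) : Prop where
  diff : ∀ z : ℂ, 0 < z.im → DifferentiableAt ℂ f z
  inv : ∀ γ : M2, IsG0 p γ → ∀ z : ℂ, 0 < z.im → f (mob γ z) = f z

namespace IsMod

variable {p : ℕ} {f g : ℂ → ℂ}

lemma const (a : ℂ) : IsMod p fun _ => a := ⟨fun _ _ => by fun_prop, fun _ _ _ _ => rfl⟩

lemma sub (hf : IsMod p f) (hg : IsMod p g) : IsMod p fun z => f z - g z :=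
  ⟨fun z hz => (hf.diff z hz).sub (hg.diff z hz), fun γ hγ z hz => by
    simp only [hf.inv γ hγ z hz, hg.inv γ hγ z hz]⟩

lemma mul (hf : IsMod p f) (hg : IsMod p g) : IsMod p fun z => f z * g z :=
  ⟨fun z hz => (hf.diff z hz).mul (hg.diff z hz), fun γ hγ z hz => by
    simp only [hf.inv γ hγ z hz, hg.inv γ hγ z hz]⟩

lemma pow (hf : IsMod p f) (n : ℕ) : IsMod p fun z => f z ^ n :=
  ⟨fun z hz => (hf.diff z hz).pow n, fun γ hγ z hz => by simp only [hf.inv γ hγ z hz]⟩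

lemma analyticOnNhd (hf : IsMod p f) : AnalyticOnNhd ℂ f {z | 0 < z.im} :=
  DifferentiableOn.analyticOnNhd (fun z hz => (hf.diff z hz).differentiableWithinAt) isOpen_upper

lemma add_one (hf : IsMod p f) {z : ℂ} (hz : 0 < z.im) : f (z + 1) = f z := by
  have h := hf.inv !![1, 1; 0, 1] ⟨by simp [det_fin_two], by simp⟩ z hz
  rw [← h]
  congr 1
  simp [mob, mden]

/-- An invariant function with limits at both cusps is constant. -/
lemma eq_const (hp : p.Prime) (hf : IsMod p f) {a b : ℂ} (ha : Tendsto f cusp (𝓝 a))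
    (hb : Tendsto (fun z => f (mob (wMat p) z)) cusp (𝓝 b)) :
    ∃ ℓ, ∀ z : ℂ, 0 < z.im → f z = ℓ := by
  have hW : (0 : ℤ) < (wMat p).det := by rw [det_wMat]; exact_mod_cast hp.pos
  set g : ℂ → ℂ := fun z => (f z - a) * (f z - b) with hg
  have hgm : IsMod p g := (hf.sub (const a)).mul (hf.sub (const b))
  have hg1 : Tendsto g cusp (𝓝 0) := by
    have := (ha.sub_const a).mul (ha.sub_const b)
    rwa [sub_self, zero_mul] at this
  have hg2 : Tendsto (fun z => g (mob (wMat p) z)) cusp (𝓝 0) := by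
    have := (hb.sub_const a).mul (hb.sub_const b)
    rwa [sub_self, mul_zero] at this
  have hzero : ∀ z : ℂ, 0 < z.im → g z = 0 := by
    intro z₀ hz₀
    by_contra hne
    have hpos : 0 < ‖g z₀‖ := norm_pos_iff.2 hne
    have hev : ∀ᶠ z in cusp, ‖g z‖ < ‖g z₀‖ ∧ ‖g (mob (wMat p) z)‖ < ‖g z₀‖ := by
      have e1 := (hg1.norm).eventually_lt_const (u := ‖g z₀‖) (by rwa [norm_zero])
      have e2 := (hg2.norm).eventually_lt_const (u := ‖g z₀‖) (by rwa [norm_zero])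
      exact e1.and e2
    obtain ⟨B, hB⟩ := eventually_cusp_iff.1 hev
    set K : Set ℂ := Set.Icc (-2) 2 ×ℂ Set.Icc (1 / (2 * p : ℝ)) B with hK
    have hKc : IsCompact K := isCompact_Icc.reProdIm isCompact_Icc
    have hp0 : (0 : ℝ) < 1 / (2 * p : ℝ) := by have := hp.pos; positivity
    have hK0 : ∀ z ∈ K, 0 < z.im := fun z hz => hp0.trans_le (mem_reProdIm.1 hz).2.1
    set K' := K ∪ mob (wMat p) '' K with hK'
    have hK'c : IsCompact K' := by
      refine hKc.union (hKc.image_of_continuousOn fun z hz => ?_)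
      exact (analyticAt_mob hW (hK0 z hz)).continuousAt.continuousWithinAt
    have hK'0 : ∀ z ∈ K', 0 < z.im := by
      rintro z (hz | ⟨w, hw, rfl⟩)
      · exact hK0 z hz
      · exact mob_im_pos hW (hK0 w hw)
    have hred : ∀ z : ℂ, 0 < z.im → (∃ w ∈ K', g z = g w) ∨ ‖g z‖ < ‖g z₀‖ := by
      intro z hz
      obtain ⟨γ, hγ, v, hv1, hv2, hv3⟩ := exists_reduction hp hz
      rw [← hgm.inv γ hγ z hz]
      rcases le_or_gt v.im B with h | h
      · have hvK : v ∈ K := mem_reProdIm.2 ⟨abs_le.1 hv1, hv2, h⟩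
        rcases hv3 with h3 | h3
        · exact Or.inl ⟨v, Or.inl hvK, by rw [h3]⟩
        · exact Or.inl ⟨_, Or.inr ⟨v, hvK, rfl⟩, by rw [h3]⟩
      · right
        rcases hv3 with h3 | h3
        · rw [h3]; exact (hB v h).1
        · rw [h3]; exact (hB v h).2
    obtain ⟨w₀, hw₀, hw₀'⟩ : ∃ w ∈ K', g z₀ = g w := (hred z₀ hz₀).resolve_right (lt_irrefl _)
    obtain ⟨z₁, hz₁, hmax⟩ := hK'c.exists_isMaxOn ⟨w₀, hw₀⟩
      (f := fun z => ‖g z‖) fun z hz => (hgm.diff z (hK'0 z hz)).continuousAt.norm.continuousWithinAt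
    have hmax' : IsMaxOn (norm ∘ g) {z : ℂ | 0 < z.im} z₁ := by
      intro z hz
      have h1 : ‖g z₀‖ ≤ ‖g z₁‖ := by rw [hw₀']; exact hmax hw₀
      rcases hred z hz with ⟨w, hw, h⟩ | h
      · change ‖g z‖ ≤ ‖g z₁‖
        rw [h]; exact hmax hw
      · exact h.le.trans h1
    have hconst := Complex.eqOn_of_isPreconnected_of_isMaxOn_norm isPreconnected_upper isOpen_upper
      (fun z hz => (hgm.diff z hz).differentiableWithinAt) (hK'0 z₁ hz₁) hmax'
    have h2 : Tendsto g cusp (𝓝 (g z₁)) := by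
      refine tendsto_const_nhds.congr' ?_
      filter_upwards [eventually_cusp_im 0] with z hz
      exact (hconst hz).symm
    have h3 := tendsto_nhds_unique h2 hg1
    exact hne ((hconst hz₀).trans h3)
  rcases AnalyticOnNhd.eq_zero_or_eq_zero_of_smul_eq_zero (hf.sub (const a)).analyticOnNhd
    (hf.sub (const b)).analyticOnNhd hzero isPreconnected_upper with h | h
  · exact ⟨a, fun z hz => sub_eq_zero.1 (h z hz)⟩
  · exact ⟨b, fun z hz => sub_eq_zero.1 (h z hz)⟩

/-- If `f q^(N+1)` vanishes at the cusp then `f q^N` has a limit there. -/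
lemma exists_tendsto (hf : IsMod p f) {N : ℕ}
    (h : Tendsto (fun z => f z * qc z ^ (N + 1)) cusp (𝓝 0)) :
    ∃ a, Tendsto (fun z => f z * qc z ^ N) cusp (𝓝 a) := by
  classical
  set F : ℂ → ℂ := fun z => if 0 < z.im then f z * qc z ^ (N + 1) else 0 with hF
  have hq : ∀ z, Function.Periodic.qParam 1 z = qc z := by
    intro z; simp [Function.Periodic.qParam, qc]
  have hper : Function.Periodic F ((1 : ℝ) : ℂ) := by
    intro z
    simp only [hF, ofReal_one, add_im, one_im, add_zero]
    split_ifs with hz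
    · rw [hf.add_one hz]
      congr 2
      simpa using qc_add_int z 1
    · rfl
  have hev : ∀ᶠ z in cusp, F z = f z * qc z ^ (N + 1) := by
    filter_upwards [eventually_cusp_im 0] with z hz
    simp only [hF, hz, if_true]
  have hF0 : Tendsto F cusp (𝓝 0) := h.congr' (hev.mono fun _ h => h.symm)
  have hdiff : ∀ᶠ z in cusp, DifferentiableAt ℂ F z := by
    filter_upwards [eventually_cusp_im 0] with z hz
    have h1 : DifferentiableAt ℂ (fun z => f z * qc z ^ (N + 1)) z := by
      refine (hf.diff z hz).mul (DifferentiableAt.pow ?_ _)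
      unfold qc; fun_prop
    refine h1.congr_of_eventuallyEq ?_
    filter_upwards [isOpen_upper.mem_nhds hz] with w hw
    simp only [hF]
    exact if_pos hw
  have hd := Function.Periodic.differentiableAt_cuspFunction_zero one_pos hper hdiff
    (hF0.isBigO_one ℝ)
  have h0 := Function.Periodic.cuspFunction_zero_of_zero_at_inf (h := 1) one_pos (f := F) hF0
  set Φ := Function.Periodic.cuspFunction 1 F with hΦ
  refine ⟨deriv Φ 0, ?_⟩
  have hs := hasDerivAt_iff_tendsto_slope.1 hd.hasDerivAt
  have hqt : Tendsto qc cusp (𝓝[≠] 0) :=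
    tendsto_nhdsWithin_iff.2 ⟨tendsto_qc, Eventually.of_forall qc_ne_zero⟩
  refine (hs.comp hqt).congr' ?_
  filter_upwards [hev] with z hz
  simp only [Function.comp, slope_def_field]
  rw [h0, sub_zero, sub_zero, ← hq z, hΦ, Function.Periodic.eq_cuspFunction one_ne_zero hper, hz, hq z]
  have := qc_ne_zero z
  field_simp
  ring

end IsMod

namespace Haupt

variable {p : ℕ} {k C : ℂ} {c : ℤ → ℂ} {t D G : ℂ → ℂ} (H : Haupt p k C c t D G)
include H

lemma isMod : IsMod p t := ⟨H.diff_t, H.inv⟩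

lemma det_wMat_pos : (0 : ℤ) < (wMat p).det := by
  rw [det_wMat]; exact_mod_cast H.prime.pos

lemma G_zero : G 0 = c 1 := by
  obtain ⟨ps, h1, h2⟩ := H.series
  have h3 := h2 0
  rw [Nat.cast_zero, zero_add] at h3
  rw [← h3]
  exact (h1.coeff_zero _).symm

lemma tendsto_G : Tendsto (fun z => G (qc z)) cusp (𝓝 (c 1)) := by
  obtain ⟨ps, h1, -⟩ := H.series
  have := h1.continuousAt.tendsto.comp tendsto_qc
  rwa [H.G_zero] at this

lemma tendsto_mul_qc : Tendsto (fun z => t z * qc z) cusp (𝓝 1) := by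
  have h := ((tendsto_qc.const_mul k).const_sub 1).add ((tendsto_qc.pow 2).mul H.tendsto_G)
  rw [mul_zero, sub_zero, zero_pow two_ne_zero, zero_mul, add_zero] at h
  refine h.congr' ?_
  filter_upwards [eventually_cusp_im 0] with z hz
  rw [H.qexp z hz]
  have := qc_ne_zero z
  field_simp

lemma tendsto_inv : Tendsto (fun z => (t z)⁻¹) cusp (𝓝 0) := by
  have h := (H.tendsto_mul_qc.inv₀ one_ne_zero).mul tendsto_qc
  rw [mul_zero] at h
  refine h.congr fun z => ?_
  have := qc_ne_zero z
  field_simp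

/-- An invariant function with finite limit at `0` and at most a pole at `i∞` is a polynomial
in `t`. -/
lemma exists_polynomial_of_tendsto (N : ℕ) {f : ℂ → ℂ} (hf : IsMod p f) {a b : ℂ}
    (ha : Tendsto (fun z => f z * qc z ^ N) cusp (𝓝 a))
    (hb : Tendsto (fun z => f (mob (wMat p) z)) cusp (𝓝 b)) :
    ∃ Q : Polynomial ℂ, ∀ z : ℂ, 0 < z.im → f z = Q.eval (t z) := by
  induction N generalizing f a b with
  | zero =>
    obtain ⟨ℓ, hℓ⟩ := hf.eq_const H.prime (by simpa using ha) hb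
    exact ⟨Polynomial.C ℓ, by simpa using hℓ⟩
  | succ N ih =>
    have hg : IsMod p fun z => f z - a * t z ^ (N + 1) :=
      hf.sub ((IsMod.const a).mul (H.isMod.pow _))
    have h0 : Tendsto (fun z => (f z - a * t z ^ (N + 1)) * qc z ^ (N + 1)) cusp (𝓝 0) := by
      have := ha.sub ((H.tendsto_mul_qc.pow (N + 1)).const_mul a)
      rw [one_pow, mul_one, sub_self] at this
      refine this.congr fun z => ?_
      ring
    obtain ⟨a', ha'⟩ := hg.exists_tendsto h0
    have hb' : Tendsto (fun z => f (mob (wMat p) z) - a * t (mob (wMat p) z) ^ (N + 1)) cusp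
        (𝓝 b) := by
      have := hb.sub (((H.tendsto_inv.const_mul C).pow (N + 1)).const_mul a)
      rw [mul_zero, zero_pow (Nat.succ_ne_zero N), mul_zero, sub_zero] at this
      refine this.congr' ?_
      filter_upwards [eventually_cusp_im 0] with z hz
      rw [H.fricke z hz, div_eq_mul_inv]
    obtain ⟨Q, hQ⟩ := ih hg ha' hb'
    refine ⟨Q + Polynomial.C a * Polynomial.X ^ (N + 1), fun z hz => ?_⟩
    have := hQ z hz
    simp only [Polynomial.eval_add, Polynomial.eval_mul, Polynomial.eval_C, Polynomial.eval_pow,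
      Polynomial.eval_X, ← this]
    ring

/-- An invariant function with at most poles at the cusps is a Laurent polynomial in `t`. -/
lemma exists_polynomial (A B : ℕ) {f : ℂ → ℂ} (hf : IsMod p f) {a b : ℂ}
    (ha : Tendsto (fun z => f z * qc z ^ A) cusp (𝓝 a))
    (hb : Tendsto (fun z => f (mob (wMat p) z) * qc z ^ B) cusp (𝓝 b)) :
    ∃ Q : Polynomial ℂ, ∀ z : ℂ, 0 < z.im → f z * t z ^ B = Q.eval (t z) := by
  refine H.exists_polynomial_of_tendsto (A + B) (a := a) (b := b * C ^ B) (hf.mul (H.isMod.pow B)) ?_ ?_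
  · have := ha.mul (H.tendsto_mul_qc.pow B)
    rw [one_pow, mul_one] at this
    exact this.congr fun z => by ring
  · have := hb.mul ((((H.tendsto_mul_qc.inv₀ one_ne_zero).const_mul C)).pow B)
    rw [inv_one, mul_one] at this
    refine this.congr' ?_
    filter_upwards [eventually_cusp_im 0] with z hz
    rw [H.fricke z hz, mul_inv, div_pow, mul_pow, mul_pow, inv_pow, inv_pow]
    have := qc_ne_zero z
    have := H.t_ne z hz
    field_simp

end Haupt

/-- A function with nonzero strict derivative is locally injective. -/
lemma eventually_injective_of_hasStrictDerivAt {f : ℂ → ℂ} {f' a : ℂ} (hf : HasStrictDerivAt f f' a)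
    (hf' : f' ≠ 0) : ∀ᶠ x in 𝓝 a ×ˢ 𝓝 a, f x.1 = f x.2 → x.1 = x.2 := by
  have h := (hf.hasStrictFDerivAt_equiv hf').eventually_left_inverse
  filter_upwards [h.prod_mk h] with x hx hxx
  rw [← hx.1, ← hx.2, hxx]

/-- The zeros of a non-zero analytic function on the upper half-plane are countable. -/
lemma countable_zeros {g : ℂ → ℂ} (hg : AnalyticOnNhd ℂ g {z | 0 < z.im}) {z₁ : ℂ}
    (hz₁ : 0 < z₁.im) (hne : g z₁ ≠ 0) : {z : ℂ | 0 < z.im ∧ g z = 0}.Countable := by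
  set S := {z : ℂ | 0 < z.im ∧ g z = 0} with hS
  have h : ∀ x ∈ S, ({x} : Set ℂ) ∈ 𝓝[S] x := by
    intro x hx
    have hx' : ∀ᶠ y in 𝓝[≠] x, g y ≠ 0 := by
      refine (hg x hx.1).eventually_eq_zero_or_eventually_ne_zero.resolve_left fun h0 => ?_
      exact hne (hg.eqOn_zero_of_preconnected_of_eventuallyEq_zero isPreconnected_upper hx.1 h0 hz₁)
    rw [eventually_nhdsWithin_iff] at hx'
    rw [mem_nhdsWithin_iff_eventually]
    filter_upwards [hx'] with y hy hyS
    by_contra hyx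
    exact hy hyx hyS.2
  obtain ⟨T, -, hT, hST⟩ := TopologicalSpace.countable_cover_nhdsWithin h
  refine hT.mono fun x hx => ?_
  obtain ⟨y, hy, hxy⟩ := Set.mem_iUnion₂.1 (hST hx)
  rwa [Set.mem_singleton_iff.1 hxy]

/-- Inequivalent points have disjoint equivalence classes of neighbourhoods. -/
lemma eventually_not_equiv {p : ℕ} {z w : ℂ} (hz : 0 < z.im) (hw : 0 < w.im)
    (h : ∀ γ, IsG0 p γ → mob γ z ≠ w) :
    ∀ᶠ x in 𝓝 z ×ˢ 𝓝 w, ∀ γ, IsG0 p γ → mob γ x.1 ≠ x.2 := by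
  filter_upwards [eventually_mob_eq one_pos hz hw] with x hx γ hγ hγx
  exact h γ hγ (hx γ hγ.1 hγx)

namespace Haupt

variable {p : ℕ} {k C : ℂ} {c : ℤ → ℂ} {t D G : ℂ → ℂ} (H : Haupt p k C c t D G)
include H

lemma eventually_norm_gt (R : ℝ) : ∀ᶠ z in cusp, R < ‖t z‖ := by
  have h := (H.tendsto_inv.norm).eventually_lt_const (u := (|R| + 1)⁻¹)
    (by rw [norm_zero]; positivity)
  filter_upwards [h, eventually_cusp_im 0] with z hz hz0
  have h0 := norm_pos_iff.2 (H.t_ne z hz0)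
  rw [norm_inv, inv_lt_inv₀ h0 (by positivity)] at hz
  linarith [le_abs_self R]

lemma not_eventually_const {z : ℂ} (hz : 0 < z.im) (a : ℂ) : ¬ ∀ᶠ w in 𝓝 z, t w = a := by
  intro h
  have h1 := H.isMod.analyticOnNhd.eqOn_of_preconnected_of_eventuallyEq
    (analyticOnNhd_const (v := a)) isPreconnected_upper hz h
  obtain ⟨w, hw, hw0⟩ := ((H.eventually_norm_gt ‖a‖).and (eventually_cusp_im 0)).exists
  rw [h1 hw0] at hw
  exact lt_irrefl _ hw

lemma nhds_le_map {z : ℂ} (hz : 0 < z.im) : 𝓝 (t z) ≤ map t (𝓝 z) :=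
  (H.isMod.analyticOnNhd z hz).eventually_constant_or_nhds_le_map_nhds.resolve_left
    (H.not_eventually_const hz _)

lemma exists_deriv_ne_zero : ∃ z : ℂ, 0 < z.im ∧ deriv t z ≠ 0 := by
  by_contra! h
  have h2 : Set.EqOn t (fun _ => t I) {z | 0 < z.im} := by
    intro z hz
    exact isOpen_upper.is_const_of_deriv_eq_zero isPreconnected_upper
      (fun w hw => (H.diff_t w hw).differentiableWithinAt) h hz (by simp)
  refine H.not_eventually_const (z := I) (by simp) (t I) ?_
  filter_upwards [isOpen_upper.mem_nhds (show I ∈ {z : ℂ | 0 < z.im} by simp)] with w hw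
  exact h2 hw

/-- Points where `t` stays in a compact subset of `ℂˣ` are equivalent to points of a compact. -/
lemma exists_compact {a : ℝ} (ha : 0 < a) (R : ℝ) : ∃ K : Set ℂ, IsCompact K ∧
    (∀ z ∈ K, 0 < z.im) ∧ ∀ z : ℂ, 0 < z.im → a ≤ ‖t z‖ → ‖t z‖ ≤ R →
      ∃ γ, IsG0 p γ ∧ mob γ z ∈ K := by
  obtain ⟨B, hB⟩ := eventually_cusp_iff.1
    ((H.eventually_norm_gt R).and (H.eventually_norm_gt (‖C‖ / a)))
  have hp0 : (0 : ℝ) < 1 / (2 * p : ℝ) := by have := H.prime.pos; positivity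
  set K : Set ℂ := Set.Icc (-2) 2 ×ℂ Set.Icc (1 / (2 * p : ℝ)) B with hK
  have hKc : IsCompact K := isCompact_Icc.reProdIm isCompact_Icc
  have hK0 : ∀ z ∈ K, 0 < z.im := fun z hz => hp0.trans_le (mem_reProdIm.1 hz).2.1
  refine ⟨K ∪ mob (wMat p) '' K, hKc.union (hKc.image_of_continuousOn fun z hz =>
    (analyticAt_mob H.det_wMat_pos (hK0 z hz)).continuousAt.continuousWithinAt), ?_, ?_⟩
  · rintro z (hz | ⟨w, hw, rfl⟩)
    · exact hK0 z hz
    · exact mob_im_pos H.det_wMat_pos (hK0 w hw)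
  · intro z hz h1 h2
    obtain ⟨γ, hγ, v, hv1, hv2, hv3⟩ := exists_reduction H.prime hz
    refine ⟨γ, hγ, ?_⟩
    have hv0 : 0 < v.im := hp0.trans_le hv2
    rcases le_or_gt v.im B with h | h
    · have hvK : v ∈ K := mem_reProdIm.2 ⟨abs_le.1 hv1, hv2, h⟩
      rcases hv3 with h3 | h3 <;> rw [h3]
      · exact Or.inl hvK
      · exact Or.inr ⟨v, hvK, rfl⟩
    · exfalso
      have h4 := H.inv γ hγ z hz
      have h5 := hB v h
      rcases hv3 with h3 | h3
      · rw [h3] at h4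
        rw [← h4] at h2
        linarith
      · rw [h3, H.fricke v hv0] at h4
        rw [← h4, norm_div, le_div_iff₀ (norm_pos_iff.2 (H.t_ne v hv0))] at h1
        have := h5.2
        rw [div_lt_iff₀ ha] at this
        nlinarith

lemma isOpen_bad : IsOpen {y : ℂ | ∃ z w : ℂ, 0 < z.im ∧ 0 < w.im ∧ t z = y ∧ t w = y ∧
    ∀ γ, IsG0 p γ → mob γ z ≠ w} := by
  rw [isOpen_iff_mem_nhds]
  rintro y ⟨z, w, hz, hw, rfl, hzw, hne⟩
  obtain ⟨V, hV, V', hV', hVV⟩ := mem_prod_iff.1 (eventually_not_equiv hz hw hne)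
  have h1 := H.nhds_le_map hz (image_mem_map (inter_mem hV (isOpen_upper.mem_nhds hz)))
  have h2 := H.nhds_le_map hw (image_mem_map (inter_mem hV' (isOpen_upper.mem_nhds hw)))
  rw [hzw] at h2
  filter_upwards [h1, h2]
  rintro y ⟨z', hz', rfl⟩ ⟨w', hw', hy'⟩
  exact ⟨z', w', hz'.2, hw'.2, rfl, hy', @hVV (z', w') ⟨hz'.1, hw'.1⟩⟩

lemma eventually_injective_cusp : ∀ᶠ x in cusp ×ˢ cusp, t x.1 = t x.2 → qc x.1 = qc x.2 := by
  obtain ⟨ps, h1, -⟩ := H.series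
  set h : ℂ → ℂ := fun x => x / (1 - k * x + x ^ 2 * G x) with hh
  have ha : AnalyticAt ℂ h 0 := by
    have := h1.analyticAt
    exact analyticAt_id.div (by fun_prop) (by simp)
  have hd : HasDerivAt h 1 0 := by
    have hG : HasDerivAt G (deriv G 0) 0 := h1.analyticAt.differentiableAt.hasDerivAt
    have e := (hasDerivAt_id (0 : ℂ)).div (((hasDerivAt_id (0 : ℂ)).const_mul k |>.const_sub 1).add
      (((hasDerivAt_id (0 : ℂ)).pow 2).mul hG)) (by simp)
    exact e.congr_deriv (by simp)
  have hs := ha.hasStrictDerivAt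
  rw [hd.deriv] at hs
  have hi := eventually_injective_of_hasStrictDerivAt hs one_ne_zero
  have hi' := (tendsto_qc.prodMap tendsto_qc).eventually hi
  have hth : ∀ z : ℂ, 0 < z.im → h (qc z) = (t z)⁻¹ := by
    intro z hz
    have := qc_ne_zero z
    rw [H.qexp z hz, hh, eq_comm, inv_eq_iff_eq_inv, inv_div]
    field_simp
  filter_upwards [hi', (eventually_cusp_im 0).prod_mk (eventually_cusp_im 0)] with x hx hx0 hxx
  apply hx
  simp only [Prod.map]
  rw [hth _ hx0.1, hth _ hx0.2, hxx]

/-- Points with the same large value of `t` are equivalent. -/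
lemma exists_bound_equiv : ∃ R : ℝ, ∀ z w : ℂ, 0 < z.im → 0 < w.im → R < ‖t z‖ → t z = t w →
    ∃ γ, IsG0 p γ ∧ mob γ z = w := by
  obtain ⟨B, hB⟩ : ∃ B : ℝ, ∀ z w : ℂ, B < z.im → B < w.im → t z = t w → qc z = qc w := by
    obtain ⟨V, hV, V', hV', hVV⟩ := mem_prod_iff.1 H.eventually_injective_cusp
    obtain ⟨B, hB⟩ := eventually_cusp_iff.1 (inter_mem hV hV')
    exact ⟨B, fun z w hz hw => @hVV (z, w) ⟨(hB z hz).1, (hB w hw).2⟩⟩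
  obtain ⟨B', hB'⟩ := eventually_cusp_iff.1 (H.eventually_norm_gt 1)
  have hp0 : (0 : ℝ) < 1 / (2 * p : ℝ) := by have := H.prime.pos; positivity
  set K : Set ℂ := Set.Icc (-2) 2 ×ℂ Set.Icc (1 / (2 * p : ℝ)) (max B B') with hK
  have hKc : IsCompact K := isCompact_Icc.reProdIm isCompact_Icc
  have hK0 : ∀ z ∈ K, 0 < z.im := fun z hz => hp0.trans_le (mem_reProdIm.1 hz).2.1
  obtain ⟨R₁, hR₁⟩ := (hKc.exists_bound_of_continuousOn (f := t) fun z hz =>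
    (H.diff_t z (hK0 z hz)).continuousAt.continuousWithinAt)
  obtain ⟨R₂, hR₂⟩ := (hKc.exists_bound_of_continuousOn (f := fun z => C / t z) fun z hz =>
    (continuousAt_const.div (H.diff_t z (hK0 z hz)).continuousAt
      (H.t_ne z (hK0 z hz))).continuousWithinAt)
  have key : ∀ z : ℂ, 0 < z.im → max R₁ (max R₂ ‖C‖) < ‖t z‖ → ∃ γ, IsG0 p γ ∧ B < (mob γ z).im := by
    intro z hz hR
    obtain ⟨γ, hγ, v, hv1, hv2, hv3⟩ := exists_reduction H.prime hz
    have hv0 : 0 < v.im := hp0.trans_le hv2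
    refine ⟨γ, hγ, ?_⟩
    rw [← H.inv γ hγ z hz] at hR
    simp only [max_lt_iff] at hR
    rcases le_or_gt v.im (max B B') with h | h
    · exfalso
      have hvK : v ∈ K := mem_reProdIm.2 ⟨abs_le.1 hv1, hv2, h⟩
      rcases hv3 with h3 | h3
      · rw [h3] at hR
        linarith [hR₁ v hvK]
      · rw [h3, H.fricke v hv0] at hR
        linarith [hR₂ v hvK]
    · simp only [max_lt_iff] at h
      rcases hv3 with h3 | h3
      · rw [h3]; exact h.1
      · exfalso
        rw [h3, H.fricke v hv0, norm_div] at hR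
        have h4 := hB' v h.2
        have := hR.2.2
        rw [lt_div_iff₀ (by linarith)] at this
        nlinarith [norm_nonneg C]
  refine ⟨max R₁ (max R₂ ‖C‖), fun z w hz hw hR hzw => ?_⟩
  obtain ⟨γ, hγ, h1⟩ := key z hz hR
  obtain ⟨δ, hδ, h2⟩ := key w hw (hzw ▸ hR)
  have hγz := mob_im_pos hγ.det_pos hz
  have hδw := mob_im_pos hδ.det_pos hw
  have hq := hB _ _ h1 h2 (by rw [H.inv γ hγ z hz, H.inv δ hδ w hw, hzw])
  obtain ⟨m, hm⟩ := qc_eq_iff.1 hq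
  have hT : ∀ m : ℤ, IsG0 p !![1, m; 0, 1] := fun m => ⟨by simp [det_fin_two], by simp⟩
  have hTm : ∀ (m : ℤ) (v : ℂ), mob !![1, m; 0, 1] v = v + m := by
    intro m v; simp [mob, mden]
  have hex : ∃ m : ℤ, mob !![1, m; 0, 1] (mob γ z) = mob δ w := by
    simp only [hTm]
    exact ⟨-m, by push_cast; rw [hm]; ring⟩
  obtain ⟨m, hm⟩ := hex
  refine ⟨δ.adjugate * (!![1, m; 0, 1] * γ), hδ.inv.mul ((hT m).mul hγ), ?_⟩
  rw [mob_mul _ ((hT m).mul hγ).det_pos hz, mob_mul _ hγ.det_pos hz, hm, hδ.mob_inv hw]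

/-- `t` separates `Γ₀(p)`-orbits. -/
theorem equiv_of_eq {z w : ℂ} (hz : 0 < z.im) (hw : 0 < w.im) (h : t z = t w) :
    ∃ γ, IsG0 p γ ∧ mob γ z = w := by
  by_contra! hne
  set B := {y : ℂ | ∃ z w : ℂ, 0 < z.im ∧ 0 < w.im ∧ t z = y ∧ t w = y ∧
    ∀ γ, IsG0 p γ → mob γ z ≠ w} with hB
  have hBne : t z ∈ B := ⟨z, w, hz, hw, rfl, h.symm, hne⟩
  obtain ⟨z₁, hz₁, hz₁'⟩ := H.exists_deriv_ne_zero
  set Z : Set ℂ := insert 0 (t '' {z : ℂ | 0 < z.im ∧ deriv t z = 0}) with hZ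
  have hZc : Z.Countable :=
    ((countable_zeros (fun z hz => (H.isMod.analyticOnNhd z hz).deriv) hz₁ hz₁').image t).insert 0
  have hconn : IsPreconnected Zᶜ := by
    have hr : 1 < Module.rank ℝ ℂ := by simp
    exact (hZc.isPathConnected_compl_of_one_lt_rank hr).isConnected.isPreconnected
  have hclos : closure B ∩ Zᶜ ⊆ B := by
    rintro y ⟨hyB, hyZ⟩
    have hy0 : y ≠ 0 := fun h => hyZ (h ▸ Set.mem_insert _ _)
    have hyn : 0 < ‖y‖ := norm_pos_iff.2 hy0
    obtain ⟨u, huB, hu⟩ := mem_closure_iff_seq_limit.1 hyB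
    choose zs ws hzs hws hzu hwu hzw using huB
    obtain ⟨K, hK, hK0, hKr⟩ := H.exists_compact (half_pos hyn) (2 * ‖y‖)
    obtain ⟨N, hN⟩ := eventually_atTop.1 ((hu.norm.eventually_const_le (half_lt_self hyn)).and
      (hu.norm.eventually_le_const (show ‖y‖ < 2 * ‖y‖ by linarith)))
    have hex : ∀ n, ∃ x ∈ K ×ˢ K, t x.1 = u (N + n) ∧ t x.2 = u (N + n) ∧
        ∀ γ, IsG0 p γ → mob γ x.1 ≠ x.2 := by
      intro n
      have hb := hN (N + n) (Nat.le_add_right _ _)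
      obtain ⟨γ, hγ, h1⟩ := hKr (zs (N + n)) (hzs _) (by rw [hzu]; exact hb.1)
        (by rw [hzu]; exact hb.2)
      obtain ⟨δ, hδ, h2⟩ := hKr (ws (N + n)) (hws _) (by rw [hwu]; exact hb.1)
        (by rw [hwu]; exact hb.2)
      refine ⟨(_, _), ⟨h1, h2⟩, ?_, ?_, ?_⟩
      · rw [← hzu]; exact H.inv γ hγ _ (hzs _)
      · rw [← hwu]; exact H.inv δ hδ _ (hws _)
      · intro ε hε hεx
        refine hzw (N + n) (δ.adjugate * (ε * γ)) (hδ.inv.mul (hε.mul hγ)) ?_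
        rw [mob_mul _ (hε.mul hγ).det_pos (hzs _), mob_mul _ hγ.det_pos (hzs _)]
        rw [show mob ε (mob γ (zs (N + n))) = mob δ (ws (N + n)) from hεx, hδ.mob_inv (hws _)]
    choose x hxK hx1 hx2 hx3 using hex
    obtain ⟨⟨z', w'⟩, hzK, φ, hφ, hlim⟩ := (hK.prod hK).tendsto_subseq hxK
    have hz' := hK0 _ hzK.1
    have hw' := hK0 _ hzK.2
    have hl1 : Tendsto (fun n => (x (φ n)).1) atTop (𝓝 z') := (continuous_fst.tendsto _).comp hlim
    have hl2 : Tendsto (fun n => (x (φ n)).2) atTop (𝓝 w') := (continuous_snd.tendsto _).comp hlim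
    have hu' : Tendsto (fun n => u (N + φ n)) atTop (𝓝 y) :=
      hu.comp (tendsto_atTop_mono (fun n => Nat.le_add_left _ N) hφ.tendsto_atTop)
    have ht1 : t z' = y := tendsto_nhds_unique
      ((H.diff_t z' hz').continuousAt.tendsto.comp hl1) (hu'.congr fun n => (hx1 (φ n)).symm)
    have ht2 : t w' = y := tendsto_nhds_unique
      ((H.diff_t w' hw').continuousAt.tendsto.comp hl2) (hu'.congr fun n => (hx2 (φ n)).symm)
    refine ⟨z', w', hz', hw', ht1, ht2, fun γ hγ hγz => ?_⟩
    have hd : deriv t z' ≠ 0 := fun h0 => hyZ (Set.mem_insert_of_mem _ ⟨z', ⟨hz', h0⟩, ht1⟩)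
    have hinj := eventually_injective_of_hasStrictDerivAt
      (H.isMod.analyticOnNhd z' hz').hasStrictDerivAt hd
    have hl3 : Tendsto (fun n => mob γ.adjugate (x (φ n)).2) atTop (𝓝 z') := by
      have := (analyticAt_mob hγ.inv.det_pos hw').continuousAt.tendsto.comp hl2
      rwa [← hγz, hγ.mob_inv hz'] at this
    obtain ⟨n, hn⟩ := ((hl1.prodMk hl3).eventually hinj).exists
    have him1 := hK0 _ (hxK (φ n)).1
    have him2 := hK0 _ (hxK (φ n)).2
    have he := hn (by rw [hx1, H.inv _ hγ.inv _ him2, hx2])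
    refine hx3 (φ n) γ hγ ?_
    simp only at he
    rw [he, ← mob_mul _ hγ.inv.det_pos him2, hγ.mul_inv, mob_one]
  have hdisj : Zᶜ ∩ B = ∅ := by
    by_contra hne'
    have hsub := hconn.subset_of_closure_inter_subset H.isOpen_bad
      (Set.nonempty_iff_ne_empty.2 hne') hclos
    obtain ⟨R, hR⟩ := H.exists_bound_equiv
    have hopen : IsOpen {y : ℂ | R < ‖y‖} := isOpen_lt continuous_const continuous_norm
    have hnon : {y : ℂ | R < ‖y‖}.Nonempty := by
      refine ⟨((|R| + 1 : ℝ) : ℂ), ?_⟩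
      simp only [Set.mem_ofPred_eq, norm_real, Real.norm_eq_abs]
      rw [abs_of_pos (by positivity)]
      linarith [le_abs_self R]
    obtain ⟨y, hy, hyZ⟩ := (hZc.dense_compl ℝ).inter_open_nonempty _ hopen hnon
    obtain ⟨z', w', hz', hw', h1, h2, h3⟩ := hsub hyZ
    obtain ⟨γ, hγ, hγz⟩ := hR z' w' hz' hw' (by rw [h1]; exact hy) (h1.trans h2.symm)
    exact h3 γ hγ hγz
  have hd := (hZc.dense_compl ℝ).inter_open_nonempty B H.isOpen_bad ⟨_, hBne⟩
  rw [Set.inter_comm, hdisj] at hd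
  exact Set.not_nonempty_empty hd

/-- `t` takes every nonzero value. -/
theorem exists_eq {y : ℂ} (hy : y ≠ 0) : ∃ z : ℂ, 0 < z.im ∧ t z = y := by
  set B := t '' {z : ℂ | 0 < z.im} with hB
  have hconn : IsPreconnected ({0}ᶜ : Set ℂ) :=
    (isPathConnected_compl_singleton_of_one_lt_rank (by simp) 0).isConnected.isPreconnected
  have hopen : IsOpen B := by
    rw [isOpen_iff_mem_nhds]
    rintro _ ⟨z, hz, rfl⟩
    exact H.nhds_le_map hz (image_mem_map (isOpen_upper.mem_nhds hz))
  have hclos : closure B ∩ {0}ᶜ ⊆ B := by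
    rintro y ⟨hyB, hy0⟩
    have hyn : 0 < ‖y‖ := norm_pos_iff.2 hy0
    obtain ⟨K, hK, hK0, hKr⟩ := H.exists_compact (half_pos hyn) (2 * ‖y‖)
    have hKc : IsClosed (t '' K) := (hK.image_of_continuousOn fun z hz =>
      (H.diff_t z (hK0 z hz)).continuousAt.continuousWithinAt).isClosed
    have hO : IsOpen {x : ℂ | ‖y‖ / 2 < ‖x‖ ∧ ‖x‖ < 2 * ‖y‖} :=
      (isOpen_lt continuous_const continuous_norm).inter (isOpen_lt continuous_norm continuous_const)
    have hyO : y ∈ {x : ℂ | ‖y‖ / 2 < ‖x‖ ∧ ‖x‖ < 2 * ‖y‖} :=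
      ⟨half_lt_self hyn, by linarith⟩
    have h1 : y ∈ closure (t '' K) := by
      rw [mem_closure_iff] at hyB ⊢
      intro o ho hyo
      obtain ⟨x, ⟨hxo, hx⟩, ⟨z, hz, rfl⟩⟩ := hyB _ (ho.inter hO) ⟨hyo, hyO⟩
      obtain ⟨γ, hγ, h2⟩ := hKr z hz hx.1.le hx.2.le
      exact ⟨t z, hxo, mob γ z, h2, H.inv γ hγ z hz⟩
    rw [hKc.closure_eq] at h1
    obtain ⟨z, hz, rfl⟩ := h1
    exact ⟨z, hK0 z hz, rfl⟩
  have := hconn.subset_of_closure_inter_subset hopen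
    ⟨t I, H.t_ne I (by simp), I, by simp, rfl⟩ hclos
  exact this hy

end Haupt

lemma mob_sub_mob {M : M2} (hM : 0 < M.det) {z w : ℂ} (hz : 0 < z.im) (hw : 0 < w.im) :
    mob M w - mob M z = (w - z) * (M.det / (mden M w * mden M z)) := by
  have h1 := mden_ne_zero hM hz
  have h2 := mden_ne_zero hM hw
  have h3 : (M.det : ℂ) = M 0 0 * M 1 1 - M 0 1 * M 1 0 := by rw [det_fin_two]; push_cast; ring
  rw [h3, mob, mob, div_sub_div _ _ h2 h1, mul_div_assoc']
  congr 1
  simp only [mden]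
  ring

/-- The ramification index of `t` at `z`. -/
noncomputable def ram (t : ℂ → ℂ) (z : ℂ) : ℕ := analyticOrderNatAt (fun w => t w - t z) z

/-- A fixed point with multiplier one forces the matrix to be scalar. -/
lemma eq_scalar_of_mden_sq {M : M2} {z : ℂ} (hz : 0 < z.im) (hM : 0 < M.det) (hMz : mob M z = z)
    (hd : mden M z ^ 2 = M.det) : ∃ m : ℤ, M = !![m, 0; 0, m] := by
  have him : (mden M z).im = 0 := by
    have h1 : (mden M z ^ 2).im = 0 := by rw [hd]; simp
    have h2 : 0 < (mden M z ^ 2).re := by rw [hd]; simpa using hM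
    rw [pow_two, mul_im] at h1
    rw [pow_two, mul_re] at h2
    by_contra hne
    have h3 : (mden M z).re = 0 := by
      have : (mden M z).re * (mden M z).im = 0 := by linarith
      exact (mul_eq_zero.1 this).resolve_right hne
    rw [h3] at h2
    nlinarith [sq_nonneg (mden M z).im]
  have hc : M 1 0 = 0 := by
    simp only [mden, add_im, mul_im, intCast_re, intCast_im, zero_mul, add_zero] at him
    have := (mul_eq_zero.1 him).resolve_right hz.ne'
    exact_mod_cast this
  have hne := mden_ne_zero hM hz
  rw [mob, div_eq_iff hne] at hMz
  simp only [mden, hc, Int.cast_zero, zero_mul, zero_add] at hMz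
  have h1 := congrArg Complex.im hMz
  simp only [add_im, mul_im, intCast_re, intCast_im, zero_mul, add_zero, mul_zero, zero_add] at h1
  have h2 : M 0 0 = M 1 1 := by
    have : ((M 0 0 : ℤ) : ℝ) = M 1 1 := mul_right_cancel₀ hz.ne' (by rw [h1]; ring)
    exact_mod_cast this
  have h3 : M 0 1 = 0 := by
    rw [h2, mul_comm] at hMz
    have : ((M 0 1 : ℤ) : ℂ) = 0 := by simpa using hMz
    exact_mod_cast this
  refine ⟨M 1 1, ?_⟩
  ext i j
  fin_cases i <;> fin_cases j <;> simp [hc, h2, h3]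

namespace Haupt

variable {p : ℕ} {k C : ℂ} {c : ℤ → ℂ} {t D G : ℂ → ℂ} (H : Haupt p k C c t D G)
include H

lemma order_ne_top {z : ℂ} (hz : 0 < z.im) (a : ℂ) :
    analyticOrderAt (fun w => t w - a) z ≠ ⊤ := by
  rw [Ne, analyticOrderAt_eq_top]
  intro h
  exact H.not_eventually_const hz a (h.mono fun w hw => sub_eq_zero.1 hw)

lemma analyticAt_sub {z : ℂ} (hz : 0 < z.im) (a : ℂ) : AnalyticAt ℂ (fun w => t w - a) z :=
  (H.isMod.analyticOnNhd z hz).sub analyticAt_const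

lemma order_sub {z : ℂ} (hz : 0 < z.im) :
    analyticOrderAt (fun w => t w - t z) z = ram t z :=
  (Nat.cast_analyticOrderNatAt (H.order_ne_top hz _)).symm

lemma ram_pos {z : ℂ} (hz : 0 < z.im) : 0 < ram t z := by
  have h1 := H.order_sub hz
  rcases Nat.eq_zero_or_pos (ram t z) with h | h
  · rw [h] at h1
    exact absurd (sub_self (t z)) ((H.analyticAt_sub hz _).analyticOrderAt_eq_zero.1 h1)
  · exact h

lemma exists_local {z : ℂ} (hz : 0 < z.im) : ∃ g : ℂ → ℂ, AnalyticAt ℂ g z ∧ g z ≠ 0 ∧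
    ∀ᶠ w in 𝓝 z, t w - t z = (w - z) ^ ram t z * g w := by
  obtain ⟨g, hg, hg0, h⟩ := ((H.analyticAt_sub hz (t z)).analyticOrderAt_ne_top).1
    (H.order_ne_top hz _)
  exact ⟨g, hg, hg0, h⟩

lemma exists_local_diff {M : M2} (hM : 0 < M.det) {z : ℂ} (hz : 0 < z.im) (hMz : mob M z = z) :
    ∃ h : ℂ → ℂ, AnalyticAt ℂ h z ∧
      (h z = 0 ↔ (M.det / mden M z ^ 2 : ℂ) ^ ram t z = 1) ∧
      ∀ᶠ w in 𝓝 z, t w - t (mob M w) = (w - z) ^ ram t z * h w := by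
  obtain ⟨g, hg, hg0, h⟩ := H.exists_local hz
  have hne := mden_ne_zero hM hz
  have hmd : AnalyticAt ℂ (mden M) z := by unfold mden; fun_prop
  have hmob := analyticAt_mob hM hz
  refine ⟨fun w => g w - (M.det / (mden M w * mden M z)) ^ ram t z * g (mob M w), ?_, ?_, ?_⟩
  · refine hg.sub (AnalyticAt.mul (AnalyticAt.pow ?_ _) ?_)
    · exact analyticAt_const.div (hmd.mul analyticAt_const) (mul_ne_zero hne hne)
    · exact AnalyticAt.comp (by rwa [hMz]) hmob
  · simp only [hMz, ← pow_two]
    constructor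
    · intro h0
      have : (1 - (M.det / mden M z ^ 2 : ℂ) ^ ram t z) * g z = 0 := by rw [← h0]; ring
      exact (sub_eq_zero.1 ((mul_eq_zero.1 this).resolve_right hg0)).symm
    · intro h0
      rw [h0]; ring
  · have h' : ∀ᶠ w in 𝓝 z, t (mob M w) - t z = (mob M w - z) ^ ram t z * g (mob M w) := by
      have := hmob.continuousAt.tendsto
      rw [hMz] at this
      exact this.eventually h
    filter_upwards [h, h', isOpen_upper.mem_nhds hz] with w h1 h2 hw
    have h3 := mob_sub_mob hM hz hw
    rw [hMz] at h3
    rw [h3, mul_pow] at h2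
    linear_combination h1 - h2

lemma multiplier_pow {γ : M2} (hγ : IsG0 p γ) {z : ℂ} (hz : 0 < z.im) (hγz : mob γ z = z) :
    mden γ z ^ (2 * ram t z) = 1 := by
  obtain ⟨h, ha, h0, hev⟩ := H.exists_local_diff hγ.det_pos hz hγz
  rw [hγ.1, Int.cast_one, div_pow, one_pow, one_div, inv_eq_one, ← pow_mul] at h0
  refine h0.1 ?_
  have hz0 : ∀ᶠ w in 𝓝[≠] z, h w = 0 := by
    filter_upwards [hev.filter_mono nhdsWithin_le_nhds, self_mem_nhdsWithin,
      mem_nhdsWithin_of_mem_nhds (isOpen_upper.mem_nhds hz)] with w h1 h2 h3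
    rw [H.inv γ hγ w h3, sub_self, eq_comm, mul_eq_zero] at h1
    exact h1.resolve_left (pow_ne_zero _ (sub_ne_zero.2 h2))
  exact tendsto_nhds_unique (ha.continuousAt.tendsto.mono_left nhdsWithin_le_nhds)
    (tendsto_const_nhds.congr' (hz0.mono fun _ h => h.symm))

lemma exists_root {z : ℂ} (hz : 0 < z.im) : ∃ (h : ℂ → ℂ) (a : ℂ), AnalyticAt ℂ h z ∧ h z = 0 ∧
    a ≠ 0 ∧ HasStrictDerivAt h a z ∧ ∀ᶠ w in 𝓝 z, t w - t z = h w ^ ram t z := by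
  obtain ⟨g, hg, hg0, h⟩ := H.exists_local hz
  have hr := (H.ram_pos hz).ne'
  obtain ⟨a, ha⟩ := IsAlgClosed.exists_pow_nat_eq (g z) (H.ram_pos hz)
  have ha0 : a ≠ 0 := fun h0 => hg0 (by rw [← ha, h0, zero_pow hr])
  set s : ℂ → ℂ := fun w => a * (g w / g z) ^ ((ram t z : ℂ)⁻¹) with hs
  have hsa : AnalyticAt ℂ s z := by
    refine analyticAt_const.mul (AnalyticAt.cpow (hg.div analyticAt_const hg0) analyticAt_const ?_)
    rw [div_self hg0]; exact one_mem_slitPlane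
  have hsz : s z = a := by simp [hs, div_self hg0]
  refine ⟨fun w => (w - z) * s w, a, by fun_prop, by simp, ha0, ?_, ?_⟩
  · have hA : AnalyticAt ℂ (fun w => (w - z) * s w) z := by fun_prop
    have hd : HasDerivAt (fun w => (w - z) * s w) a z := by
      have := ((hasDerivAt_id z).sub_const z).mul hsa.differentiableAt.hasDerivAt
      exact this.congr_deriv (by simp [hsz])
    have := hA.hasStrictDerivAt
    rwa [hd.deriv] at this
  · filter_upwards [h] with w hw
    rw [hw, mul_pow, hs]
    simp only
    rw [mul_pow, cpow_nat_inv_pow _ hr, ha, mul_div_cancel₀ _ hg0]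

lemma exists_multiplier {z : ℂ} (hz : 0 < z.im) {ζ : ℂ} (hζ : ζ ^ ram t z = 1) :
    ∃ γ, IsG0 p γ ∧ mob γ z = z ∧ ζ * mden γ z ^ 2 = 1 := by
  obtain ⟨h, a, hA, h0, ha0, hd, hev⟩ := H.exists_root hz
  set ψ := hd.localInverse h a z ha0 with hψ
  have hψd : HasStrictDerivAt ψ a⁻¹ 0 := by
    have := hd.to_localInverse ha0
    rwa [h0] at this
  have hψ0 : ψ 0 = z := by
    have := (hd.hasStrictFDerivAt_equiv ha0).localInverse_apply_image
    rwa [h0] at this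
  have hr : ∀ᶠ ρ in 𝓝 0, h (ψ ρ) = ρ := by
    have := (hd.hasStrictFDerivAt_equiv ha0).eventually_right_inverse
    rwa [h0] at this
  have hψt : Tendsto ψ (𝓝 0) (𝓝 z) := by
    have := hψd.hasDerivAt.continuousAt.tendsto
    rwa [hψ0] at this
  have hζt : Tendsto (fun ρ : ℂ => ζ * ρ) (𝓝 0) (𝓝 0) := by
    have : Continuous fun ρ : ℂ => ζ * ρ := by fun_prop
    simpa using this.tendsto 0
  have hψζ : Tendsto (fun ρ => ψ (ζ * ρ)) (𝓝 0) (𝓝 z) := hψt.comp hζt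
  have hup := isOpen_upper.mem_nhds hz
  have hex : ∀ᶠ ρ in 𝓝 0, ∃ γ ∈ {γ : M2 | IsG0 p γ ∧ mob γ z = z}, mob γ (ψ ρ) = ψ (ζ * ρ) := by
    filter_upwards [hψt.eventually hup, hψζ.eventually hup, hψt.eventually hev, hψζ.eventually hev,
      hr, hζt.eventually hr, (hψt.prodMk hψζ).eventually (eventually_mob_eq one_pos hz hz)]
      with ρ h1 h2 h3 h4 h5 h6 h7
    obtain ⟨γ, hγ, hγρ⟩ := H.equiv_of_eq h1 h2 (by
      have : t (ψ ρ) - t z = t (ψ (ζ * ρ)) - t z := by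
        rw [h3, h4, h5, h6, mul_pow, hζ, one_mul]
      exact sub_left_injective this)
    exact ⟨γ, ⟨hγ, h7 γ hγ.1 hγρ⟩, hγρ⟩
  have hfin : {γ : M2 | IsG0 p γ ∧ mob γ z = z}.Finite :=
    (finite_fixing one_pos hz).subset fun γ hγ => ⟨hγ.1.1, hγ.2⟩
  by_contra! hne
  have hall : ∀ᶠ ρ in 𝓝[≠] 0, ∀ γ ∈ {γ : M2 | IsG0 p γ ∧ mob γ z = z}, mob γ (ψ ρ) ≠ ψ (ζ * ρ) := by
    rw [eventually_all_finite hfin]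
    rintro γ ⟨hγ, hγz⟩
    have hd1 : HasDerivAt (fun ρ => mob γ (ψ ρ)) (1 / mden γ z ^ 2 * a⁻¹) 0 := by
      have e := hasDerivAt_mob hγ.det_pos hz
      rw [hγ.1, Int.cast_one] at e
      rw [← hψ0] at e
      have := e.comp 0 hψd.hasDerivAt
      rwa [hψ0] at this
    have hd2 : HasDerivAt (fun ρ => ψ (ζ * ρ)) (a⁻¹ * (ζ * 1)) 0 := by
      have e := (hasDerivAt_id (0 : ℂ)).const_mul ζ
      have e2 := hψd.hasDerivAt
      rw [← mul_zero ζ] at e2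
      exact HasDerivAt.comp (0 : ℂ) e2 e
    have hmne := mden_ne_zero hγ.det_pos hz
    have := (hd1.sub hd2).eventually_ne (c := 0) (by
      intro h
      refine hne γ hγ hγz ?_
      have h' : (1 / mden γ z ^ 2 - ζ) * a⁻¹ = 0 := by rw [← h]; ring
      have h'' := (mul_eq_zero.1 h').resolve_right (inv_ne_zero ha0)
      rw [← sub_eq_zero.1 h'']
      field_simp)
    exact this.mono fun ρ h => sub_ne_zero.1 h
  obtain ⟨ρ, h1, h2⟩ := ((hex.filter_mono nhdsWithin_le_nhds).and hall).exists
  obtain ⟨γ, hγ, h3⟩ := h1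
  exact h2 γ hγ h3

/-- The order of the stabilizer in `Γ₀(p)` is twice the ramification index. -/
theorem card_stabilizer {z : ℂ} (hz : 0 < z.im) :
    {γ : M2 | IsG0 p γ ∧ mob γ z = z}.ncard = 2 * ram t z := by
  have hpos : 0 < 2 * ram t z := by have := H.ram_pos hz; omega
  have hinj : Set.InjOn (fun γ => mden γ z) {γ : M2 | IsG0 p γ ∧ mob γ z = z} := by
    rintro γ ⟨hγ, hγz⟩ δ ⟨hδ, hδz⟩ h
    have key : ∀ a b c d : ℤ, (a : ℂ) * z + b = c * z + d → a = c ∧ b = d := by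
      intro a b c d h
      have h1 := congrArg Complex.im h
      simp only [add_im, mul_im, intCast_re, intCast_im, zero_mul, add_zero] at h1
      have h2 : a = c := by exact_mod_cast mul_right_cancel₀ hz.ne' h1
      rw [h2] at h
      exact ⟨h2, by exact_mod_cast add_left_cancel h⟩
    simp only at h
    have h1 := key _ _ _ _ (show (γ 1 0 : ℂ) * z + γ 1 1 = δ 1 0 * z + δ 1 1 from h)
    have h2 : (γ 0 0 : ℂ) * z + γ 0 1 = δ 0 0 * z + δ 0 1 := by
      rw [mob, div_eq_iff (mden_ne_zero hγ.det_pos hz)] at hγz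
      rw [mob, div_eq_iff (mden_ne_zero hδ.det_pos hz)] at hδz
      rw [hγz, hδz, h]
    have h3 := key _ _ _ _ h2
    ext i j
    fin_cases i <;> fin_cases j
    exacts [h3.1, h3.2, h1.1, h1.2]
  have himg : (fun γ => mden γ z) '' {γ : M2 | IsG0 p γ ∧ mob γ z = z} =
      (Polynomial.nthRootsFinset (2 * ram t z) (1 : ℂ) : Set ℂ) := by
    ext x
    rw [Finset.mem_coe, Polynomial.mem_nthRootsFinset hpos]
    constructor
    · rintro ⟨γ, ⟨hγ, hγz⟩, rfl⟩
      exact H.multiplier_pow hγ hz hγz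
    · intro hx
      have hx0 : x ≠ 0 := by rintro rfl; rw [zero_pow hpos.ne'] at hx; exact zero_ne_one hx
      obtain ⟨γ, hγ, hγz, hm⟩ := H.exists_multiplier hz (ζ := (x ^ 2)⁻¹)
        (by rw [inv_pow, ← pow_mul, hx, inv_one])
      have hsq : mden γ z ^ 2 = x ^ 2 := by field_simp at hm; exact hm
      rcases sq_eq_sq_iff_eq_or_eq_neg.1 hsq with h | h
      · exact ⟨γ, ⟨hγ, hγz⟩, h⟩
      · refine ⟨-γ, ⟨hγ.neg, by rw [mob_neg, hγz]⟩, ?_⟩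
        simp only [mden, neg_apply, Int.cast_neg] at h ⊢
        linear_combination -h
  rw [← hinj.ncard_image, himg, Set.ncard_coe_finset,
    (Complex.isPrimitiveRoot_exp _ hpos.ne').card_nthRootsFinset]

/-- The order of vanishing of `t(τ) - t(Mτ)` at a fixed point of `M`. -/
theorem order_diff {n : ℤ} (hn : 0 < n) {M : M2} (hM : IsR p n M) {z : ℂ} (hz : 0 < z.im)
    (hMz : mob M z = z) (hns : ∀ (γ : M2) (m : ℤ), IsG0 p γ → M ≠ m • γ) :
    analyticOrderAt (fun w => t w - t (mob M w)) z = ram t z := by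
  have hMd : 0 < M.det := by rw [hM.1]; exact hn
  obtain ⟨h, ha, h0, hev⟩ := H.exists_local_diff hMd hz hMz
  have hh : h z ≠ 0 := by
    intro hz0
    obtain ⟨γ, hγ, hγz, hm⟩ := H.exists_multiplier hz (h0.1 hz0)
    have hne := mden_ne_zero hMd hz
    have hr : IsR p n (M * γ.adjugate) := hM.mul_right hγ.inv
    have hγi : mob γ.adjugate z = z := by
      conv_lhs => rw [← hγz]
      exact hγ.mob_inv hz
    have hd := mden_mul M hγ.inv.det_pos hz
    rw [hγi] at hd
    have hd2 := mden_mul γ.adjugate hγ.det_pos hz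
    rw [hγ.inv_mul, hγz] at hd2
    have hone : mden 1 z = 1 := by simp [mden]
    rw [hone] at hd2
    obtain ⟨m, hm'⟩ := eq_scalar_of_mden_sq hz (M := M * γ.adjugate) (by rw [hr.1]; exact hn)
      (by rw [mob_mul _ hγ.inv.det_pos hz, hγi, hMz]) (by
        rw [hd, mul_pow, hr.1, ← hM.1]
        have e1 : (M.det : ℂ) * mden γ z ^ 2 = mden M z ^ 2 := by
          field_simp at hm; exact hm
        rw [← e1]
        linear_combination -(M.det : ℂ) * (1 + mden γ.adjugate z * mden γ z) * hd2)
    refine hns γ m hγ ?_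
    calc M = (M * γ.adjugate) * γ := by rw [Matrix.mul_assoc, hγ.inv_mul, Matrix.mul_one]
      _ = m • γ := by
        rw [hm']
        ext i j
        fin_cases i <;> fin_cases j <;> simp [Matrix.mul_apply, Fin.sum_univ_two]
  have hA : AnalyticAt ℂ (fun w => t w - t (mob M w)) z :=
    (H.isMod.analyticOnNhd z hz).sub (AnalyticAt.comp (by
      rw [hMz]; exact H.isMod.analyticOnNhd z hz) (analyticAt_mob hMd hz))
  exact hA.analyticOrderAt_eq_natCast.2 ⟨h, ha, hh, by simpa only [smul_eq_mul] using hev⟩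

end Haupt

/-- The second Faber polynomial of a hauptmodul `q⁻¹ - k + c₁ q + ⋯`. -/
def faber (k c₁ x : ℂ) : ℂ := (x + k) ^ 2 - 2 * c₁

/-- The second Faber polynomial of the Fricke hauptmodul, as a function of `x = t`. -/
noncomputable def frickeFaber (k c₁ C x : ℂ) : ℂ :=
  faber k c₁ x + faber k c₁ (C / x) - faber k c₁ 0

lemma HasJ.exists_tendsto {F : ℂ → ℂ} {A : ℤ} {c u L : ℂ} (hF : HasJ F A c u L) {N : ℕ} (hN : A < N) :
    Tendsto (fun τ => F τ * qc τ ^ N) cusp (𝓝 0) := by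
  obtain ⟨hc, ε, hε, h⟩ := hF
  have h1 := (tendsto_qc_sq_coeff (a := u) (b := L / 2) hε).cexp
  have h2 := (tendsto_norm_qc_zpow_neg (A := A - N) (by linarith)).mul h1 |>.const_mul c
  rw [zero_mul, mul_zero] at h2
  refine h2.congr' ?_
  filter_upwards [h] with τ hτ
  rw [hτ, show -(A - (N : ℤ)) = -A + N by ring, zpow_add₀ (qc_ne_zero τ), zpow_natCast]
  ring

lemma HasL2.multiset_prod {F : ℂ → ℂ → ℂ} {A : ℤ} {L : ℂ → ℂ} (R : Multiset ℂ)
    (h : ∀ x ∈ R, HasL2 (F x) A (L x)) :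
    ∃ B, HasL2 (fun τ => (R.map fun x => F x τ).prod) B (R.map L).sum := by
  induction R using Multiset.induction_on with
  | empty => exact ⟨0, by simpa using HasL2.const one_ne_zero⟩
  | cons x R ih =>
    obtain ⟨B, hB⟩ := ih fun y hy => h y (Multiset.mem_cons_of_mem hy)
    refine ⟨A + B, ?_⟩
    simp only [Multiset.map_cons, Multiset.prod_cons, Multiset.sum_cons]
    exact (h x (Multiset.mem_cons_self x R)).mul hB

namespace Haupt

variable {p : ℕ} {k C : ℂ} {c : ℤ → ℂ} {t D G : ℂ → ℂ} (H : Haupt p k C c t D G)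
include H

lemma hasL2_sub (x : ℂ) : HasL2 (fun z => t z - x) 1 (-faber k (c 1) x) := by
  have h : HasJ (fun z => t z - x) 1 1 (-(k + x)) (2 * c 1 - (-(k + x)) ^ 2) := by
    refine hasJ_of_taylor (ε := fun z => qc z ^ 2 * (G (qc z) - c 1)) one_ne_zero ?_ ?_
    · have := H.tendsto_G.sub_const (c 1)
      rw [sub_self] at this
      refine this.congr fun z => ?_
      rw [mul_div_cancel_left₀ _ (pow_ne_zero 2 (qc_ne_zero z))]
    · filter_upwards [eventually_cusp_im 0] with z hz
      have := qc_ne_zero z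
      rw [H.qexp z hz, _root_.zpow_neg_one]
      field_simp
      ring
  exact ⟨_, _, by convert h using 1; rw [faber]; ring⟩

lemma hasL2 : HasL2 t 1 (-faber k (c 1) 0) := by simpa using H.hasL2_sub 0

lemma order_eq_zero {z : ℂ} (hz : 0 < z.im) {a : ℂ} (h : a ≠ t z) :
    analyticOrderAt (fun w => t w - a) z = 0 :=
  (H.analyticAt_sub hz a).analyticOrderAt_eq_zero.2 (sub_ne_zero.2 h.symm)

lemma order_prod {z : ℂ} (hz : 0 < z.im) (R : Multiset ℂ) :
    AnalyticAt ℂ (fun w => (R.map fun x => t w - x).prod) z ∧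
    analyticOrderAt (fun w => (R.map fun x => t w - x).prod) z = (R.count (t z) * ram t z : ℕ) := by
  induction R using Multiset.induction_on with
  | empty =>
    simp only [Multiset.map_zero, Multiset.prod_zero, Multiset.count_zero, zero_mul, Nat.cast_zero]
    exact ⟨analyticAt_const, analyticAt_const.analyticOrderAt_eq_zero.2 one_ne_zero⟩
  | cons x R ih =>
    simp only [Multiset.map_cons, Multiset.prod_cons]
    refine ⟨(H.analyticAt_sub hz x).mul ih.1, ?_⟩
    have := analyticOrderAt_mul (H.analyticAt_sub hz x) ih.1
    refine this.trans ?_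
    rw [ih.2, Multiset.count_cons]
    split_ifs with h
    · rw [← h, H.order_sub hz]; push_cast; ring
    · rw [H.order_eq_zero hz (Ne.symm h)]; simp

/-- The divisor of an invariant function, and the trace of `frickeFaber` over it. -/
theorem exists_divisor {f : ℂ → ℂ} (hf : IsMod p f) {A A' : ℤ} {L L' : ℂ} (hL : HasL2 f A L)
    (hL' : HasL2 (fun z => f (mob (wMat p) z)) A' L') :
    ∃ R : Multiset ℂ, (∀ x ∈ R, x ≠ 0) ∧
      (∀ z : ℂ, 0 < z.im → analyticOrderAt f z = (R.count (t z) * ram t z : ℕ)) ∧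
      (R.map (frickeFaber k (c 1) C)).sum = -(L + L') := by
  have hJ := hL
  have hJ' := hL'
  obtain ⟨c₀, u, hc0⟩ := hL
  obtain ⟨c₀', u', hc0'⟩ := hL'
  set B : ℕ := A'.toNat + 1 with hB
  obtain ⟨Q, hQ⟩ := H.exists_polynomial (A.toNat + 1) B hf
    (hc0.exists_tendsto (by push_cast; linarith [A.self_le_toNat]))
    (hc0'.exists_tendsto (by rw [hB]; push_cast; linarith [A'.self_le_toNat]))
  have hQ0 : Q ≠ 0 := by
    rintro rfl
    obtain ⟨z, hz, hz0⟩ := (hc0.eventually_ne.and (eventually_cusp_im 0)).exists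
    have := hQ z hz0
    rw [Polynomial.eval_zero] at this
    exact mul_ne_zero hz (pow_ne_zero _ (H.t_ne z hz0)) this
  have hfac : ∀ x, Q.eval x = Q.leadingCoeff * (Q.roots.map fun y => x - y).prod := by
    intro x
    conv_lhs => rw [(IsAlgClosed.splits Q).eq_prod_roots]
    rw [Polynomial.eval_mul, Polynomial.eval_C, Polynomial.eval_multiset_prod, Multiset.map_map]
    simp
  have hlc : Q.leadingCoeff ≠ 0 := Polynomial.leadingCoeff_ne_zero.2 hQ0
  set R := Q.roots.filter (· ≠ 0) with hR
  set m := Q.roots.count 0 with hm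
  have hRm : ∀ x, Q.eval x = Q.leadingCoeff * (x ^ m * (R.map fun y => x - y).prod) := by
    intro x
    rw [hfac]
    conv_lhs => rw [← Multiset.filter_add_not (· ≠ 0) Q.roots]
    rw [Multiset.map_add, Multiset.prod_add]
    have : Q.roots.filter (fun a => ¬ a ≠ 0) = Multiset.replicate m 0 := by
      rw [hm, ← Multiset.filter_eq']
      congr 1
      ext a; simp
    rw [this, Multiset.map_replicate, Multiset.prod_replicate, sub_zero]
    ring
  have hR0 : ∀ x ∈ R, x ≠ 0 := fun x hx => (Multiset.mem_filter.1 hx).2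
  refine ⟨R, hR0, fun z hz => ?_, ?_⟩
  · have hfa := hf.analyticOnNhd z hz
    have htB : AnalyticAt ℂ (fun w => t w ^ B) z := (H.isMod.analyticOnNhd z hz).pow B
    have htm : AnalyticAt ℂ (fun w => Q.leadingCoeff * t w ^ m) z :=
      analyticAt_const.mul ((H.isMod.analyticOnNhd z hz).pow m)
    have h1 : analyticOrderAt (fun w => f w * t w ^ B) z = analyticOrderAt f z := by
      refine (analyticOrderAt_mul hfa htB).trans ?_
      rw [htB.analyticOrderAt_eq_zero.2 (pow_ne_zero _ (H.t_ne z hz)), add_zero]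
    have hP := H.order_prod hz R
    have h2 : analyticOrderAt (fun w => (Q.leadingCoeff * t w ^ m) *
        (R.map fun y => t w - y).prod) z = (R.count (t z) * ram t z : ℕ) := by
      refine (analyticOrderAt_mul htm hP.1).trans ?_
      rw [htm.analyticOrderAt_eq_zero.2 (mul_ne_zero hlc (pow_ne_zero _ (H.t_ne z hz))), zero_add,
        hP.2]
    rw [← h1, ← h2]
    refine analyticOrderAt_congr ?_
    filter_upwards [isOpen_upper.mem_nhds hz] with w hw
    rw [hQ w hw, hRm, mul_assoc]
  · obtain ⟨B₁, hB₁⟩ := HasL2.multiset_prod (F := fun x z => t z - x) R fun x _ => H.hasL2_sub x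
    have e1 := (hJ.mul (H.hasL2.pow B)).unique
      (((HasL2.const hlc).mul ((H.hasL2.pow m).mul hB₁)).congr (by
        filter_upwards [eventually_cusp_im 0] with z hz
        rw [hQ z hz, hRm]))
    have hsub : ∀ x ∈ R, HasL2 (fun z => C / t z - x) 0 (faber k (c 1) 0 - faber k (c 1) (C / x)) := by
      intro x hx
      have hx0 := hR0 x hx
      have h1 := ((HasL2.const (neg_ne_zero.2 hx0)).div H.hasL2).mul (H.hasL2_sub (C / x))
      rw [show (0 : ℤ) - 1 + 1 = 0 by norm_num, show 0 - -faber k (c 1) 0 + -faber k (c 1) (C / x) =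
        faber k (c 1) 0 - faber k (c 1) (C / x) by ring] at h1
      refine h1.congr ?_
      filter_upwards [eventually_cusp_im 0] with z hz
      have := H.t_ne z hz
      field_simp
      ring
    obtain ⟨B₂, hB₂⟩ := HasL2.multiset_prod (F := fun x z => C / t z - x) R hsub
    have hCt : HasL2 (fun z => C / t z) (0 - 1) (0 - -faber k (c 1) 0) :=
      (HasL2.const H.C_ne).div H.hasL2
    have e2 := (hJ'.mul (hCt.pow B)).unique
      (((HasL2.const hlc).mul ((hCt.pow m).mul hB₂)).congr (by
        filter_upwards [eventually_cusp_im 0] with z hz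
        have h1 := hQ (mob (wMat p) z) (mob_im_pos H.det_wMat_pos hz)
        rw [hRm, H.fricke z hz] at h1
        exact h1))
    have hs : (R.map (frickeFaber k (c 1) C)).sum = -(R.map fun x => -faber k (c 1) x).sum -
        (R.map fun x => faber k (c 1) 0 - faber k (c 1) (C / x)).sum := by
      rw [← Multiset.sum_map_neg', Multiset.map_map, ← Multiset.sum_map_sub]
      congr 1
      refine Multiset.map_congr rfl fun x _ => ?_
      simp only [frickeFaber, Function.comp]; ring
    rw [hs]
    linear_combination e1.2 + e2.2

end Haupt

/-- The invariant function whose divisor measures the ramification of `t`. -/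
noncomputable def ramFun (t D : ℂ → ℂ) (z : ℂ) : ℂ := (deriv t z / t z) ^ 12 / D z

lemma hasDerivAt_qc (z : ℂ) : HasDerivAt qc (2 * Real.pi * I * qc z) z := by
  unfold qc
  have := (((hasDerivAt_id z).const_mul (2 * Real.pi * I)).cexp)
  exact this.congr_deriv (by simp; ring)

namespace Haupt

variable {p : ℕ} {k C : ℂ} {c : ℤ → ℂ} {t D G : ℂ → ℂ} (H : Haupt p k C c t D G)
include H

lemma hasL2_deriv : HasL2 (deriv t) 1 (-2 * c 1) := by
  obtain ⟨ps, hG, -⟩ := H.series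
  have hGa := hG.analyticAt
  have hpi : (2 * Real.pi * I : ℂ) ≠ 0 := two_pi_I_ne_zero
  have h : HasJ (deriv t) 1 (-(2 * Real.pi * I)) 0 (2 * (-c 1) - 0 ^ 2) := by
    refine hasJ_of_taylor
      (ε := fun z => -(qc z ^ 2 * ((G (qc z) - c 1) + qc z * deriv G (qc z)))) (neg_ne_zero.2 hpi) ?_ ?_
    · have h1 := H.tendsto_G.sub_const (c 1)
      have h2 := tendsto_qc.mul (hGa.deriv.continuousAt.tendsto.comp tendsto_qc)
      have h3 := (h1.add h2).neg
      rw [sub_self, zero_mul, add_zero, neg_zero] at h3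
      refine h3.congr fun z => ?_
      rw [neg_div, mul_div_cancel_left₀ _ (pow_ne_zero 2 (qc_ne_zero z))]
      rfl
    · filter_upwards [eventually_cusp_im 0, tendsto_qc.eventually hGa.eventually_analyticAt]
        with z hz hGz
      have hq := qc_ne_zero z
      have hd := (((hasDerivAt_qc z).inv hq).sub_const k).add
        ((hasDerivAt_qc z).mul (hGz.differentiableAt.hasDerivAt.comp z (hasDerivAt_qc z)))
      have he : t =ᶠ[𝓝 z] (fun w => (qc w)⁻¹ - k + qc w * G (qc w)) := by
        filter_upwards [isOpen_upper.mem_nhds hz] with w hw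
        exact H.qexp w hw
      rw [(HasDerivAt.congr_of_eventuallyEq hd he).deriv, _root_.zpow_neg_one]
      simp only [Function.comp]
      field_simp
      ring
  exact ⟨_, _, by convert h using 1; ring⟩

lemma analyticAt_deriv {z : ℂ} (hz : 0 < z.im) : AnalyticAt ℂ (deriv t) z :=
  (H.isMod.analyticOnNhd z hz).deriv

lemma logDeriv_mob {γ : M2} (hγ : IsG0 p γ) {z : ℂ} (hz : 0 < z.im) :
    deriv t (mob γ z) / t (mob γ z) = mden γ z ^ 2 * (deriv t z / t z) := by
  have h1 : HasDerivAt (fun w => t (mob γ w)) (deriv t (mob γ z) * (γ.det / mden γ z ^ 2)) z :=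
    ((H.diff_t _ (mob_im_pos hγ.det_pos hz)).hasDerivAt).comp z (hasDerivAt_mob hγ.det_pos hz)
  have he : (fun w => t (mob γ w)) =ᶠ[𝓝 z] t := by
    filter_upwards [isOpen_upper.mem_nhds hz] with w hw
    exact H.inv γ hγ w hw
  have h2 := (h1.congr_of_eventuallyEq he.symm).deriv
  have hne := mden_ne_zero hγ.det_pos hz
  rw [hγ.1, Int.cast_one] at h2
  rw [H.inv γ hγ z hz, h2]
  field_simp

lemma logDeriv_wMat {z : ℂ} (hz : 0 < z.im) :
    deriv t (mob (wMat p) z) / t (mob (wMat p) z) = -(p * z ^ 2) * (deriv t z / t z) := by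
  have hW := H.det_wMat_pos
  have h1 : HasDerivAt (fun w => t (mob (wMat p) w))
      (deriv t (mob (wMat p) z) * ((wMat p).det / mden (wMat p) z ^ 2)) z :=
    ((H.diff_t _ (mob_im_pos hW hz)).hasDerivAt).comp z (hasDerivAt_mob hW hz)
  have he : (fun w => t (mob (wMat p) w)) =ᶠ[𝓝 z] fun w => C / t w := by
    filter_upwards [isOpen_upper.mem_nhds hz] with w hw
    exact H.fricke w hw
  have ht := H.t_ne z hz
  have h3 : HasDerivAt (fun w => C / t w) ((0 * t z - C * deriv t z) / t z ^ 2) z :=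
    (hasDerivAt_const z C).div (H.diff_t z hz).hasDerivAt ht
  have h2 := h1.unique (h3.congr_of_eventuallyEq he)
  have hz0 : z ≠ 0 := fun h => by simp [h] at hz
  have hp0 : (p : ℂ) ≠ 0 := by exact_mod_cast H.prime.ne_zero
  have hC := H.C_ne
  have hmd : mden (wMat p) z = p * z := by simp [mden, wMat]
  rw [det_wMat, hmd] at h2
  rw [H.fricke z hz]
  push_cast at h2
  field_simp at h2 ⊢
  linear_combination h2

lemma isMod_ramFun : IsMod p (ramFun t D) := by
  constructor
  · intro z hz
    exact (((H.analyticAt_deriv hz).differentiableAt.div (H.diff_t z hz) (H.t_ne z hz)).pow 12).div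
      (H.diff_D z hz) (H.D_ne z hz)
  · intro γ hγ z hz
    have hne := mden_ne_zero hγ.det_pos hz
    have := H.D_ne z hz
    rw [ramFun, ramFun, H.logDeriv_mob hγ hz, H.inv_D γ hγ z hz, mul_pow, ← pow_mul,
      mul_div_mul_left _ _ (pow_ne_zero _ hne)]

lemma ramFun_wMat {z : ℂ} (hz : 0 < z.im) : ramFun t D (mob (wMat p) z) = ramFun t D z := by
  have hz0 : z ≠ 0 := fun h => by simp [h] at hz
  have hp0 : (p : ℂ) ≠ 0 := by exact_mod_cast H.prime.ne_zero
  rw [ramFun, ramFun, H.logDeriv_wMat hz, H.fricke_D z hz, mul_pow,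
    show (-((p : ℂ) * z ^ 2)) ^ 12 = p ^ 12 * z ^ 24 by ring,
    mul_div_mul_left _ _ (by positivity)]

lemma hasL2_ramFun : HasL2 (ramFun t D) (p + 1)
    (12 * (faber k (c 1) 0 - 2 * c 1) + 72 + 48 * if p = 2 then 1 else 0) := by
  have h := ((H.hasL2_deriv.div H.hasL2).pow 12).div H.hasL2_D
  convert h using 1
  · rfl
  · push_cast; ring
  · push_cast; ring

lemma order_ramFun {z : ℂ} (hz : 0 < z.im) :
    analyticOrderAt (ramFun t D) z + 12 = (12 * ram t z : ℕ) := by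
  have hA := H.isMod.analyticOnNhd z hz
  have hD : AnalyticAt ℂ D z :=
    DifferentiableOn.analyticAt (fun w hw => (H.diff_D w hw).differentiableWithinAt)
      (isOpen_upper.mem_nhds hz)
  have h1 := hA.analyticOrderAt_deriv_add_one
  have h2 : AnalyticAt ℂ (fun w => (t w ^ 12 * D w)⁻¹) z :=
    ((hA.pow 12).mul hD).inv (mul_ne_zero (pow_ne_zero _ (H.t_ne z hz)) (H.D_ne z hz))
  have h3 : ramFun t D = fun w => deriv t w ^ 12 * (t w ^ 12 * D w)⁻¹ := by
    funext w
    rw [ramFun, div_pow, div_div, div_eq_mul_inv]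
  have h4 : analyticOrderAt (fun w => deriv t w ^ 12 * (t w ^ 12 * D w)⁻¹) z =
      12 * analyticOrderAt (deriv t) z := by
    refine (analyticOrderAt_mul (H.analyticAt_deriv hz |>.pow 12) h2).trans ?_
    rw [h2.analyticOrderAt_eq_zero.2 (inv_ne_zero
      (mul_ne_zero (pow_ne_zero _ (H.t_ne z hz)) (H.D_ne z hz))), add_zero,
      analyticOrderAt_pow (H.analyticAt_deriv hz)]
    simp
  rw [h3, h4]
  have h5 := H.order_sub hz
  rw [← h1] at h5
  push_cast
  rw [← h5, mul_add, mul_one]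

end Haupt

/-- Indices for representatives of `Γ₀(p)` acting on the left on matrices of determinant `n`. -/
def repIdx (p n : ℕ) : Finset ((Σ _ : ℕ, ℕ) ⊕ (Σ _ : ℕ, ℕ)) :=
  (n.divisors.sigma fun a => Finset.range (n / a)).disjSum
    ((n.divisors.filter (p ∣ ·)).sigma fun g => Finset.range (p * (n / g)))

/-- Representatives of `Γ₀(p)` acting on the left on matrices of determinant `n`. -/
def repMat (n : ℕ) : ((Σ _ : ℕ, ℕ) ⊕ (Σ _ : ℕ, ℕ)) → M2
  | .inl x => !![(x.1 : ℤ), (x.2 : ℤ); 0, ((n / x.1 : ℕ) : ℤ)]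
  | .inr x => !![0, -((n / x.1 : ℕ) : ℤ); (x.1 : ℤ), (x.2 : ℤ)]

lemma repMat_isR {p n : ℕ} {i} (hi : i ∈ repIdx p n) : IsR p n (repMat n i) := by
  rcases i with ⟨a, b⟩ | ⟨g, b⟩
  · simp only [repIdx, Finset.inl_mem_disjSum, Finset.mem_sigma, Nat.mem_divisors] at hi
    refine ⟨?_, by simp [repMat]⟩
    simp only [repMat, det_fin_two_of, mul_zero, sub_zero]
    exact_mod_cast Nat.mul_div_cancel' hi.1.1
  · simp only [repIdx, Finset.inr_mem_disjSum, Finset.mem_sigma, Finset.mem_filter,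
      Nat.mem_divisors] at hi
    refine ⟨?_, by simpa [repMat] using Int.natCast_dvd_natCast.2 hi.1.2⟩
    simp only [repMat, det_fin_two_of, zero_mul, zero_sub, neg_mul, neg_neg]
    exact_mod_cast Nat.div_mul_cancel hi.1.1.1

lemma exists_shift (b : ℤ) {d : ℤ} (hd : 0 < d) : ∃ (l : ℤ) (b' : ℕ), (b' : ℤ) < d ∧ b + l * d = b' := by
  refine ⟨-(b / d), (b % d).toNat, ?_, ?_⟩
  · rw [Int.toNat_of_nonneg (Int.emod_nonneg b hd.ne')]; exact Int.emod_lt_of_pos b hd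
  · rw [Int.toNat_of_nonneg (Int.emod_nonneg b hd.ne')]
    have := Int.emod_add_mul_ediv b d
    linarith

lemma exists_rep {p n : ℕ} (hp : p.Prime) (hn : 0 < n) {M : M2} (hM : IsR p n M) :
    ∃ i ∈ repIdx p n, ∃ γ, IsG0 p γ ∧ γ * M = repMat n i := by
  obtain ⟨hdet, c₁, hc₁⟩ := hM
  rw [det_fin_two] at hdet
  set a := M 0 0 with ha
  set b := M 0 1 with hb
  set c := M 1 0 with hc
  set d := M 1 1 with hd
  have hMe : M = !![a, b; c, d] := by ext i j; fin_cases i <;> fin_cases j <;> rfl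
  have hn' : (0 : ℤ) < n := by exact_mod_cast hn
  have h0 : 0 < Int.gcd a c := by
    rw [Int.gcd_pos_iff]
    by_contra! h
    rw [h.1, h.2] at hdet
    simp at hdet
    omega
  set h : ℕ := Int.gcd a c with hh
  obtain ⟨a', ha'⟩ : (h : ℤ) ∣ a := Int.gcd_dvd_left ..
  obtain ⟨c', hc'⟩ : (h : ℤ) ∣ c := Int.gcd_dvd_right ..
  have hZ : (h : ℤ) ≠ 0 := by exact_mod_cast h0.ne'
  have hcop : IsCoprime a' c' := by
    have h1 := Int.gcd_eq_gcd_ab a c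
    refine ⟨Int.gcdA a c, Int.gcdB a c, ?_⟩
    apply mul_left_cancel₀ hZ
    rw [mul_one]
    linear_combination -h1 - Int.gcdA a c * ha' - Int.gcdB a c * hc'
  have hdet' : (n : ℤ) = h * (a' * d - b * c') := by rw [← hdet, ha', hc']; ring
  have hD : 0 < a' * d - b * c' := by
    by_contra! hle
    have : (h : ℤ) * (a' * d - b * c') ≤ 0 :=
      mul_nonpos_of_nonneg_of_nonpos (by positivity) hle
    omega
  have hdvd : h ∣ n := by exact_mod_cast Dvd.intro _ hdet'.symm
  have hquot : ((n / h : ℕ) : ℤ) = a' * d - b * c' := by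
    push_cast
    rw [hdet', Int.mul_ediv_cancel_left _ hZ]
  by_cases hpc : (p : ℤ) ∣ c'
  · obtain ⟨x, y, hxy⟩ := hcop
    obtain ⟨l, b', hb', hl⟩ := exists_shift (x * b + y * d) hD
    refine ⟨.inl ⟨h, b'⟩, ?_, !![x - l * c', y + l * a'; -c', a'], ⟨?_, ?_⟩, ?_⟩
    · simp only [repIdx, Finset.inl_mem_disjSum, Finset.mem_sigma, Nat.mem_divisors, Finset.mem_range]
      exact ⟨⟨hdvd, hn.ne'⟩, by rw [← hquot] at hb'; exact_mod_cast hb'⟩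
    · rw [det_fin_two_of]; linear_combination hxy
    · simpa using hpc
    · rw [hMe]
      ext i j
      fin_cases i <;> fin_cases j <;> simp [repMat, Matrix.mul_apply, Fin.sum_univ_two]
      · rw [ha', hc']; linear_combination (h : ℤ) * hxy
      · linear_combination hl
      · rw [ha', hc']; ring
      · rw [← Int.natCast_ediv, hquot]; ring
  · have hpP : Prime (p : ℤ) := Nat.prime_iff_prime_int.1 hp
    have hph : (p : ℤ) ∣ h := by
      have : (p : ℤ) ∣ h * c' := by rw [← hc', hc₁]; exact dvd_mul_right _ _
      exact (hpP.dvd_or_dvd this).resolve_right hpc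
    have hcop2 : IsCoprime (p * a') c' :=
      IsCoprime.mul_left ((Prime.coprime_iff_not_dvd hpP).2 hpc) hcop
    obtain ⟨u, v, huv⟩ := hcop2
    have hpD : 0 < (p : ℤ) * (a' * d - b * c') := mul_pos (by exact_mod_cast hp.pos) hD
    obtain ⟨l, b', hb', hl⟩ := exists_shift (p * u * b + v * d) hpD
    refine ⟨.inr ⟨h, b'⟩, ?_, !![c', -a'; p * (u - l * c'), v + p * l * a'], ⟨?_, ?_⟩, ?_⟩
    · simp only [repIdx, Finset.inr_mem_disjSum, Finset.mem_sigma, Nat.mem_divisors, Finset.mem_range,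
        Finset.mem_filter]
      exact ⟨⟨⟨hdvd, hn.ne'⟩, by exact_mod_cast hph⟩, by rw [← hquot] at hb'; exact_mod_cast hb'⟩
    · rw [det_fin_two_of]; linear_combination huv
    · simp
    · rw [hMe]
      ext i j
      fin_cases i <;> fin_cases j <;> simp [repMat, Matrix.mul_apply, Fin.sum_univ_two]
      · rw [ha', hc']; ring
      · rw [← Int.natCast_ediv, hquot]; ring
      · rw [ha', hc']; linear_combination (h : ℤ) * huv
      · linear_combination hl

lemma shift_unique {b b' d k : ℤ} (h0 : 0 ≤ b) (h1 : b < d) (h0' : 0 ≤ b') (h1' : b' < d)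
    (h : b = b' + k * d) : b = b' := by
  rw [← Int.emod_eq_of_lt h0 h1, ← Int.emod_eq_of_lt h0' h1', h, Int.add_mul_emod_self_right]

lemma rep_unique {p n : ℕ} (hp : p.Prime) {i j} (hi : i ∈ repIdx p n) (hj : j ∈ repIdx p n)
    {γ : M2} (hγ : IsG0 p γ) (h : repMat n i = γ * repMat n j) : i = j := by
  obtain ⟨hdet, w, hw⟩ := hγ
  rw [det_fin_two, hw] at hdet
  have hp2 : (2 : ℤ) ≤ p := by exact_mod_cast hp.two_le
  have hnot : ∀ x : ℤ, (p : ℤ) * x ≠ 1 := by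
    intro x hx
    have := Int.le_of_dvd one_pos (Dvd.intro x hx)
    omega
  have e00 := congrFun (congrFun h 0) 0
  have e01 := congrFun (congrFun h 0) 1
  have e10 := congrFun (congrFun h 1) 0
  have e11 := congrFun (congrFun h 1) 1
  simp only [Matrix.mul_apply, Fin.sum_univ_two] at e00 e01 e10 e11
  rw [hw] at e10 e11
  rcases i with ⟨a, b⟩ | ⟨a, b⟩ <;> rcases j with ⟨a', b'⟩ | ⟨a', b'⟩ <;>
    simp only [repIdx, Finset.inl_mem_disjSum, Finset.inr_mem_disjSum, Finset.mem_sigma,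
      Nat.mem_divisors, Finset.mem_range, Finset.mem_filter] at hi hj <;>
    simp only [repMat, of_apply, cons_val', cons_val_zero, cons_val_one, cons_val_fin_one, mul_zero,
      add_zero, zero_add] at e00 e01 e10 e11 <;>
    have ha : (0 : ℤ) < a := by
      first
      | exact_mod_cast Nat.pos_of_dvd_of_pos hi.1.1 (Nat.pos_of_ne_zero hi.1.2)
      | exact_mod_cast Nat.pos_of_dvd_of_pos hi.1.1.1 (Nat.pos_of_ne_zero hi.1.1.2) 
  all_goals
    have ha' : (0 : ℤ) < a' := by
      first
      | exact_mod_cast Nat.pos_of_dvd_of_pos hj.1.1 (Nat.pos_of_ne_zero hj.1.2)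
      | exact_mod_cast Nat.pos_of_dvd_of_pos hj.1.1.1 (Nat.pos_of_ne_zero hj.1.1.2)
  · have hw0 : (p : ℤ) * w = 0 := by
      rcases mul_eq_zero.1 e10.symm with h | h
      · exact h
      · omega
    rw [hw0, mul_zero, sub_zero] at hdet
    have h00 : γ 0 0 = 1 := by
      rcases Int.isUnit_iff.1 (IsUnit.of_mul_eq_one _ hdet) with h | h
      · exact h
      · rw [h] at e00; omega
    rw [h00, one_mul] at e00 e01
    obtain rfl : a = a' := by exact_mod_cast e00
    have : (b : ℤ) = b' := shift_unique (d := ((n / a : ℕ) : ℤ)) (k := γ 0 1) (by positivity)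
      (by exact_mod_cast hi.2) (by positivity) (by exact_mod_cast hj.2) e01
    obtain rfl : b = b' := by exact_mod_cast this
    rfl
  · exfalso
    have : γ 1 1 = 0 := by
      rcases mul_eq_zero.1 e10.symm with h | h
      · exact h
      · omega
    rw [this] at hdet
    exact hnot (-(γ 0 1 * w)) (by linear_combination hdet)
  · exfalso
    have : γ 0 0 = 0 := by
      rcases mul_eq_zero.1 e00.symm with h | h
      · exact h
      · omega
    rw [this] at hdet
    exact hnot (-(γ 0 1 * w)) (by linear_combination hdet)
  · have hw0 : γ 0 1 = 0 := by
      rcases mul_eq_zero.1 e00.symm with h | h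
      · exact h
      · omega
    rw [hw0, zero_mul, sub_zero, mul_comm] at hdet
    have h00 : γ 1 1 = 1 := by
      rcases Int.isUnit_iff.1 (IsUnit.of_mul_eq_one _ hdet) with h | h
      · exact h
      · rw [h] at e10; omega
    rw [h00, one_mul] at e10 e11
    obtain rfl : a = a' := by exact_mod_cast e10
    have : (b : ℤ) = b' := shift_unique (d := p * ((n / a : ℕ) : ℤ)) (k := -w) (by positivity)
      (by exact_mod_cast hi.2) (by positivity) (by exact_mod_cast hj.2) (by rw [e11]; ring)
    obtain rfl : b = b' := by exact_mod_cast this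
    rfl

/-- `M` is not an integral multiple of an element of `Γ₀(p)`. -/
def IsNS (p : ℕ) (M : M2) : Prop := ∀ (γ : M2) (m : ℤ), IsG0 p γ → M ≠ m • γ

lemma IsNS.mul_left {p : ℕ} {γ M : M2} (hγ : IsG0 p γ) (hM : IsNS p M) : IsNS p (γ * M) := by
  intro δ m hδ h
  refine hM (γ.adjugate * δ) m (hγ.inv.mul hδ) ?_
  rw [← Matrix.mul_smul, ← h, ← Matrix.mul_assoc, hγ.inv_mul, Matrix.one_mul]

lemma IsNS.mul_right {p : ℕ} {γ M : M2} (hM : IsNS p M) (hγ : IsG0 p γ) : IsNS p (M * γ) := by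
  intro δ m hδ h
  refine hM (δ * γ.adjugate) m (hδ.mul hγ.inv) ?_
  rw [← Matrix.smul_mul, ← h, Matrix.mul_assoc, hγ.mul_inv, Matrix.mul_one]

open Classical in
/-- Indices of the representatives which are not multiples of elements of `Γ₀(p)`. -/
noncomputable def nsIdx (p n : ℕ) : Finset ((Σ _ : ℕ, ℕ) ⊕ (Σ _ : ℕ, ℕ)) :=
  (repIdx p n).filter fun i => IsNS p (repMat n i)

lemma mem_nsIdx {p n : ℕ} {i} : i ∈ nsIdx p n ↔ i ∈ repIdx p n ∧ IsNS p (repMat n i) := by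
  simp [nsIdx]

lemma prod_nsIdx_comp {p n : ℕ} (hp : p.Prime) (hn : 0 < n) {Φ : M2 → ℂ}
    (hΦ : ∀ γ M, IsG0 p γ → IsR p n M → Φ (γ * M) = Φ M) {T : M2 → M2}
    (hT : ∀ M, IsR p n M → IsR p n (T M)) (hns : ∀ M, IsR p n M → IsNS p M → IsNS p (T M))
    (hinj : ∀ M M' γ, IsR p n M → IsR p n M' → IsG0 p γ → T M = γ * T M' →
      ∃ γ', IsG0 p γ' ∧ M = γ' * M') :
    ∏ i ∈ nsIdx p n, Φ (T (repMat n i)) = ∏ i ∈ nsIdx p n, Φ (repMat n i) := by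
  classical
  have hex : ∀ i : nsIdx p n, ∃ j ∈ nsIdx p n, ∃ γ, IsG0 p γ ∧ γ * T (repMat n i) = repMat n j := by
    rintro ⟨i, hi⟩
    rw [mem_nsIdx] at hi
    have hR := repMat_isR hi.1
    obtain ⟨j, hj, γ, hγ, h⟩ := exists_rep hp hn (hT _ hR)
    exact ⟨j, mem_nsIdx.2 ⟨hj, h ▸ (hns _ hR hi.2).mul_left hγ⟩, γ, hγ, h⟩
  choose σ hσ γ hγ h using hex
  have hinj' : Function.Injective σ := by
    intro i j hij
    have h1 := h i
    rw [hij, ← h j] at h1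
    have hRi := repMat_isR (mem_nsIdx.1 i.2).1
    have hRj := repMat_isR (mem_nsIdx.1 j.2).1
    obtain ⟨δ, hδ, h3⟩ := hinj (repMat n i) (repMat n j) ((γ i).adjugate * γ j) hRi hRj
      ((hγ i).inv.mul (hγ j))
      (by rw [Matrix.mul_assoc, ← h1, ← Matrix.mul_assoc, (hγ i).inv_mul, Matrix.one_mul])
    exact Subtype.ext (rep_unique hp (mem_nsIdx.1 i.2).1 (mem_nsIdx.1 j.2).1 hδ h3)
  let σ' : nsIdx p n → nsIdx p n := fun i => ⟨σ i, hσ i⟩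
  have hbij : Function.Bijective σ' :=
    Finite.injective_iff_bijective.1 fun i j hij => hinj' (congrArg Subtype.val hij)
  rw [← Finset.prod_coe_sort, ← Finset.prod_coe_sort (nsIdx p n) (fun i => Φ (repMat n i)),
    ← hbij.prod_comp fun i => Φ (repMat n i)]
  refine Finset.prod_congr rfl fun i _ => ?_
  rw [← h i, hΦ _ _ (hγ i) (hT _ (repMat_isR (mem_nsIdx.1 i.2).1))]

/-- Conjugation by the Fricke involution. -/
def conjW (p : ℕ) (M : M2) : M2 := !![M 1 1, -(M 1 0 / p); -(p * M 0 1), M 0 0]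

lemma exists_entries {p : ℕ} {M : M2} (h : (p : ℤ) ∣ M 1 0) :
    ∃ a b c d : ℤ, M = !![a, b; p * c, d] := by
  obtain ⟨c, hc⟩ := h
  exact ⟨M 0 0, M 0 1, c, M 1 1, by ext i j; fin_cases i <;> fin_cases j <;> simp [hc]⟩

lemma conjW_of {p : ℕ} (hp : 0 < p) (a b c d : ℤ) :
    conjW p !![a, b; p * c, d] = !![d, -c; p * (-b), a] := by
  have : (p : ℤ) ≠ 0 := by exact_mod_cast hp.ne'
  ext i j; fin_cases i <;> fin_cases j <;> simp [conjW, Int.mul_ediv_cancel_left _ this]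

lemma conjW_mul {p : ℕ} (hp : 0 < p) {M N : M2} (hM : (p : ℤ) ∣ M 1 0) (hN : (p : ℤ) ∣ N 1 0) :
    conjW p (M * N) = conjW p M * conjW p N := by
  obtain ⟨a, b, c, d, rfl⟩ := exists_entries hM
  obtain ⟨a', b', c', d', rfl⟩ := exists_entries hN
  have : !![a, b; p * c, d] * !![a', b'; p * c', d'] =
      !![a * a' + b * (p * c'), a * b' + b * d'; p * (c * a' + d * c'), p * c * b' + d * d'] := by
    rw [mul_fin_two]; ext i j; fin_cases i <;> fin_cases j <;> simp; ring
  rw [this, conjW_of hp, conjW_of hp, conjW_of hp, mul_fin_two]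
  ext i j; fin_cases i <;> fin_cases j <;> simp <;> ring

lemma conjW_conjW {p : ℕ} (hp : 0 < p) {M : M2} (hM : (p : ℤ) ∣ M 1 0) :
    conjW p (conjW p M) = M := by
  obtain ⟨a, b, c, d, rfl⟩ := exists_entries hM
  rw [conjW_of hp, conjW_of hp, neg_neg, neg_neg]

lemma wMat_mul_conjW {p : ℕ} (hp : 0 < p) {M : M2} (hM : (p : ℤ) ∣ M 1 0) :
    wMat p * conjW p M = M * wMat p := by
  obtain ⟨a, b, c, d, rfl⟩ := exists_entries hM
  rw [conjW_of hp, wMat, mul_fin_two, mul_fin_two]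
  ext i j; fin_cases i <;> fin_cases j <;> simp <;> ring

lemma IsR.conjW {p : ℕ} (hp : 0 < p) {n : ℤ} {M : M2} (hM : IsR p n M) :
    IsR p n (conjW p M) := by
  obtain ⟨h1, h2⟩ := hM
  obtain ⟨a, b, c, d, rfl⟩ := exists_entries h2
  rw [conjW_of hp]
  refine ⟨?_, by simp⟩
  rw [← h1, det_fin_two_of, det_fin_two_of]; ring

lemma IsG0.conjW {p : ℕ} (hp : 0 < p) {M : M2} (hM : IsG0 p M) : IsG0 p (conjW p M) :=
  IsR.conjW (n := 1) hp hM

lemma conjW_smul {p : ℕ} (hp : 0 < p) (m : ℤ) {M : M2} (hM : (p : ℤ) ∣ M 1 0) :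
    conjW p (m • M) = m • conjW p M := by
  obtain ⟨a, b, c, d, rfl⟩ := exists_entries hM
  have : m • !![a, b; p * c, d] = !![m * a, m * b; p * (m * c), m * d] := by
    ext i j; fin_cases i <;> fin_cases j <;> simp; ring
  rw [this, conjW_of hp, conjW_of hp]
  ext i j; fin_cases i <;> fin_cases j <;> simp; ring

lemma IsNS.conjW {p : ℕ} (hp : 0 < p) {M : M2} (hM' : (p : ℤ) ∣ M 1 0) (hM : IsNS p M) :
    IsNS p (conjW p M) := by
  intro δ m hδ h
  refine hM (TraceFormula.conjW p δ) m (hδ.conjW hp) ?_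
  rw [← conjW_smul hp m hδ.2, ← h, conjW_conjW hp hM']

lemma conjW_inj {p n : ℕ} (hp : 0 < p) (M M' γ : M2) (hM : IsR p n M) (hM' : IsR p n M')
    (hγ : IsG0 p γ) (h : conjW p M = γ * conjW p M') : ∃ γ', IsG0 p γ' ∧ M = γ' * M' := by
  refine ⟨conjW p γ, hγ.conjW hp, ?_⟩
  rw [← conjW_conjW hp hM.2, h, conjW_mul hp hγ.2 (hM'.conjW hp).2, conjW_conjW hp hM'.2]

/-- The product over representatives of the differences `t(τ) - t(Mτ)`. -/
noncomputable def diffProd (p n : ℕ) (t : ℂ → ℂ) (z : ℂ) : ℂ :=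
  ∏ i ∈ nsIdx p n, (t z - t (mob (repMat n i) z))

/-- The product over representatives of the functions `t(Mτ)`. -/
noncomputable def normProd (p n : ℕ) (t : ℂ → ℂ) (z : ℂ) : ℂ :=
  ∏ i ∈ nsIdx p n, t (mob (repMat n i) z)

lemma repMat_det_pos {p n : ℕ} (hn : 0 < n) {i} (hi : i ∈ repIdx p n) : 0 < (repMat n i).det := by
  rw [(repMat_isR hi).1]; exact_mod_cast hn

lemma nsIdx_det_pos {p n : ℕ} (hn : 0 < n) {i} (hi : i ∈ nsIdx p n) : 0 < (repMat n i).det :=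
  repMat_det_pos hn (mem_nsIdx.1 hi).1

lemma IsR.det_pos {p n : ℕ} (hn : 0 < n) {M : M2} (hM : IsR p n M) : 0 < M.det := by
  rw [hM.1]; exact_mod_cast hn

namespace Haupt

variable {p : ℕ} {k C : ℂ} {c : ℤ → ℂ} {t D G : ℂ → ℂ} (H : Haupt p k C c t D G)
include H

lemma t_mul_mob {n : ℕ} (hn : 0 < n) {γ M : M2} (hγ : IsG0 p γ) (hM : IsR p n M) {z : ℂ}
    (hz : 0 < z.im) : t (mob (γ * M) z) = t (mob M z) := by
  rw [mob_mul γ (hM.det_pos hn) hz, H.inv γ hγ _ (mob_im_pos (hM.det_pos hn) hz)]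

lemma differentiableAt_comp_mob {M : M2} (hM : 0 < M.det) {z : ℂ} (hz : 0 < z.im) :
    DifferentiableAt ℂ (fun w => t (mob M w)) z :=
  DifferentiableAt.comp z (H.diff_t _ (mob_im_pos hM hz)) (analyticAt_mob hM hz).differentiableAt

lemma isMod_prod {n : ℕ} (hn : 0 < n) {Ψ : ℂ → ℂ → ℂ} (hΨ : Differentiable ℂ fun x : ℂ × ℂ => Ψ x.1 x.2) :
    IsMod p (fun z => ∏ i ∈ nsIdx p n, Ψ (t z) (t (mob (repMat n i) z))) := by
  refine ⟨fun z hz => ?_, fun γ hγ z hz => ?_⟩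
  · refine DifferentiableAt.fun_finsetProd fun i hi => ?_
    exact DifferentiableAt.comp (g := fun x : ℂ × ℂ => Ψ x.1 x.2) z (hΨ _)
      ((H.diff_t z hz).prodMk (H.differentiableAt_comp_mob (nsIdx_det_pos hn hi) hz))
  · rw [← prod_nsIdx_comp H.prime hn (Φ := fun M => Ψ (t z) (t (mob M z))) (T := fun M => M * γ)]
    · refine Finset.prod_congr rfl fun i _ => ?_
      rw [H.inv γ hγ z hz, mob_mul _ hγ.det_pos hz]
    · intro δ M hδ hM
      simp only [H.t_mul_mob hn hδ hM hz]
    · exact fun M hM => hM.mul_right hγ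
    · exact fun M _ hM => hM.mul_right hγ
    · intro M M' δ _ _ hδ h
      refine ⟨δ, hδ, ?_⟩
      have := congrArg (· * γ.adjugate) h
      simpa only [Matrix.mul_assoc, hγ.mul_inv, Matrix.mul_one] using this

lemma prod_wMat {n : ℕ} (hn : 0 < n) (Ψ : ℂ → ℂ → ℂ) {z : ℂ} (hz : 0 < z.im) :
    ∏ i ∈ nsIdx p n, Ψ (t (mob (wMat p) z)) (t (mob (repMat n i) (mob (wMat p) z))) =
      ∏ i ∈ nsIdx p n, Ψ (C / t z) (C / t (mob (repMat n i) z)) := by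
  have hp := H.prime.pos
  rw [← prod_nsIdx_comp H.prime hn (Φ := fun M => Ψ (C / t z) (C / t (mob M z))) (T := conjW p)]
  · refine Finset.prod_congr rfl fun i hi => ?_
    have hR := repMat_isR (mem_nsIdx.1 hi).1
    have hR' := hR.conjW hp
    rw [H.fricke z hz, ← mob_mul _ H.det_wMat_pos hz, ← wMat_mul_conjW hp hR.2,
      mob_mul _ (hR'.det_pos hn) hz, H.fricke _ (mob_im_pos (hR'.det_pos hn) hz)]
  · intro δ M hδ hM
    simp only [H.t_mul_mob hn hδ hM hz]
  · exact fun M hM => hM.conjW hp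
  · exact fun M hM hM' => hM'.conjW hp hM.2
  · exact conjW_inj hp

lemma isMod_diffProd {n : ℕ} (hn : 0 < n) : IsMod p (diffProd p n t) :=
  H.isMod_prod hn (Ψ := fun x y => x - y) (by fun_prop)

lemma isMod_normProd {n : ℕ} (hn : 0 < n) : IsMod p (normProd p n t) :=
  H.isMod_prod hn (Ψ := fun _ y => y) (by fun_prop)

lemma normProd_ne {n : ℕ} (hn : 0 < n) {z : ℂ} (hz : 0 < z.im) : normProd p n t z ≠ 0 :=
  Finset.prod_ne_zero_iff.2 fun _ hi => H.t_ne _ (mob_im_pos (nsIdx_det_pos hn hi) hz)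

lemma normProd_wMat {n : ℕ} (hn : 0 < n) {z : ℂ} (hz : 0 < z.im) :
    normProd p n t (mob (wMat p) z) = C ^ (nsIdx p n).card / normProd p n t z := by
  rw [normProd, H.prod_wMat hn (fun _ y => y) hz, Finset.prod_div_distrib, Finset.prod_const, normProd]

lemma diffProd_wMat {n : ℕ} (hn : 0 < n) {z : ℂ} (hz : 0 < z.im) :
    diffProd p n t (mob (wMat p) z) = (-C) ^ (nsIdx p n).card * diffProd p n t z *
      (t z ^ (nsIdx p n).card * normProd p n t z)⁻¹ := by
  rw [diffProd, H.prod_wMat hn (fun x y => x - y) hz, diffProd, normProd, ← Finset.prod_const,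
    ← Finset.prod_const, ← Finset.prod_mul_distrib, ← Finset.prod_mul_distrib, ← Finset.prod_inv_distrib,
    ← Finset.prod_mul_distrib]
  refine Finset.prod_congr rfl fun i hi => ?_
  have h1 := H.t_ne z hz
  have h2 := H.t_ne _ (mob_im_pos (nsIdx_det_pos hn hi) hz)
  field_simp
  ring

end Haupt

lemma analyticOrderAt_finset_prod {ι : Type*} (s : Finset ι) {f : ι → ℂ → ℂ} {z : ℂ}
    (h : ∀ i ∈ s, AnalyticAt ℂ (f i) z) :
    analyticOrderAt (fun w => ∏ i ∈ s, f i w) z = ∑ i ∈ s, analyticOrderAt (f i) z := by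
  classical
  induction s using Finset.induction_on with
  | empty => simpa using AnalyticAt.analyticOrderAt_eq_zero (f := fun _ : ℂ => (1 : ℂ)) analyticAt_const |>.2 one_ne_zero
  | insert a s ha ih =>
    simp only [Finset.prod_insert ha, Finset.sum_insert ha]
    rw [← ih fun i hi => h i (Finset.mem_insert_of_mem hi)]
    exact analyticOrderAt_mul (h a (Finset.mem_insert_self a s))
      (Finset.analyticAt_fun_prod s fun i hi => h i (Finset.mem_insert_of_mem hi))

lemma mul_left_injective_of_det {M : M2} (hM : M.det ≠ 0) {A B : M2} (h : A * M = B * M) : A = B := by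
  have := congrArg (· * M.adjugate) h
  simp only [Matrix.mul_assoc, mul_adjugate, Matrix.mul_smul, Matrix.mul_one] at this
  exact smul_right_injective _ hM this

/-- The number of matrices of determinant `n` fixing `z`, with positive lower left entry. -/
noncomputable def fixCount (p n : ℕ) (z : ℂ) : ℕ :=
  {M : M2 | IsR p n M ∧ mob M z = z ∧ 0 < M 1 0}.ncard

open Classical in
lemma card_fixing {p n : ℕ} (hn : 0 < n) {z : ℂ} (hz : 0 < z.im) :
    {M : M2 | IsR p n M ∧ mob M z = z}.ncard = 2 * fixCount p n z + 2 * if IsSquare n then 1 else 0 := by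
  have hn' : (0 : ℤ) < n := by exact_mod_cast hn
  have hfin := finite_fixing hn' hz
  set A : Set M2 := {M : M2 | IsR p n M ∧ mob M z = z ∧ 0 < M 1 0} with hA
  have hAfin : A.Finite := hfin.subset fun M hM => ⟨hM.1.1, hM.2.1⟩
  set B : Set M2 := {M : M2 | IsR p n M ∧ mob M z = z ∧ M 1 0 = 0} with hB
  have hBfin : B.Finite := hfin.subset fun M hM => ⟨hM.1.1, hM.2.1⟩
  have hnegfin : ((fun M : M2 => -M) '' A).Finite := hAfin.image _
  have hneg : ((fun M : M2 => -M) '' A).ncard = A.ncard :=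
    Set.InjOn.ncard_image fun M _ N _ h => neg_injective h
  have hRneg : ∀ M : M2, IsR p n M → IsR p n (-M) := fun M hM =>
    ⟨by rw [det_neg, hM.1]; simp, by simpa using hM.2⟩
  have hU : {M : M2 | IsR p n M ∧ mob M z = z} = (A ∪ (fun M : M2 => -M) '' A) ∪ B := by
    ext M
    simp only [Set.mem_union, Set.mem_image, hA, hB, Set.mem_ofPred_eq]
    constructor
    · rintro ⟨h1, h2⟩
      rcases lt_trichotomy (M 1 0) 0 with h | h | h
      · exact Or.inl (Or.inr ⟨-M, ⟨hRneg M h1, by rw [mob_neg, h2], by simpa using h⟩, neg_neg M⟩)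
      · exact Or.inr ⟨h1, h2, h⟩
      · exact Or.inl (Or.inl ⟨h1, h2, h⟩)
    · rintro ((⟨h1, h2, -⟩ | ⟨N, ⟨h1, h2, -⟩, rfl⟩) | ⟨h1, h2, -⟩)
      · exact ⟨h1, h2⟩
      · exact ⟨hRneg N h1, by rw [mob_neg, h2]⟩
      · exact ⟨h1, h2⟩
  have hd1 : Disjoint A ((fun M : M2 => -M) '' A) := by
    rw [Set.disjoint_left]
    rintro M ⟨-, -, h1⟩ ⟨N, ⟨-, -, h2⟩, rfl⟩
    simp at h1
    omega
  have hd2 : Disjoint (A ∪ (fun M : M2 => -M) '' A) B := by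
    rw [Set.disjoint_left]
    rintro M (⟨-, -, h1⟩ | ⟨N, ⟨-, -, h2⟩, rfl⟩) ⟨-, -, h3⟩
    · omega
    · simp at h3
      omega
  have hBcard : B.ncard = 2 * if IsSquare n then 1 else 0 := by
    have hscal : ∀ M ∈ B, ∃ m : ℤ, M = !![m, 0; 0, m] ∧ m * m = n := by
      rintro M ⟨h1, h2, h3⟩
      have hdet := h1.1
      rw [det_fin_two, h3, mul_zero, sub_zero] at hdet
      have h11 : M 1 1 ≠ 0 := by rintro h; rw [h] at hdet; omega
      have h11' : (M 1 1 : ℂ) ≠ 0 := by exact_mod_cast h11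
      rw [mob, mden, h3] at h2
      simp only [Int.cast_zero, zero_mul, zero_add] at h2
      rw [div_eq_iff h11'] at h2
      have him := congrArg Complex.im h2
      have hre := congrArg Complex.re h2
      simp at him hre
      have e1 : M 0 0 = M 1 1 := by
        have : (M 0 0 : ℝ) = M 1 1 := by
          apply mul_right_cancel₀ hz.ne'
          linarith
        exact_mod_cast this
      have e2 : M 0 1 = 0 := by
        rw [e1] at hre
        have : (M 0 1 : ℝ) = 0 := by linarith
        exact_mod_cast this
      refine ⟨M 1 1, ?_, by rw [← hdet, e1]⟩
      ext i j; fin_cases i <;> fin_cases j <;> simp [e1, e2, h3]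
    split_ifs with hsq
    · obtain ⟨m, rfl⟩ := hsq
      have hm : 0 < m := Nat.pos_of_mul_pos_left hn
      have : B = {!![(m : ℤ), 0; 0, (m : ℤ)], !![-(m : ℤ), 0; 0, -(m : ℤ)]} := by
        ext M
        constructor
        · intro hM
          obtain ⟨m', rfl, h⟩ := hscal M hM
          push_cast at h
          rcases mul_self_eq_mul_self_iff.1 h with rfl | rfl <;> simp
        · have hmc : (m : ℂ) ≠ 0 := by exact_mod_cast hm.ne'
          rintro (rfl | rfl)
          · refine ⟨⟨by simp [det_fin_two], by simp⟩, ?_, by simp⟩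
            simp [mob, mden]
            field_simp
          · refine ⟨⟨by simp [det_fin_two], by simp⟩, ?_, by simp⟩
            simp [mob, mden]
            field_simp
      rw [this, Set.ncard_pair]
      intro h
      have := congrFun (congrFun h 0) 0
      simp at this
      omega
    · rw [mul_zero, Set.ncard_eq_zero hBfin, Set.eq_empty_iff_forall_notMem]
      intro M hM
      obtain ⟨m', -, h⟩ := hscal M hM
      apply hsq
      refine ⟨m'.natAbs, ?_⟩
      rw [← Int.natAbs_mul, h]
      simp
  rw [hU, Set.ncard_union_eq hd2 (hAfin.union hnegfin) hBfin, Set.ncard_union_eq hd1 hAfin hnegfin,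
    hneg, hBcard, fixCount, ← hA]
  ring

namespace Haupt

variable {p : ℕ} {k C : ℂ} {c : ℤ → ℂ} {t D G : ℂ → ℂ} (H : Haupt p k C c t D G)
include H

open Classical in
lemma order_diffProd {n : ℕ} (hn : 0 < n) {z : ℂ} (hz : 0 < z.im) :
    analyticOrderAt (diffProd p n t) z =
      (((nsIdx p n).filter fun i => t (mob (repMat n i) z) = t z).card * ram t z : ℕ) := by
  have hn' : (0 : ℤ) < n := by exact_mod_cast hn
  have hA : ∀ M : M2, 0 < M.det → AnalyticAt ℂ (fun w => t w - t (mob M w)) z := fun M hM =>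
    (H.isMod.analyticOnNhd z hz).sub
      ((H.isMod.analyticOnNhd _ (mob_im_pos hM hz)).comp (analyticAt_mob hM hz))
  refine (analyticOrderAt_finset_prod (nsIdx p n) (f := fun i w => t w - t (mob (repMat n i) w))
    fun i hi => hA _ (nsIdx_det_pos hn hi)).trans ?_
  rw [Finset.card_filter, Finset.sum_mul]
  push_cast
  refine Finset.sum_congr rfl fun i hi => ?_
  have hR := repMat_isR (mem_nsIdx.1 hi).1
  have hpos := nsIdx_det_pos hn hi
  split_ifs with h
  · obtain ⟨γ, hγ, hγz⟩ := H.equiv_of_eq (mob_im_pos hpos hz) hz h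
    rw [one_mul, ← H.order_diff hn' (hR.mul_left hγ) hz (by rw [mob_mul γ hpos hz, hγz])
      ((mem_nsIdx.1 hi).2.mul_left hγ)]
    refine analyticOrderAt_congr ?_
    filter_upwards [isOpen_upper.mem_nhds hz] with w hw
    rw [H.t_mul_mob hn hγ hR hw]
  · rw [zero_mul]
    exact (hA _ hpos).analyticOrderAt_eq_zero.2 (sub_ne_zero.2 (Ne.symm h))

open Classical in
lemma card_ns {n : ℕ} (hn : 0 < n) {z : ℂ} (hz : 0 < z.im) :
    {M : M2 | IsR p n M ∧ mob M z = z ∧ IsNS p M}.ncard =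
      ((nsIdx p n).filter fun i => t (mob (repMat n i) z) = t z).card * (2 * ram t z) := by
  set J := (nsIdx p n).filter fun i => t (mob (repMat n i) z) = t z with hJ
  have hex : ∀ i, ∃ γ, i ∈ J → IsG0 p γ ∧ mob γ (mob (repMat n i) z) = z := by
    intro i
    by_cases hi : i ∈ J
    · obtain ⟨h1, h2⟩ := Finset.mem_filter.1 hi
      obtain ⟨γ, hγ⟩ := H.equiv_of_eq (mob_im_pos (nsIdx_det_pos hn h1) hz) hz h2
      exact ⟨γ, fun _ => hγ⟩
    · exact ⟨1, fun h => absurd h hi⟩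
  choose g hg using hex
  have hJn : ∀ i ∈ J, i ∈ nsIdx p n := fun i hi => (Finset.mem_filter.1 hi).1
  have hR : ∀ i ∈ J, IsR p n (repMat n i) := fun i hi => repMat_isR (mem_nsIdx.1 (hJn i hi)).1
  rw [← H.card_stabilizer hz, ← Set.ncard_coe_finset, ← Set.ncard_prod]
  have himg : {M : M2 | IsR p n M ∧ mob M z = z ∧ IsNS p M} =
      (fun x : _ × M2 => x.2 * (g x.1 * repMat n x.1)) '' ((J : Set _) ×ˢ {γ : M2 | IsG0 p γ ∧ mob γ z = z}) := by
    ext M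
    constructor
    · rintro ⟨h1, h2, h3⟩
      obtain ⟨i, hi, γ, hγ, h⟩ := exists_rep H.prime hn h1
      have hiJ : i ∈ J := by
        rw [hJ, Finset.mem_filter, mem_nsIdx]
        refine ⟨⟨hi, h ▸ h3.mul_left hγ⟩, ?_⟩
        rw [← h, H.t_mul_mob hn hγ h1 hz, h2]
      obtain ⟨hg1, hg2⟩ := hg i hiJ
      have hM : M = γ.adjugate * (g i).adjugate * (g i * repMat n i) := by
        rw [← h, Matrix.mul_assoc, ← Matrix.mul_assoc (g i).adjugate, hg1.inv_mul, Matrix.one_mul,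
          ← Matrix.mul_assoc, hγ.inv_mul, Matrix.one_mul]
      refine ⟨(i, γ.adjugate * (g i).adjugate), ⟨hiJ, hγ.inv.mul hg1.inv, ?_⟩, hM.symm⟩
      conv_lhs => rw [← hg2]
      rw [← mob_mul _ ((hR i hiJ).det_pos hn) hz,
        ← mob_mul _ (((hR i hiJ).mul_left hg1).det_pos hn) hz, ← hM, h2]
    · rintro ⟨⟨i, γ⟩, ⟨hi, hγ, hγz⟩, rfl⟩
      obtain ⟨hg1, hg2⟩ := hg i hi
      have h1 := (hR i hi).mul_left hg1
      refine ⟨h1.mul_left hγ, ?_, ((mem_nsIdx.1 (hJn i hi)).2.mul_left hg1).mul_left hγ⟩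
      rw [mob_mul _ (h1.det_pos hn) hz, mob_mul _ ((hR i hi).det_pos hn) hz]
      exact (congrArg (mob γ) hg2).trans hγz
  rw [himg, Set.InjOn.ncard_image]
  rintro ⟨i, γ⟩ ⟨hi, hγ, -⟩ ⟨j, δ⟩ ⟨hj, hδ, -⟩ h
  simp only at h hi hj hγ hδ
  have hgi := (hg i hi).1
  have hgj := (hg j hj).1
  have hij : i = j := by
    refine rep_unique H.prime (mem_nsIdx.1 (hJn i hi)).1 (mem_nsIdx.1 (hJn j hj)).1
      (γ := (g i).adjugate * (γ.adjugate * (δ * g j))) (hgi.inv.mul (hγ.inv.mul (hδ.mul hgj))) ?_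
    rw [Matrix.mul_assoc, Matrix.mul_assoc, Matrix.mul_assoc, ← h, ← Matrix.mul_assoc γ.adjugate,
      hγ.inv_mul, Matrix.one_mul, ← Matrix.mul_assoc, hgi.inv_mul, Matrix.one_mul]
  subst hij
  rw [mul_left_injective_of_det (((hR i hi).mul_left hgi).det_pos hn).ne' h]

open Classical in
lemma card_not_ns {n : ℕ} (hn : 0 < n) {z : ℂ} (hz : 0 < z.im) :
    {M : M2 | IsR p n M ∧ mob M z = z ∧ ¬ IsNS p M}.ncard =
      2 * ram t z * if IsSquare n then 1 else 0 := by
  have hmob : ∀ (m : ℤ) (γ : M2), m ≠ 0 → mob (m • γ) z = mob γ z := by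
    intro m γ hm
    have hm' : (m : ℂ) ≠ 0 := by exact_mod_cast hm
    have h1 : mden (m • γ) z = m * mden γ z := by simp [mden]; ring
    rw [mob, mob, h1, ← mul_div_mul_left _ (mden γ z) hm']
    congr 1
    simp; ring
  have hsq : ∀ (m : ℤ) (γ : M2), IsR p n (m • γ) → IsG0 p γ → m * m = n := by
    intro m γ h hγ
    rw [← h.1, det_smul, hγ.1]
    simp [sq]
  split_ifs with h
  · obtain ⟨m, rfl⟩ := h
    have hm : 0 < m := Nat.pos_of_mul_pos_left hn
    have hm' : (m : ℤ) ≠ 0 := by exact_mod_cast hm.ne'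
    rw [mul_one, ← H.card_stabilizer hz]
    have : {M : M2 | IsR p (m * m : ℕ) M ∧ mob M z = z ∧ ¬ IsNS p M} =
        (fun γ : M2 => (m : ℤ) • γ) '' {γ : M2 | IsG0 p γ ∧ mob γ z = z} := by
      ext M
      constructor
      · rintro ⟨h1, h2, h3⟩
        rw [IsNS] at h3
        push Not at h3
        obtain ⟨γ, l, hγ, rfl⟩ := h3
        have hl := hsq l γ h1 hγ
        have hl0 : l ≠ 0 := by rintro rfl; push_cast at hl; nlinarith
        rw [hmob l γ hl0] at h2
        push_cast at hl
        rcases mul_self_eq_mul_self_iff.1 hl with rfl | rfl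
        · exact ⟨γ, ⟨hγ, h2⟩, rfl⟩
        · exact ⟨-γ, ⟨hγ.neg, by rw [mob_neg, h2]⟩, by simp⟩
      · rintro ⟨γ, ⟨h1, h2⟩, rfl⟩
        refine ⟨⟨?_, ?_⟩, ?_, ?_⟩
        · simp only [det_smul, h1.1]; simp [sq]
        · simpa using Dvd.dvd.mul_left h1.2 _
        · simp only [hmob _ γ hm', h2]
        · intro h3
          exact h3 γ m h1 rfl
    rw [this, Set.InjOn.ncard_image]
    exact fun γ _ δ _ h => smul_right_injective _ hm' h
  · rw [mul_zero]
    have : {M : M2 | IsR p n M ∧ mob M z = z ∧ ¬ IsNS p M} = ∅ := by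
      rw [Set.eq_empty_iff_forall_notMem]
      rintro M ⟨h1, h2, h3⟩
      rw [IsNS] at h3
      push Not at h3
      obtain ⟨γ, l, hγ, rfl⟩ := h3
      refine h ⟨l.natAbs, ?_⟩
      rw [← Int.natAbs_mul, hsq l γ h1 hγ]
      simp
    rw [this, Set.ncard_empty]

open Classical in
theorem order_total {n : ℕ} (hn : 0 < n) {z : ℂ} (hz : 0 < z.im) :
    analyticOrderAt (fun w => diffProd p n t w ^ 12 * if IsSquare n then ramFun t D w else 1) z =
      (12 * fixCount p n z : ℕ) := by
  have h1 := H.order_diffProd hn hz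
  have h2 := H.card_ns hn hz
  have h3 := H.card_not_ns hn hz
  have h4 := card_fixing (p := p) hn hz
  have hfin := finite_fixing (n := (n : ℤ)) (by exact_mod_cast hn) hz
  have h5 : {M : M2 | IsR p n M ∧ mob M z = z}.ncard =
      {M : M2 | IsR p n M ∧ mob M z = z ∧ IsNS p M}.ncard +
      {M : M2 | IsR p n M ∧ mob M z = z ∧ ¬ IsNS p M}.ncard := by
    rw [← Set.ncard_union_eq (hs := hfin.subset fun M hM => ⟨hM.1.1, hM.2.1⟩)
      (ht := hfin.subset fun M hM => ⟨hM.1.1, hM.2.1⟩)]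
    · congr 1
      ext M
      simp only [Set.mem_union, Set.mem_ofPred_eq]
      tauto
    · rw [Set.disjoint_left]
      rintro M ⟨-, -, h⟩ ⟨-, -, h'⟩
      exact h' h
  rw [h2, h3, h4] at h5
  have hA := (H.isMod_diffProd hn).analyticOnNhd z hz
  set κ := ((nsIdx p n).filter fun i => t (mob (repMat n i) z) = t z).card with hκ
  set e := ram t z
  split_ifs at h5 ⊢ with hs
  · have hB := H.isMod_ramFun.analyticOnNhd z hz
    have h6 := analyticOrderAt_mul (hA.pow 12) hB
    change analyticOrderAt (fun w => diffProd p n t w ^ 12 * ramFun t D w) z = _ at h6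
    have h7 := H.order_ramFun hz
    rw [analyticOrderAt_pow hA, h1] at h6
    rw [h6]
    have h8 : analyticOrderAt (ramFun t D) z ≠ ⊤ := by
      intro h
      rw [h, top_add] at h7
      exact ENat.natCast_ne_top _ h7.symm
    lift analyticOrderAt (ramFun t D) z to ℕ using h8 with r hr
    have h7' : r + 12 = 12 * e := by exact_mod_cast h7
    have : 12 * (κ * e) + r = 12 * fixCount p n z := by nlinarith
    rw [← this]
    push_cast
    simp
  · have h6 := analyticOrderAt_pow hA 12
    simp only [mul_one]
    change analyticOrderAt (fun w => diffProd p n t w ^ 12) z = _ at h6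
    rw [h6, h1]
    have : 12 * (κ * e) = 12 * fixCount p n z := by nlinarith
    rw [← this]
    push_cast
    simp

end Haupt

lemma exists_mul_self_of_not_isNS {p n : ℕ} (hp : p.Prime) (hn : 0 < n) {i} (hi : i ∈ repIdx p n)
    (h : ¬ IsNS p (repMat n i)) : IsSquare n ∧ i = .inl ⟨n.sqrt, 0⟩ := by
  rw [IsNS] at h
  push Not at h
  obtain ⟨γ, l, hγ, h⟩ := h
  have hdet := (repMat_isR hi).1
  rw [h, det_smul, hγ.1] at hdet
  simp only [Fintype.card_fin, mul_one] at hdet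
  have hsq : n = l.natAbs * l.natAbs := by
    rw [← Int.natAbs_mul, ← sq, hdet]; simp
  refine ⟨⟨_, hsq⟩, ?_⟩
  have hsqrt : n.sqrt = l.natAbs := by rw [hsq, Nat.sqrt_eq]
  have hl : 0 < l.natAbs := by
    rw [Nat.pos_iff_ne_zero]; intro h0; rw [h0] at hsq; omega
  have hdiv : n / l.natAbs = l.natAbs := by
    nth_rewrite 1 [hsq]
    exact Nat.mul_div_cancel _ hl
  rw [hsqrt]
  have hj : Sum.inl ⟨l.natAbs, 0⟩ ∈ repIdx p n := by
    simp only [repIdx, Finset.inl_mem_disjSum, Finset.mem_sigma, Nat.mem_divisors, Finset.mem_range,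
      hdiv]
    exact ⟨⟨⟨_, hsq⟩, hn.ne'⟩, hl⟩
  have hrep : repMat n (.inl ⟨l.natAbs, 0⟩) = (l.natAbs : ℤ) • (1 : M2) := by
    simp only [repMat, hdiv]
    ext i j; fin_cases i <;> fin_cases j <;> simp
  rcases Int.natAbs_eq l with hl' | hl'
  · refine rep_unique hp hi hj hγ ?_
    rw [hrep, Matrix.mul_smul, Matrix.mul_one, ← hl', h]
  · refine rep_unique hp hi hj hγ.neg ?_
    rw [hrep, Matrix.mul_smul, Matrix.mul_one, smul_neg, ← neg_smul, ← hl', h]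

lemma sqrt_facts {n : ℕ} (hn : 0 < n) (hs : IsSquare n) :
    0 < n.sqrt ∧ n.sqrt * n.sqrt = n ∧ n / n.sqrt = n.sqrt := by
  obtain ⟨m, rfl⟩ := hs
  have hm : 0 < m := Nat.pos_of_mul_pos_left hn
  rw [Nat.sqrt_eq]
  exact ⟨hm, rfl, Nat.mul_div_cancel _ hm⟩

lemma nsIdx_eq {p n : ℕ} (hp : p.Prime) (hn : 0 < n) :
    (¬ IsSquare n → nsIdx p n = repIdx p n) ∧
    (IsSquare n → Sum.inl ⟨n.sqrt, 0⟩ ∈ repIdx p n ∧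
      nsIdx p n = (repIdx p n).erase (.inl ⟨n.sqrt, 0⟩)) := by
  constructor
  · intro hs
    ext i
    rw [mem_nsIdx, and_iff_left_iff_imp]
    intro hi
    by_contra h
    exact hs (exists_mul_self_of_not_isNS hp hn hi h).1
  · intro hs
    obtain ⟨h1, h2, h3⟩ := sqrt_facts hn hs
    refine ⟨?_, ?_⟩
    · simp only [repIdx, Finset.inl_mem_disjSum, Finset.mem_sigma, Nat.mem_divisors, Finset.mem_range, h3]
      exact ⟨⟨⟨_, h2.symm⟩, hn.ne'⟩, h1⟩
    · ext i
      rw [mem_nsIdx, Finset.mem_erase, and_comm]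
      refine and_congr_left fun hi => ⟨?_, fun h => ?_⟩
      · rintro h rfl
        refine h 1 n.sqrt IsG0.one ?_
        simp only [repMat, h3]
        ext i j; fin_cases i <;> fin_cases j <;> simp
      · by_contra h'
        exact h (exists_mul_self_of_not_isNS hp hn hi h').2

open Classical in
lemma prod_nsIdx_mul {α : Type*} [CommMonoid α] {p n : ℕ} (hp : p.Prime) (hn : 0 < n)
    (Ψ : ((Σ _ : ℕ, ℕ) ⊕ (Σ _ : ℕ, ℕ)) → α) :
    (∏ i ∈ nsIdx p n, Ψ i) * (if IsSquare n then Ψ (.inl ⟨n.sqrt, 0⟩) else 1) =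
      (∏ a ∈ n.divisors, ∏ b ∈ Finset.range (n / a), Ψ (.inl ⟨a, b⟩)) *
      ∏ g ∈ n.divisors.filter (p ∣ ·), ∏ b ∈ Finset.range (p * (n / g)), Ψ (.inr ⟨g, b⟩) := by
  have h0 : ∏ i ∈ repIdx p n, Ψ i =
      (∏ a ∈ n.divisors, ∏ b ∈ Finset.range (n / a), Ψ (.inl ⟨a, b⟩)) *
      ∏ g ∈ n.divisors.filter (p ∣ ·), ∏ b ∈ Finset.range (p * (n / g)), Ψ (.inr ⟨g, b⟩) := by
    rw [repIdx, Finset.prod_disjSum, Finset.prod_sigma, Finset.prod_sigma]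
  rw [← h0]
  obtain ⟨h1, h2⟩ := nsIdx_eq hp hn
  split_ifs with hs
  · obtain ⟨h3, h4⟩ := h2 hs
    rw [h4, Finset.prod_erase_mul _ _ h3]
  · rw [h1 hs, mul_one]

/-- The affine map `(aτ + b) / d`. -/
noncomputable def aff (a b d : ℕ) (τ : ℂ) : ℂ := ((a : ℂ) * τ + b) / d

lemma aff_im {a b d : ℕ} (τ : ℂ) : (aff a b d τ).im = a / d * τ.im := by
  have : aff a b d τ = ((a / d : ℝ) : ℂ) * τ + ((b / d : ℝ) : ℂ) := by
    rw [aff, add_div]; push_cast; ring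
  rw [this, add_im, im_ofReal_mul, ofReal_im, add_zero]

lemma tendsto_aff {a b d : ℕ} (ha : 0 < a) (hd : 0 < d) : Tendsto (aff a b d) cusp cusp := by
  rw [tendsto_comap_iff]
  have : Complex.im ∘ aff a b d = fun τ => ((a : ℝ) / d) * τ.im := by
    funext τ; exact aff_im τ
  rw [this]
  exact tendsto_comap.const_mul_atTop (by positivity)

lemma aff_im_pos {a b d : ℕ} (ha : 0 < a) (hd : 0 < d) {τ : ℂ} (hτ : 0 < τ.im) :
    0 < (aff a b d τ).im := by
  rw [aff_im]; positivity

lemma mob_repMat_inl (n a b : ℕ) (τ : ℂ) : mob (repMat n (.inl ⟨a, b⟩)) τ = aff a b (n / a) τ := by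
  simp only [repMat, mob, mden, aff, of_apply, cons_val', cons_val_zero, cons_val_one,
    cons_val_fin_one, Int.cast_natCast, Int.cast_zero, zero_mul, zero_add]

lemma prod_qc_aff {a d : ℕ} (hd : 0 < d) :
    ∃ κ : ℂ, κ ≠ 0 ∧ ∀ τ, ∏ b ∈ Finset.range d, qc (aff a b d τ) = κ * qc τ ^ a := by
  refine ⟨qc (∑ b ∈ Finset.range d, (b : ℂ) / d), qc_ne_zero _, fun τ => ?_⟩
  have h : ∀ (s : Finset ℕ) (f : ℕ → ℂ), ∏ b ∈ s, qc (f b) = qc (∑ b ∈ s, f b) := by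
    intro s f
    simp only [qc, Finset.mul_sum, exp_sum]
  have hd' : (d : ℂ) ≠ 0 := by exact_mod_cast hd.ne'
  rw [h, ← qc_nat_mul, ← qc_add]
  congr 1
  simp only [aff, add_div, Finset.sum_add_distrib, Finset.sum_const, Finset.card_range, nsmul_eq_mul]
  field_simp
  ring

/-- `F ∼ c q^{-A}` at the cusp, for some `c ≠ 0`. -/
def HasLead (F : ℂ → ℂ) (A : ℤ) : Prop :=
  ∃ c : ℂ, c ≠ 0 ∧ Tendsto (fun τ => F τ * qc τ ^ A) cusp (𝓝 c)

namespace HasLead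

variable {F F' : ℂ → ℂ} {A B : ℤ}

lemma mul (h : HasLead F A) (h' : HasLead F' B) : HasLead (fun τ => F τ * F' τ) (A + B) := by
  obtain ⟨c, hc, h⟩ := h
  obtain ⟨c', hc', h'⟩ := h'
  refine ⟨c * c', mul_ne_zero hc hc', (h.mul h').congr fun τ => ?_⟩
  rw [zpow_add₀ (qc_ne_zero τ)]; ring

lemma inv (h : HasLead F A) : HasLead (fun τ => (F τ)⁻¹) (-A) := by
  obtain ⟨c, hc, h⟩ := h
  refine ⟨c⁻¹, inv_ne_zero hc, (h.inv₀ hc).congr fun τ => ?_⟩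
  rw [_root_.zpow_neg, mul_inv]

lemma const {a : ℂ} (ha : a ≠ 0) : HasLead (fun _ => a) 0 := ⟨a, ha, by simp⟩

lemma prod {ι : Type*} (s : Finset ι) {F : ι → ℂ → ℂ} {A : ι → ℤ} (h : ∀ i ∈ s, HasLead (F i) (A i)) :
    HasLead (fun τ => ∏ i ∈ s, F i τ) (∑ i ∈ s, A i) := by
  classical
  induction s using Finset.induction_on with
  | empty => simpa using const one_ne_zero
  | insert a s ha ih =>
    simp only [Finset.prod_insert ha, Finset.sum_insert ha]
    exact (h a (Finset.mem_insert_self a s)).mul (ih fun i hi => h i (Finset.mem_insert_of_mem hi))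

lemma congr (h : HasLead F A) (h' : ∀ᶠ τ in cusp, F' τ = F τ) : HasLead F' A := by
  obtain ⟨c, hc, h⟩ := h
  refine ⟨c, hc, h.congr' ?_⟩
  filter_upwards [h'] with τ hτ
  rw [hτ]

lemma tendsto_zero (h : HasLead F A) (hAB : A < B) : Tendsto (fun τ => F τ * qc τ ^ B) cusp (𝓝 0) := by
  obtain ⟨c, hc, h⟩ := h
  have h1 := h.mul (tendsto_norm_qc_zpow_neg (A := A - B) (by omega))
  rw [mul_zero] at h1
  refine h1.congr fun τ => ?_
  rw [mul_assoc, ← zpow_add₀ (qc_ne_zero τ)]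
  congr 2
  ring

lemma unique [NeBot cusp] (h : HasLead F A) (h' : HasLead F B) : A = B := by
  rcases lt_trichotomy A B with hlt | heq | hlt
  · obtain ⟨c, hc, h2⟩ := h'
    exact absurd (tendsto_nhds_unique h2 (h.tendsto_zero hlt)) hc
  · exact heq
  · obtain ⟨c, hc, h2⟩ := h
    exact absurd (tendsto_nhds_unique h2 (h'.tendsto_zero hlt)) hc

lemma of_hasL2 {L : ℂ} (h : HasL2 F A L) : HasLead F A := by
  obtain ⟨c, u, hc, ε, hε, h⟩ := h
  refine ⟨c, hc, ?_⟩
  have h1 : Tendsto (fun τ => c * exp (u * qc τ + L / 2 * qc τ ^ 2 + ε τ)) cusp (𝓝 c) := by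
    have := ((continuous_exp.tendsto 0).comp (tendsto_qc_sq_coeff (a := u) (b := L / 2) hε)).const_mul c
    simpa using this
  refine h1.congr' ?_
  filter_upwards [h] with τ hτ
  rw [hτ, mul_right_comm, mul_assoc c, ← zpow_add₀ (qc_ne_zero τ), neg_add_cancel, zpow_zero, mul_one]

end HasLead

namespace Haupt

variable {p : ℕ} {k C : ℂ} {c : ℤ → ℂ} {t D G : ℂ → ℂ} (H : Haupt p k C c t D G)
include H

lemma t_repMat_inr {n g b : ℕ} (hn : 0 < n) (hg : g ∣ n) {τ : ℂ} (hτ : 0 < τ.im) :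
    t (mob (repMat n (.inr ⟨g, b⟩)) τ) = C / t (aff g b (p * (n / g)) τ) := by
  have hp := H.prime.pos
  have hg0 : 0 < g := Nat.pos_of_dvd_of_pos hg hn
  have hd : 0 < n / g := Nat.div_pos (Nat.le_of_dvd hn hg) hg0
  rw [← H.fricke _ (aff_im_pos hg0 (Nat.mul_pos hp hd) hτ), mob_wMat, aff, mob]
  have h1 : (p : ℂ) ≠ 0 := by exact_mod_cast hp.ne'
  have h2 : ((n / g : ℕ) : ℂ) ≠ 0 := by exact_mod_cast hd.ne'
  congr 1
  simp only [repMat, mden, of_apply, cons_val', cons_val_zero, cons_val_one, cons_val_fin_one,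
    Int.cast_natCast, Int.cast_zero, Int.cast_neg, zero_mul, zero_add, Nat.cast_mul]
  field_simp

lemma hasLead_block {a d : ℕ} (ha : 0 < a) (hd : 0 < d) :
    HasLead (fun τ => ∏ b ∈ Finset.range d, t (aff a b d τ)) a := by
  obtain ⟨κ, hκ, h⟩ := prod_qc_aff (a := a) hd
  refine ⟨κ⁻¹, inv_ne_zero hκ, ?_⟩
  have h1 : Tendsto (fun τ => ∏ b ∈ Finset.range d, (t (aff a b d τ) * qc (aff a b d τ))) cusp
      (𝓝 (∏ b ∈ Finset.range d, 1)) :=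
    tendsto_finsetProd _ fun b _ => H.tendsto_mul_qc.comp (tendsto_aff ha hd)
  have h2 := h1.const_mul κ⁻¹
  simp only [Finset.prod_const_one, mul_one] at h2
  refine h2.congr fun τ => ?_
  rw [Finset.prod_mul_distrib, h τ, zpow_natCast]
  field_simp

open Classical in
lemma hasLead_normProd {n : ℕ} (hn : 0 < n) :
    HasLead (normProd p n t) (∑ a ∈ n.divisors, (a : ℤ) - ∑ g ∈ n.divisors.filter (p ∣ ·), (g : ℤ) -
      if IsSquare n then 1 else 0) := by
  have hp := H.prime.pos
  have h1 : HasLead (fun τ => ∏ a ∈ n.divisors, ∏ b ∈ Finset.range (n / a), t (aff a b (n / a) τ))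
      (∑ a ∈ n.divisors, (a : ℤ)) := by
    refine HasLead.prod _ fun a ha => ?_
    obtain ⟨ha, -⟩ := Nat.mem_divisors.1 ha
    have ha0 := Nat.pos_of_dvd_of_pos ha hn
    exact H.hasLead_block ha0 (Nat.div_pos (Nat.le_of_dvd hn ha) ha0)
  have h2 : HasLead (fun τ => ∏ g ∈ n.divisors.filter (p ∣ ·), (C ^ (p * (n / g)) *
      (∏ b ∈ Finset.range (p * (n / g)), t (aff g b (p * (n / g)) τ))⁻¹))
      (∑ g ∈ n.divisors.filter (p ∣ ·), (0 + -(g : ℤ))) := by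
    refine HasLead.prod _ fun a ha => ?_
    obtain ⟨ha, -⟩ := Nat.mem_divisors.1 (Finset.mem_filter.1 ha).1
    have ha0 := Nat.pos_of_dvd_of_pos ha hn
    exact (HasLead.const (pow_ne_zero _ H.C_ne)).mul (H.hasLead_block ha0
      (Nat.mul_pos hp (Nat.div_pos (Nat.le_of_dvd hn ha) ha0))).inv
  have h3 : HasLead (fun τ => (if IsSquare n then t τ else 1)⁻¹) (-if IsSquare n then 1 else 0) := by
    refine HasLead.inv ?_
    split_ifs
    · exact HasLead.of_hasL2 H.hasL2
    · exact HasLead.const one_ne_zero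
  have h4 := (h1.mul h2).mul h3
  have hA : ∑ a ∈ n.divisors, (a : ℤ) + ∑ g ∈ n.divisors.filter (p ∣ ·), (0 + -(g : ℤ)) +
      (-if IsSquare n then 1 else 0) = ∑ a ∈ n.divisors, (a : ℤ) -
      ∑ g ∈ n.divisors.filter (p ∣ ·), (g : ℤ) - if IsSquare n then 1 else 0 := by
    simp only [zero_add, Finset.sum_neg_distrib]
    ring
  rw [hA] at h4
  clear hA h1 h2 h3
  refine h4.congr ?_
  filter_upwards [eventually_cusp_im 0] with τ hτ
  have h5 : (if IsSquare n then t τ else 1) ≠ 0 := by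
    split_ifs
    · exact H.t_ne τ hτ
    · exact one_ne_zero
  rw [eq_mul_inv_iff_mul_eq₀ h5]
  have h6 := prod_nsIdx_mul H.prime hn fun i => t (mob (repMat n i) τ)
  have h7 : (if IsSquare n then t (mob (repMat n (.inl ⟨n.sqrt, 0⟩)) τ) else 1) =
      if IsSquare n then t τ else 1 := by
    split_ifs with hs
    · obtain ⟨s1, s2, s3⟩ := sqrt_facts hn hs
      have : (n.sqrt : ℂ) ≠ 0 := by exact_mod_cast s1.ne'
      rw [mob_repMat_inl, aff, s3]
      congr 1
      field_simp
      simp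
    · rfl
  rw [h7] at h6
  rw [normProd, h6]
  congr 1
  · simp only [mob_repMat_inl]
  · refine Finset.prod_congr rfl fun g hg => ?_
    obtain ⟨hg, -⟩ := Nat.mem_divisors.1 (Finset.mem_filter.1 hg).1
    simp only [H.t_repMat_inr hn hg hτ]
    rw [Finset.prod_div_distrib, Finset.prod_const, Finset.card_range, div_eq_mul_inv]

lemma exists_normProd_eq {n : ℕ} (hn : 0 < n) :
    ∃ (κ : ℂ) (m B : ℕ), κ ≠ 0 ∧ ∀ z : ℂ, 0 < z.im → normProd p n t z = κ * t z ^ m / t z ^ B := by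
  classical
  have hlead := H.hasLead_normProd hn
  generalize ∑ a ∈ n.divisors, (a : ℤ) - ∑ g ∈ n.divisors.filter (p ∣ ·), (g : ℤ) -
      (if IsSquare n then 1 else 0) = u at hlead
  have h1 : Tendsto (fun z => normProd p n t z * qc z ^ (u.natAbs + 1)) cusp (𝓝 0) := by
    have := hlead.tendsto_zero (B := (u.natAbs + 1 : ℕ)) (by omega)
    simpa only [zpow_natCast] using this
  have h2 : Tendsto (fun z => normProd p n t (mob (wMat p) z) * qc z ^ (u.natAbs + 1)) cusp (𝓝 0) := by
    have hl2 := (HasLead.const (pow_ne_zero (nsIdx p n).card H.C_ne)).mul hlead.inv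
    have := hl2.tendsto_zero (B := (u.natAbs + 1 : ℕ)) (by omega)
    refine this.congr' ?_
    filter_upwards [eventually_cusp_im 0] with τ hτ
    rw [zpow_natCast, H.normProd_wMat hn hτ, div_eq_mul_inv]
  obtain ⟨Q, hQ⟩ := H.exists_polynomial _ _ (H.isMod_normProd hn) h1 h2
  have hne : ∀ z : ℂ, 0 < z.im → Q.eval (t z) ≠ 0 := fun z hz => by
    rw [← hQ z hz]
    exact mul_ne_zero (H.normProd_ne hn hz) (pow_ne_zero _ (H.t_ne z hz))
  have hQ0 : Q ≠ 0 := by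
    rintro rfl
    exact hne I (by simp) (by simp)
  obtain ⟨q, hq, hX⟩ := Polynomial.exists_eq_pow_rootMultiplicity_mul_and_not_dvd Q hQ0 0
  generalize Q.rootMultiplicity 0 = m at hq
  simp only [Polynomial.C_0, sub_zero] at hq hX
  have hdeg : q.degree = 0 := by
    by_contra hdeg
    obtain ⟨x, hx⟩ := IsAlgClosed.exists_root q hdeg
    have hx0 : x ≠ 0 := by
      rintro rfl
      exact hX (by simpa using Polynomial.dvd_iff_isRoot.2 hx)
    obtain ⟨z, hz, rfl⟩ := H.exists_eq hx0
    apply hne z hz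
    rw [hq, Polynomial.eval_mul, hx.eq_zero, mul_zero]
  rw [Polynomial.eq_C_of_degree_eq_zero hdeg] at hq
  refine ⟨q.coeff 0, m, u.natAbs + 1, ?_, fun z hz => ?_⟩
  · intro h0
    rw [h0, Polynomial.C_0, mul_zero] at hq
    exact hQ0 hq
  · rw [eq_div_iff (pow_ne_zero _ (H.t_ne z hz)), hQ z hz]
    rw [congrArg (Polynomial.eval (t z)) hq, Polynomial.eval_mul, Polynomial.eval_pow,
      Polynomial.eval_X, Polynomial.eval_C, mul_comm]

open Classical in
lemma hasL2_normProd {n : ℕ} (hn : 0 < n) {u : ℤ}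
    (hu : u = ∑ a ∈ n.divisors, (a : ℤ) - ∑ g ∈ n.divisors.filter (p ∣ ·), (g : ℤ) -
      if IsSquare n then 1 else 0) :
    HasL2 (normProd p n t) u (-(u * faber k (c 1) 0)) := by
  obtain ⟨κ, m, B, hκ, h⟩ := H.exists_normProd_eq hn
  have h1 := ((HasL2.const hκ).mul (H.hasL2.pow m)).div (H.hasL2.pow B)
  have h2 : HasL2 (normProd p n t) _ _ := h1.congr (by
    filter_upwards [eventually_cusp_im 0] with τ hτ using h τ hτ)
  have : NeBot cusp := by
    rw [neBot_iff]
    intro hbot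
    have := HasL2.unique (F := fun _ => (1 : ℂ)) (A := 0) (B := 1) (L := 0) (M := 0)
      (HasL2.const one_ne_zero) ⟨1, 0, one_ne_zero, fun _ => 0, by simp [hbot], by simp [hbot]⟩
    omega
  have h3 := (HasLead.of_hasL2 h2).unique (H.hasLead_normProd hn)
  rw [← hu] at h3
  have h4 : (0 + m * -faber k (c 1) 0 - B * -faber k (c 1) 0 : ℂ) = -(u * faber k (c 1) 0) := by
    rw [← h3]; push_cast; ring
  rwa [h3, h4] at h2

end Haupt

lemma tendsto_prod_one_sub {ι : Type*} (s : Finset ι) {B x : ι → ℂ → ℂ}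
    (hB : ∀ i ∈ s, Tendsto (fun τ => (B i τ - (1 - qc τ * x i τ)) / qc τ ^ 2) cusp (𝓝 0))
    (hx : ∀ i ∈ s, Tendsto (x i) cusp (𝓝 0)) :
    Tendsto (fun τ => (∏ i ∈ s, B i τ - (1 - qc τ * ∑ i ∈ s, x i τ)) / qc τ ^ 2) cusp (𝓝 0) := by
  classical
  induction s using Finset.induction_on with
  | empty => simp
  | insert i s hi ih =>
    have h1 := ih (fun j hj => hB j (Finset.mem_insert_of_mem hj))
      fun j hj => hx j (Finset.mem_insert_of_mem hj)
    have h2 := hB i (Finset.mem_insert_self i s)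
    have h3 := hx i (Finset.mem_insert_self i s)
    have h4 : Tendsto (fun τ => ∑ j ∈ s, x j τ) cusp (𝓝 0) := by
      simpa using tendsto_finsetSum s fun j hj => hx j (Finset.mem_insert_of_mem hj)
    have h5 : Tendsto (B i) cusp (𝓝 1) := by
      have := (h2.mul (tendsto_qc.pow 2)).add ((tendsto_qc.mul h3).const_sub 1)
      simp only [zero_mul, sub_zero, zero_add] at this
      refine this.congr fun τ => ?_
      have := qc_ne_zero τ
      field_simp
      ring
    have h6 := ((h4.mul h3).add (h1.mul h5)).add (h2.mul ((tendsto_qc.mul h4).const_sub 1))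
    simp only [zero_mul, add_zero] at h6
    refine h6.congr fun τ => ?_
    have := qc_ne_zero τ
    rw [Finset.prod_insert hi, Finset.sum_insert hi]
    field_simp
    ring

lemma hasL2_prod_one_sub {ι : Type*} (s : Finset ι) {B x : ι → ℂ → ℂ} {κ : ℂ}
    (hB : ∀ i ∈ s, Tendsto (fun τ => (B i τ - (1 - qc τ * x i τ)) / qc τ ^ 2) cusp (𝓝 0))
    (hx : ∀ i ∈ s, Tendsto (x i) cusp (𝓝 0))
    (hs : Tendsto (fun τ => (∑ i ∈ s, x i τ) / qc τ) cusp (𝓝 κ)) :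
    HasL2 (fun τ => ∏ i ∈ s, B i τ) 0 (-(2 * κ)) := by
  have h1 : HasJ (fun τ => ∏ i ∈ s, B i τ) 0 1 0 (2 * -κ - 0 ^ 2) := by
    refine hasJ_of_taylor (ε := fun τ => ∏ i ∈ s, B i τ - 1 + κ * qc τ ^ 2) one_ne_zero ?_ ?_
    · have h2 := (tendsto_prod_one_sub s hB hx).sub (hs.sub_const κ)
      simp only [sub_self] at h2
      refine h2.congr fun τ => ?_
      have := qc_ne_zero τ
      field_simp
      ring
    · refine Eventually.of_forall fun τ => ?_
      simp
      ring
  have h2 : -(2 * κ) = 2 * -κ - 0 ^ 2 := by ring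
  rw [h2]
  exact ⟨_, _, h1⟩

lemma qc_aff {a b d : ℕ} (τ : ℂ) :
    qc (aff a b d τ) = exp (2 * Real.pi * I / d) ^ b * qc (aff a 0 d τ) := by
  rw [← Complex.exp_nat_mul, qc, qc, ← Complex.exp_add, aff, aff]
  congr 1
  simp
  ring

lemma qc_aff_pow {a b d : ℕ} (hd : 0 < d) (τ : ℂ) : qc (aff a b d τ) ^ d = qc τ ^ a := by
  have hd' : (d : ℂ) ≠ 0 := by exact_mod_cast hd.ne'
  rw [← qc_nat_mul, aff, mul_div_cancel₀ _ hd', qc_add, qc_nat_mul, ← Int.cast_natCast b, qc_intCast,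
    mul_one]

lemma sum_qc_aff_pow {a d m : ℕ} (hd : 0 < d) (hm : m ≤ d) (τ : ℂ) :
    ∑ b ∈ Finset.range d, qc (aff a b d τ) ^ m =
      if m = 0 then (d : ℂ) else if m = d then d * qc τ ^ a else 0 := by
  split_ifs with h1 h2
  · simp [h1]
  · rw [h2, Finset.sum_congr rfl fun b _ => qc_aff_pow hd τ]
    simp
  · have hζ := Complex.isPrimitiveRoot_exp d hd.ne'
    have h3 : ∀ b ∈ Finset.range d, qc (aff a b d τ) ^ m =
        (exp (2 * Real.pi * I / d) ^ m) ^ b * qc (aff a 0 d τ) ^ m := fun b _ => by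
      rw [qc_aff, mul_pow, ← pow_mul, ← pow_mul, mul_comm b m]
    have hne : exp (2 * Real.pi * I / d) ^ m ≠ 1 :=
      hζ.pow_ne_one_of_pos_of_lt h1 (lt_of_le_of_ne hm h2)
    rw [Finset.sum_congr rfl h3, ← Finset.sum_mul, geom_sum_eq hne, ← pow_mul, mul_comm m d, pow_mul,
      hζ.pow_eq_one, one_pow, sub_self, zero_div, zero_mul]

lemma tendsto_multisection {h : ℂ → ℂ} {e : ℕ → ℂ} {a d : ℕ} (ha : 0 < a) (hd : 0 < d)
    (hO : (fun x => h x - ∑ m ∈ Finset.range (d + 1), e m * x ^ m) =O[𝓝 0] fun x => x ^ (d + 1)) :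
    Tendsto (fun τ => (∑ b ∈ Finset.range d, h (qc (aff a b d τ)) - d * e 0) / qc τ ^ a) cusp
      (𝓝 (d * e d)) := by
  have h1 : ∀ b, Tendsto (fun τ => (h (qc (aff a b d τ)) -
      ∑ m ∈ Finset.range (d + 1), e m * qc (aff a b d τ) ^ m) / qc τ ^ a) cusp (𝓝 0) := fun b => by
    have hr : Tendsto (fun τ => qc (aff a b d τ)) cusp (𝓝 0) := tendsto_qc.comp (tendsto_aff ha hd)
    obtain ⟨K, hK⟩ := hO.bound
    have h0 : Tendsto (fun τ => K * ‖qc (aff a b d τ)‖) cusp (𝓝 0) := by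
      simpa using hr.norm.const_mul K
    refine squeeze_zero_norm' ?_ h0
    filter_upwards [hr.eventually hK] with τ hτ
    rw [norm_div, ← qc_aff_pow (b := b) hd, div_le_iff₀ (norm_pos_iff.2 (pow_ne_zero _ (qc_ne_zero _)))]
    refine hτ.trans_eq ?_
    rw [norm_pow, norm_pow, pow_succ]
    ring
  have h2 : Tendsto (fun τ => ∑ b ∈ Finset.range d, (h (qc (aff a b d τ)) -
      ∑ m ∈ Finset.range (d + 1), e m * qc (aff a b d τ) ^ m) / qc τ ^ a + d * e d) cusp
      (𝓝 (d * e d)) := by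
    simpa using (tendsto_finsetSum (Finset.range d) fun b _ => h1 b).add_const (d * e d)
  refine h2.congr fun τ => ?_
  have h3 : ∑ b ∈ Finset.range d, ∑ m ∈ Finset.range (d + 1), e m * qc (aff a b d τ) ^ m =
      d * e 0 + d * e d * qc τ ^ a := by
    rw [Finset.sum_comm]
    have h4 : ∀ m ∈ Finset.range (d + 1), ∑ b ∈ Finset.range d, e m * qc (aff a b d τ) ^ m =
        if m = 0 then d * e 0 else if m = d then d * e d * qc τ ^ a else 0 := fun m hm => by
      rw [← Finset.mul_sum, sum_qc_aff_pow hd (Nat.lt_succ_iff.1 (Finset.mem_range.1 hm))]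
      split_ifs with h5 h6
      · rw [h5]; ring
      · rw [h6]; ring
      · rw [mul_zero]
    rw [Finset.sum_congr rfl h4, Finset.sum_range_succ', Finset.sum_congr rfl (g := fun m =>
      if m = d - 1 then d * e d * qc τ ^ a else 0) fun m _ => by
        simp only [Nat.succ_ne_zero, if_false, show m + 1 = d ↔ m = d - 1 by omega],
      Finset.sum_ite_eq', if_pos (Finset.mem_range.2 (by omega)), if_pos rfl, add_comm]
  have := qc_ne_zero τ
  rw [← Finset.sum_div, Finset.sum_sub_distrib, h3]
  field_simp
  ring

lemma exists_isBigO {h : ℂ → ℂ} {ps : FormalMultilinearSeries ℂ ℂ ℂ} (hh : HasFPowerSeriesAt h ps 0)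
    (d : ℕ) : (fun x => h x - ∑ m ∈ Finset.range d, ps.coeff m * x ^ m) =O[𝓝 0] fun x => x ^ d := by
  have h1 := (hh.isBigO_sub_partialSum_pow d).trans (g := fun x : ℂ => ‖x‖ ^ d)
    (k := fun x : ℂ => x ^ d) (by
      simp_rw [← norm_pow]
      exact (Asymptotics.isBigO_refl _ _).norm_left)
  refine h1.congr_left fun x => ?_
  rw [zero_add, FormalMultilinearSeries.partialSum]
  congr 1
  refine Finset.sum_congr rfl fun m _ => ?_
  rw [FormalMultilinearSeries.apply_eq_pow_smul_coeff, smul_eq_mul, mul_comm]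

lemma prod_inv_sub_inv {a d : ℕ} (hd : 0 < d) (τ : ℂ) :
    ∏ b ∈ Finset.range d, ((qc τ)⁻¹ - (qc (aff a b d τ))⁻¹) = (qc τ)⁻¹ ^ d - (qc τ)⁻¹ ^ a := by
  have hζ := (Complex.isPrimitiveRoot_exp d hd.ne').inv
  have h1 := X_pow_sub_C_eq_prod hζ hd (α := (qc (aff a 0 d τ))⁻¹) (a := (qc τ)⁻¹ ^ a) (by
    rw [inv_pow, qc_aff_pow hd, inv_pow])
  have h2 := congrArg (Polynomial.eval (qc τ)⁻¹) h1
  simp only [Polynomial.eval_sub, Polynomial.eval_pow, Polynomial.eval_X, Polynomial.eval_C,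
    Polynomial.eval_prod] at h2
  rw [h2]
  refine Finset.prod_congr rfl fun b _ => ?_
  rw [qc_aff (b := b), mul_inv, inv_pow]

lemma qc_ne_qc_aff {a b d : ℕ} (hd : 0 < d) (hb : b < d) (h : b ≠ 0 ∨ a ≠ d) {τ : ℂ} (hτ : 0 < τ.im) :
    qc τ ≠ qc (aff a b d τ) := by
  intro heq
  obtain ⟨m, hm⟩ := qc_eq_iff.1 heq
  have hd' : (d : ℝ) ≠ 0 := by exact_mod_cast hd.ne'
  have hdc : (d : ℂ) ≠ 0 := by exact_mod_cast hd.ne'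
  have h1 := congrArg Complex.im hm
  rw [add_im, intCast_im, add_zero, aff_im] at h1
  have h2 : (a : ℝ) / d = 1 := by
    have := mul_right_cancel₀ hτ.ne' ((one_mul _).trans h1)
    exact this.symm
  rw [div_eq_one_iff_eq hd'] at h2
  have had : a = d := by exact_mod_cast h2
  subst had
  rw [aff] at hm
  field_simp at hm
  have h3 : ((b + a * m : ℤ) : ℂ) = 0 := by push_cast; linear_combination -hm
  have h4 : (b : ℤ) + a * m = 0 := by exact_mod_cast h3
  have h5 : (a : ℤ) ∣ b := ⟨-m, by linarith⟩
  have h6 : b = 0 := Nat.eq_zero_of_dvd_of_lt (by exact_mod_cast h5) hb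
  simp [h6] at h

/-- The contribution `s` if `s ∈ {1, 2}` and `0` otherwise. -/
noncomputable def gap (s : ℕ) : ℂ := if s = 1 then 1 else if s = 2 then 2 else 0

lemma hasL2_one_sub_pow {s : ℕ} (hs : 0 < s) : HasL2 (fun τ => 1 - qc τ ^ s) 0 (-gap s) := by
  have hJ : HasJ (fun τ => 1 - qc τ ^ s) 0 1 (if s = 1 then -1 else 0)
      (2 * (if s = 2 then -1 else 0) - (if s = 1 then -1 else 0) ^ 2) := by
    refine hasJ_of_taylor (ε := fun τ => if 3 ≤ s then -qc τ ^ s else 0) one_ne_zero ?_ ?_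
    · split_ifs with h
      · refine tendsto_div_sq_of_le (K := 1) ?_
        filter_upwards [eventually_norm_qc_le one_pos] with τ hτ
        rw [norm_neg, norm_pow, one_mul]
        exact pow_le_pow_of_le_one (norm_nonneg _) hτ h
      · simp
    · refine Eventually.of_forall fun τ => ?_
      rcases (by omega : s = 1 ∨ s = 2 ∨ 3 ≤ s) with h | h | h
      · subst h; simp; ring
      · subst h; simp; ring
      · simp [h, show s ≠ 1 by omega, show s ≠ 2 by omega]; ring
  refine ⟨1, if s = 1 then -1 else 0, ?_⟩
  convert hJ using 1
  rw [gap]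
  split_ifs <;> first | omega | norm_num

lemma hasL2_pow_sub_pow {a d : ℕ} (h : a ≠ d) :
    ∃ A : ℤ, HasL2 (fun τ => (qc τ)⁻¹ ^ d - (qc τ)⁻¹ ^ a) A (-gap ((a : ℤ) - d).natAbs) := by
  have h1 : ∀ a d : ℕ, a < d →
      ∃ A : ℤ, HasL2 (fun τ => (qc τ)⁻¹ ^ d - (qc τ)⁻¹ ^ a) A (-gap ((a : ℤ) - d).natAbs) := by
    intro a d h
    have h2 : HasL2 (fun τ => qc τ ^ (-(d : ℤ))) d 0 := ⟨_, _, HasJ.zpow_qc _⟩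
    have h3 := h2.mul (hasL2_one_sub_pow (s := d - a) (by omega))
    rw [zero_add] at h3
    refine ⟨d + 0, ?_⟩
    rw [show ((a : ℤ) - d).natAbs = d - a by omega]
    refine h3.congr (Eventually.of_forall fun τ => ?_)
    have hq := qc_ne_zero τ
    obtain ⟨s, rfl⟩ : ∃ s, d = a + s := ⟨d - a, by omega⟩
    rw [_root_.zpow_neg, zpow_natCast, Nat.add_sub_cancel_left, inv_pow, inv_pow, pow_add]
    field_simp
  rcases lt_or_gt_of_ne h with h | h
  · exact h1 a d h
  · obtain ⟨A, hA⟩ := h1 d a h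
    have h2 := (HasL2.const (a := -1) (by norm_num)).mul hA
    refine ⟨A, ?_⟩
    rw [zero_add, zero_add, show ((d : ℤ) - a).natAbs = ((a : ℤ) - d).natAbs by omega] at h2
    exact h2.congr (Eventually.of_forall fun τ => by ring)

namespace Haupt

variable {p : ℕ} {k C : ℂ} {c : ℤ → ℂ} {t D G : ℂ → ℂ} (H : Haupt p k C c t D G)
include H

lemma analyticAt_G : AnalyticAt ℂ G 0 := by
  obtain ⟨ps, h, -⟩ := H.series
  exact h.analyticAt

lemma tendsto_factor {σ : ℂ → ℂ} (hσ : Tendsto σ cusp cusp) (hne : ∀ᶠ τ in cusp, qc τ ≠ qc (σ τ)) :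
    Tendsto (fun τ => ((t τ - t (σ τ)) / ((qc τ)⁻¹ - (qc (σ τ))⁻¹) -
      (1 - qc τ * (qc (σ τ) * G (qc (σ τ))))) / qc τ ^ 2) cusp (𝓝 0) := by
  have hr : Tendsto (fun τ => qc (σ τ)) cusp (𝓝 0) := tendsto_qc.comp hσ
  obtain ⟨K, hK⟩ := H.analyticAt_G.hasStrictDerivAt.hasStrictFDerivAt.isBigO_sub.bound
  have h0 : Tendsto (fun τ => ‖qc (σ τ)‖ * K) cusp (𝓝 0) := by simpa using hr.norm.mul_const K
  refine squeeze_zero_norm' ?_ h0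
  filter_upwards [hne, (tendsto_qc.prodMk_nhds hr).eventually hK, eventually_cusp_im 0,
    hσ.eventually (eventually_cusp_im 0)] with τ h1 h2 h3 h4
  have hq := qc_ne_zero τ
  have hr0 := qc_ne_zero (σ τ)
  have hsub : qc τ - qc (σ τ) ≠ 0 := sub_ne_zero.2 h1
  have hinv : (qc τ)⁻¹ - (qc (σ τ))⁻¹ ≠ 0 := sub_ne_zero.2 fun h => h1 (inv_injective h)
  have h5 : ((t τ - t (σ τ)) / ((qc τ)⁻¹ - (qc (σ τ))⁻¹) -
      (1 - qc τ * (qc (σ τ) * G (qc (σ τ))))) / qc τ ^ 2 =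
      -(qc (σ τ) * ((G (qc τ) - G (qc (σ τ))) / (qc τ - qc (σ τ)))) := by
    rw [H.qexp τ h3, H.qexp _ h4]
    generalize qc τ = q at *
    generalize qc (σ τ) = r at *
    have : q⁻¹ - r⁻¹ = -(q - r) / (q * r) := by field_simp; ring
    rw [div_sub' hinv, div_div, div_eq_iff (mul_ne_zero hinv (pow_ne_zero 2 hq)), this]
    field_simp
    ring
  rw [h5, norm_neg, norm_mul, norm_div]
  gcongr
  rw [div_le_iff₀ (norm_pos_iff.2 hsub)]
  exact h2

lemma tendsto_sum_mul_G {a d : ℕ} (ha : 0 < a) (hd : 0 < d) :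
    Tendsto (fun τ => (∑ b ∈ Finset.range d, qc (aff a b d τ) * G (qc (aff a b d τ))) / qc τ) cusp
      (𝓝 (if a = 1 then d * c d else 0)) := by
  obtain ⟨ps, hG, hc⟩ := H.series
  have hO := (Asymptotics.isBigO_refl (fun x : ℂ => x) (𝓝 0)).mul (exists_isBigO hG d)
  have h1 := tendsto_multisection (h := fun x => x * G x) (e := fun m => if m = 0 then 0 else c m) ha hd
    (by
      refine (hO.congr_left fun x => ?_).congr_right fun x => by ring
      rw [Finset.sum_range_succ', mul_sub, Finset.mul_sum]
      simp only [Nat.succ_ne_zero, if_false, if_true, zero_mul, add_zero]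
      congr 1
      refine Finset.sum_congr rfl fun m _ => ?_
      rw [hc]; push_cast; ring)
  simp only [if_true, mul_zero, sub_zero, hd.ne', if_false] at h1
  split_ifs with h
  · subst h; simpa using h1
  · have h2 := h1.mul (tendsto_qc.pow (a - 1))
    rw [zero_pow (by omega), mul_zero] at h2
    refine h2.congr fun τ => ?_
    have := qc_ne_zero τ
    obtain ⟨a, rfl⟩ : ∃ a', a = a' + 1 := ⟨a - 1, by omega⟩
    rw [Nat.add_sub_cancel, pow_succ]
    field_simp

lemma hasL2_block_inl {a d : ℕ} (ha : 0 < a) (hd : 0 < d) :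
    ∃ A : ℤ, HasL2 (fun τ => ∏ b ∈ (Finset.range d).filter (fun b => b ≠ 0 ∨ a ≠ d),
      (t τ - t (aff a b d τ))) A
      (-gap ((a : ℤ) - d).natAbs - 2 * ((if a = 1 then d * c d else 0) - if a = d then c 1 else 0)) := by
  classical
  set S := (Finset.range d).filter (fun b => b ≠ 0 ∨ a ≠ d) with hS
  have hmem : ∀ b ∈ S, b < d ∧ (b ≠ 0 ∨ a ≠ d) := fun b hb => by
    simpa [hS] using hb
  have hlim : Tendsto (fun τ => (∑ b ∈ S, qc (aff a b d τ) * G (qc (aff a b d τ))) / qc τ) cusp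
      (𝓝 ((if a = 1 then d * c d else 0) - if a = d then c 1 else 0)) := by
    by_cases had : a = d
    · rw [if_pos had]
      refine ((H.tendsto_sum_mul_G ha hd).sub H.tendsto_G).congr fun τ => ?_
      have hS' : S = (Finset.range d).erase 0 := by ext b; simp [hS, had, and_comm]
      have haff : aff a 0 d τ = τ := by
        have : (d : ℂ) ≠ 0 := by exact_mod_cast hd.ne'
        rw [aff, had]; field_simp; simp
      have := qc_ne_zero τ
      rw [hS', ← Finset.sum_erase_add _ _ (Finset.mem_range.2 hd), haff]
      field_simp
      ring
    · rw [if_neg had, sub_zero]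
      have hS' : S = Finset.range d := by simp [hS, had]
      rw [hS']
      exact H.tendsto_sum_mul_G ha hd
  have hne : ∀ b ∈ S, ∀ᶠ τ in cusp, qc τ ≠ qc (aff a b d τ) := fun b hb => by
    filter_upwards [eventually_cusp_im 0] with τ hτ
    exact qc_ne_qc_aff hd (hmem b hb).1 (hmem b hb).2 hτ
  have h1 := hasL2_prod_one_sub S
    (fun b hb => H.tendsto_factor (tendsto_aff (b := b) ha hd) (hne b hb))
    (fun b hb => by
      have := (tendsto_qc.mul H.tendsto_G).comp (tendsto_aff (b := b) ha hd)
      rw [zero_mul] at this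
      exact this) hlim
  obtain ⟨A, h2⟩ : ∃ A : ℤ, HasL2 (fun τ => ∏ b ∈ S, ((qc τ)⁻¹ - (qc (aff a b d τ))⁻¹)) A
      (-gap ((a : ℤ) - d).natAbs) := by
    by_cases had : a = d
    · refine ⟨∑ b ∈ S, 1, ?_⟩
      have : -gap ((a : ℤ) - d).natAbs = ∑ b ∈ S, (0 : ℂ) := by simp [had, gap]
      rw [this]
      refine HasL2.prod S fun b hb => ?_
      obtain ⟨hb1, hb2⟩ := hmem b hb
      have hζ := (Complex.isPrimitiveRoot_exp d hd.ne')
      have hne1 : 1 - (exp (2 * Real.pi * I / d) ^ b)⁻¹ ≠ 0 := by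
        rw [sub_ne_zero, ne_comm, ne_eq, inv_eq_one]
        exact hζ.pow_ne_one_of_pos_of_lt (hb2.resolve_right (by simp [had])) hb1
      have hz : HasL2 (fun τ => qc τ ^ (-(1 : ℤ))) 1 0 := ⟨_, _, HasJ.zpow_qc _⟩
      have := (HasL2.const hne1).mul hz
      rw [zero_add, zero_add] at this
      refine this.congr (Eventually.of_forall fun τ => ?_)
      have haff : aff a 0 d τ = τ := by
        have : (d : ℂ) ≠ 0 := by exact_mod_cast hd.ne'
        rw [aff, had]; field_simp; simp
      rw [qc_aff, haff, mul_inv, _root_.zpow_neg_one]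
      ring
    · have hS' : S = Finset.range d := by simp [hS, had]
      rw [hS']
      simp only [prod_inv_sub_inv hd]
      exact hasL2_pow_sub_pow had
  refine ⟨A + 0, ?_⟩
  rw [sub_eq_add_neg]
  refine (h2.mul h1).congr ?_
  filter_upwards [(S.eventually_all).2 hne] with τ hτ
  rw [← Finset.prod_mul_distrib]
  refine Finset.prod_congr rfl fun b hb => ?_
  rw [mul_div_cancel₀]
  exact sub_ne_zero.2 fun h => hτ b hb (inv_injective h)

lemma hasL2_block_inr {a d : ℕ} (ha : 2 ≤ a) (hd : 0 < d) :
    ∃ A : ℤ, HasL2 (fun τ => ∏ b ∈ Finset.range d, (t τ - C / t (aff a b d τ))) A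
      (-(d * faber k (c 1) 0)) := by
  have ha0 : 0 < a := by omega
  set h : ℂ → ℂ := fun x => x / (1 - k * x + x ^ 2 * G x) with hh
  have hG := H.analyticAt_G
  have han : AnalyticAt ℂ h 0 := by
    refine AnalyticAt.div (by fun_prop) (by fun_prop) ?_
    simp
  obtain ⟨ps, hps⟩ := han
  have hps0 : ps.coeff 0 = 0 := by
    rw [FormalMultilinearSeries.coeff, hps.coeff_zero, hh]
    exact zero_div _
  have hteq : ∀ z : ℂ, 0 < z.im → h (qc z) = (t z)⁻¹ := fun z hz => by
    have := qc_ne_zero z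
    rw [hh, H.qexp z hz, ← _root_.inv_inj, inv_inv]
    change (qc z / _)⁻¹ = _
    rw [inv_div]
    field_simp
  have hlim : Tendsto (fun τ => (∑ b ∈ Finset.range d, C * (t (aff a b d τ))⁻¹) / qc τ) cusp (𝓝 0) := by
    have h1 := ((tendsto_multisection ha0 hd (exists_isBigO hps (d + 1))).mul
      (tendsto_qc.pow (a - 1))).const_mul C
    rw [zero_pow (by omega), mul_zero, mul_zero] at h1
    refine h1.congr' ?_
    filter_upwards [eventually_cusp_im 0] with τ hτ
    have := qc_ne_zero τ
    obtain ⟨a, rfl⟩ : ∃ a', a = a' + 1 := ⟨a - 1, by omega⟩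
    rw [Finset.sum_congr rfl fun b _ => hteq _ (aff_im_pos (b := b) ha0 hd hτ), hps0, mul_zero, sub_zero,
      Nat.add_sub_cancel, ← Finset.mul_sum, pow_succ]
    field_simp
  have h1 := hasL2_prod_one_sub (Finset.range d)
    (B := fun b τ => 1 - C * (t τ)⁻¹ * (t (aff a b d τ))⁻¹) (fun b _ => by
      have h2 := (((tendsto_qc.mul H.tendsto_G).const_sub k).div H.tendsto_mul_qc one_ne_zero).mul
        (H.tendsto_inv.comp (tendsto_aff (b := b) ha0 hd)) |>.const_mul (-C)
      simp only [mul_zero] at h2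
      refine h2.congr' ?_
      filter_upwards [eventually_cusp_im 0] with τ hτ
      have hq := qc_ne_zero τ
      have ht := H.t_ne τ hτ
      have ht' := H.t_ne _ (aff_im_pos (b := b) ha0 hd hτ)
      have he : k - qc τ * G (qc τ) = (1 - t τ * qc τ) / qc τ := by
        rw [H.qexp τ hτ]; field_simp; ring
      simp only [Pi.div_apply, Function.comp_apply, he]
      field_simp
      ring)
    (fun b _ => by
      have := (H.tendsto_inv.comp (tendsto_aff (b := b) ha0 hd)).const_mul C
      rw [mul_zero] at this
      exact this) hlim
  have h3 := (H.hasL2.pow d).mul h1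
  refine ⟨d * 1 + 0, ?_⟩
  rw [show -(d * faber k (c 1) 0) = d * -faber k (c 1) 0 + -(2 * 0) by ring]
  refine h3.congr ?_
  filter_upwards [eventually_cusp_im 0] with τ hτ
  have ht := H.t_ne τ hτ
  conv_rhs => rw [← Finset.card_range d, ← Finset.prod_const, Finset.card_range,
    ← Finset.prod_mul_distrib]
  refine Finset.prod_congr rfl fun b _ => ?_
  field_simp

open Classical in
lemma hasL2_diffProd {n : ℕ} (hn : 0 < n) :
    ∃ A : ℤ, HasL2 (diffProd p n t) A (-∑ a ∈ n.divisors, gap ((a : ℤ) - (n / a : ℕ)).natAbs -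
      2 * (n * c n) + 2 * (if IsSquare n then c 1 else 0) -
      (∑ g ∈ n.divisors.filter (p ∣ ·), ((p * (n / g) : ℕ) : ℂ)) * faber k (c 1) 0) := by
  have hp := H.prime
  have hdiv : ∀ a ∈ n.divisors, 0 < a ∧ 0 < n / a ∧ a * (n / a) = n := fun a ha => by
    obtain ⟨h, -⟩ := Nat.mem_divisors.1 ha
    have ha0 := Nat.pos_of_dvd_of_pos h hn
    exact ⟨ha0, Nat.div_pos (Nat.le_of_dvd hn h) ha0, Nat.mul_div_cancel' h⟩
  choose! A hA using fun a (ha : a ∈ n.divisors) => H.hasL2_block_inl (hdiv a ha).1 (hdiv a ha).2.1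
  have h2 : ∀ g ∈ n.divisors.filter (p ∣ ·), 2 ≤ g ∧ 0 < p * (n / g) := fun g hg => by
    rw [Finset.mem_filter] at hg
    exact ⟨hp.two_le.trans (Nat.le_of_dvd (hdiv g hg.1).1 hg.2), Nat.mul_pos hp.pos (hdiv g hg.1).2.1⟩
  choose! A' hA' using fun g (hg : g ∈ n.divisors.filter (p ∣ ·)) =>
    H.hasL2_block_inr (h2 g hg).1 (h2 g hg).2
  have h3 := (HasL2.prod _ hA).mul (HasL2.prod _ hA')
  refine ⟨∑ a ∈ n.divisors, A a + ∑ g ∈ n.divisors.filter (p ∣ ·), A' g, ?_⟩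
  have hL : -∑ a ∈ n.divisors, gap ((a : ℤ) - (n / a : ℕ)).natAbs -
      2 * (n * c n) + 2 * (if IsSquare n then c 1 else 0) -
      (∑ g ∈ n.divisors.filter (p ∣ ·), ((p * (n / g) : ℕ) : ℂ)) * faber k (c 1) 0 =
      ∑ a ∈ n.divisors, (-gap ((a : ℤ) - (n / a : ℕ)).natAbs -
        2 * ((if a = 1 then ((n / a : ℕ) : ℂ) * c (n / a : ℕ) else 0) - if a = n / a then c 1 else 0)) +
      ∑ g ∈ n.divisors.filter (p ∣ ·), -(((p * (n / g) : ℕ) : ℂ) * faber k (c 1) 0) := by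
    rw [Finset.sum_sub_distrib, ← Finset.mul_sum, Finset.sum_sub_distrib, Finset.sum_neg_distrib,
      Finset.sum_neg_distrib, ← Finset.sum_mul, Finset.sum_ite_eq', if_pos (Nat.one_mem_divisors.2 hn.ne'),
      Nat.div_one]
    have : ∑ a ∈ n.divisors, (if a = n / a then c 1 else 0) = if IsSquare n then c 1 else 0 := by
      split_ifs with hs
      · obtain ⟨s1, s2, s3⟩ := sqrt_facts hn hs
        rw [Finset.sum_eq_single_of_mem n.sqrt (Nat.mem_divisors.2 ⟨⟨_, s2.symm⟩, hn.ne'⟩), if_pos s3.symm]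
        intro a ha hne
        rw [if_neg]
        intro h
        have := (hdiv a ha).2.2
        rw [← h] at this
        exact hne (by rw [← this, Nat.sqrt_eq])
      · refine Finset.sum_eq_zero fun a ha => if_neg fun h => hs ⟨a, ?_⟩
        have := (hdiv a ha).2.2
        rw [← h] at this
        exact this.symm
    rw [this]
    ring
  rw [hL]
  refine h3.congr ?_
  filter_upwards [eventually_cusp_im 0] with τ hτ
  set Ψ : ((Σ _ : ℕ, ℕ) ⊕ (Σ _ : ℕ, ℕ)) → ℂ := fun i =>
    if (∃ a, a = n / a ∧ i = .inl ⟨a, 0⟩) then 1 else t τ - t (mob (repMat n i) τ) with hΨ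
  have h4 := prod_nsIdx_mul hp hn Ψ
  have h5 : (if IsSquare n then Ψ (.inl ⟨n.sqrt, 0⟩) else 1) = 1 := by
    split_ifs with hs
    · rw [hΨ]
      exact if_pos ⟨_, (sqrt_facts hn hs).2.2.symm, rfl⟩
    · rfl
  rw [h5, mul_one] at h4
  have h6 : diffProd p n t τ = ∏ i ∈ nsIdx p n, Ψ i := by
    refine Finset.prod_congr rfl fun i hi => ?_
    rw [hΨ]
    refine (if_neg ?_).symm
    rintro ⟨a, ha, rfl⟩
    refine (mem_nsIdx.1 hi).2 1 a IsG0.one ?_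
    simp only [repMat]
    rw [← ha]
    ext i j; fin_cases i <;> fin_cases j <;> simp
  rw [h6, h4]
  congr 1
  · refine Finset.prod_congr rfl fun a ha => ?_
    rw [Finset.prod_filter]
    refine Finset.prod_congr rfl fun b _ => ?_
    rw [hΨ, ← mob_repMat_inl]
    by_cases h : b ≠ 0 ∨ a ≠ n / a
    · rw [if_pos h]
      refine if_neg ?_
      rintro ⟨a', ha', he⟩
      simp only [Sum.inl.injEq, Sigma.mk.injEq, heq_eq_eq] at he
      rw [he.1, he.2] at h
      simp [← ha'] at h
    · rw [if_neg h]
      push Not at h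
      exact if_pos ⟨a, h.2, by rw [h.1]⟩
  · refine Finset.prod_congr rfl fun g hg => ?_
    obtain ⟨hg', -⟩ := Nat.mem_divisors.1 (Finset.mem_filter.1 hg).1
    refine Finset.prod_congr rfl fun b _ => ?_
    rw [hΨ, ← H.t_repMat_inr hn hg' hτ]
    exact if_neg (by simp)

end Haupt

lemma sum_filter_dvd_mul_div {p n : ℕ} (hp : p.Prime) (hn : 0 < n) :
    ∑ g ∈ n.divisors.filter (p ∣ ·), p * (n / g) = ∑ g ∈ n.divisors.filter (p ∣ ·), g := by
  have key : ∀ g ∈ n.divisors.filter (p ∣ ·),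
      p * (n / g) ∈ n.divisors.filter (p ∣ ·) ∧ p * (n / (p * (n / g))) = g := by
    intro g hg
    simp only [Finset.mem_filter, Nat.mem_divisors] at hg ⊢
    obtain ⟨⟨⟨e, rfl⟩, h0⟩, ⟨h, rfl⟩⟩ := hg
    have hp0 := hp.pos
    have hh : 0 < h := Nat.pos_of_ne_zero fun hh => by simp [hh] at hn
    have he : 0 < e := Nat.pos_of_ne_zero fun hh => by simp [hh] at hn
    rw [Nat.mul_div_cancel_left _ (Nat.mul_pos hp0 hh), show p * h * e = p * e * h by ring,
      Nat.mul_div_cancel_left _ (Nat.mul_pos hp0 he)]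
    exact ⟨⟨⟨⟨h, rfl⟩, by rwa [show p * e * h = p * h * e by ring]⟩, dvd_mul_right _ _⟩, rfl⟩
  exact Finset.sum_nbij' (fun g => p * (n / g)) (fun g => p * (n / g)) (fun g hg => (key g hg).1)
    (fun g hg => (key g hg).1) (fun g hg => (key g hg).2) (fun g hg => (key g hg).2) fun _ _ => rfl

open Classical in
lemma card_nsIdx {p n : ℕ} (hp : p.Prime) (hn : 0 < n) :
    (nsIdx p n).card + (if IsSquare n then 1 else 0) =
      ∑ a ∈ n.divisors, a + ∑ g ∈ n.divisors.filter (p ∣ ·), g := by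
  have h1 : (repIdx p n).card = ∑ a ∈ n.divisors, a + ∑ g ∈ n.divisors.filter (p ∣ ·), g := by
    rw [repIdx, Finset.card_disjSum, Finset.card_sigma, Finset.card_sigma]
    simp only [Finset.card_range]
    rw [sum_filter_dvd_mul_div hp hn, Nat.sum_div_divisors n fun a => a]
  rw [← h1]
  obtain ⟨h2, h3⟩ := nsIdx_eq hp hn
  split_ifs with hs
  · rw [(h3 hs).2, Finset.card_erase_add_one (h3 hs).1]
  · rw [h2 hs, add_zero]

namespace Haupt

variable {p : ℕ} {k C : ℂ} {c : ℤ → ℂ} {t D G : ℂ → ℂ} (H : Haupt p k C c t D G)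
include H

open Classical in
/-- The residue theorem for the logarithmic derivative of the product over representatives. -/
lemma exists_fixed_divisor {n : ℕ} (hn : 0 < n) :
    ∃ R : Multiset ℂ, (∀ x ∈ R, x ≠ 0) ∧
      (∀ z : ℂ, 0 < z.im → R.count (t z) * ram t z = 12 * fixCount p n z) ∧
      (R.map (frickeFaber k (c 1) C)).sum = 24 * (∑ a ∈ n.divisors, gap ((a : ℤ) - (n / a : ℕ)).natAbs +
        2 * n * c n - faber k (c 1) 0 * (∑ a ∈ n.divisors.filter (¬ p ∣ ·), (a : ℂ)) -
        if IsSquare n then 6 + 4 * (if p = 2 then 1 else 0) else 0) := by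
  obtain ⟨A, hA⟩ := H.hasL2_diffProd hn
  set Ld := -∑ a ∈ n.divisors, gap ((a : ℤ) - (n / a : ℕ)).natAbs -
      2 * (n * c n) + 2 * (if IsSquare n then c 1 else 0) -
      (∑ g ∈ n.divisors.filter (p ∣ ·), ((p * (n / g) : ℕ) : ℂ)) * faber k (c 1) 0 with hLd
  have hN := H.hasL2_normProd hn rfl
  set u := ∑ a ∈ n.divisors, (a : ℤ) - ∑ g ∈ n.divisors.filter (p ∣ ·), (g : ℤ) -
      (if IsSquare n then 1 else 0) with hu
  obtain ⟨B, hB⟩ : ∃ B : ℤ, HasL2 (fun w => if IsSquare n then ramFun t D w else 1) B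
      (if IsSquare n then 12 * (faber k (c 1) 0 - 2 * c 1) + 72 + 48 * (if p = 2 then 1 else 0) else 0) := by
    by_cases hs : IsSquare n
    · simp only [if_pos hs]
      exact ⟨_, H.hasL2_ramFun⟩
    · simp only [if_neg hs]
      exact ⟨_, HasL2.const one_ne_zero⟩
  have hmod : IsMod p (fun w => diffProd p n t w ^ 12 * if IsSquare n then ramFun t D w else 1) := by
    refine ((H.isMod_diffProd hn).pow 12).mul ?_
    split_ifs
    · exact H.isMod_ramFun
    · exact IsMod.const 1
  have hL := (hA.pow 12).mul hB
  have hL' := (((((HasL2.const (pow_ne_zero (nsIdx p n).card (neg_ne_zero.2 H.C_ne))).mul hA).mul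
    ((H.hasL2.pow (nsIdx p n).card).mul hN).inv).pow 12).mul hB)
  have hL'' := hL'.congr (G := fun z => (fun w => diffProd p n t w ^ 12 *
      if IsSquare n then ramFun t D w else 1) (mob (wMat p) z)) (by
    filter_upwards [eventually_cusp_im 0] with τ hτ
    simp only [H.diffProd_wMat hn hτ, H.ramFun_wMat hτ])
  obtain ⟨R, hR0, hR1, hR2⟩ := H.exists_divisor hmod hL hL''
  refine ⟨R, hR0, fun z hz => ?_, ?_⟩
  · have h1 := hR1 z hz
    rw [H.order_total hn hz] at h1
    exact_mod_cast h1.symm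
  · rw [hR2, hLd]
    have h1 := congrArg (Nat.cast : ℕ → ℂ) (card_nsIdx H.prime hn)
    have h2 := congrArg (Nat.cast : ℕ → ℂ) (sum_filter_dvd_mul_div H.prime hn)
    have h3 := congrArg (Int.cast : ℤ → ℂ) hu
    have h4 := Finset.sum_filter_add_sum_filter_not n.divisors (p ∣ ·) (fun a => (a : ℂ))
    push_cast [-Nat.cast_ite, -Int.cast_ite] at h1 h2 h3
    push_cast
    rw [h2, h3]
    generalize ∑ a ∈ n.divisors.filter (¬ p ∣ ·), (a : ℂ) = s₀ at *
    generalize ∑ a ∈ n.divisors.filter (p ∣ ·), (a : ℂ) = s₁ at *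
    rw [← h4] at h1 ⊢
    have h1' := eq_sub_of_add_eq h1
    rw [h1']
    split_ifs <;> (push_cast; ring)

end Haupt

/-- Gram matrices of positive definite real binary quadratic forms. -/
structure IsPD (Q : Matrix (Fin 2) (Fin 2) ℝ) : Prop where
  symm : Q 1 0 = Q 0 1
  pos : 0 < Q 0 0
  det_pos : 0 < Q.det

namespace IsPD

variable {Q Q' : Matrix (Fin 2) (Fin 2) ℝ}

lemma cm_re (Q : Matrix (Fin 2) (Fin 2) ℝ) : (cmPointC Q).re = -(Q 0 1) / Q 0 0 := by
  rw [cmPointC, div_ofReal_re]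
  simp

lemma cm_im (Q : Matrix (Fin 2) (Fin 2) ℝ) : (cmPointC Q).im = Real.sqrt Q.det / Q 0 0 := by
  rw [cmPointC, div_ofReal_im]
  simp

lemma cm_im_pos (hQ : IsPD Q) : 0 < (cmPointC Q).im := by
  rw [cm_im]
  have := hQ.pos
  have := Real.sqrt_pos.2 hQ.det_pos
  positivity

lemma cm_root (hQ : IsPD Q) :
    (Q 0 0 : ℂ) * cmPointC Q ^ 2 + 2 * (Q 0 1 : ℂ) * cmPointC Q + (Q 1 1 : ℂ) = 0 := by
  have hA : (Q 0 0 : ℂ) ≠ 0 := by exact_mod_cast hQ.pos.ne'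
  have hs : ((Real.sqrt Q.det : ℝ) : ℂ) ^ 2 = (Q 0 0 : ℂ) * Q 1 1 - (Q 0 1 : ℂ) * Q 0 1 := by
    have h := Real.sq_sqrt hQ.det_pos.le
    rw [det_fin_two, hQ.symm] at h
    rw [det_fin_two, hQ.symm]
    exact_mod_cast h
  rw [cmPointC]
  generalize ((Real.sqrt Q.det : ℝ) : ℂ) = s at *
  field_simp
  push_cast
  ring_nf
  rw [I_sq, hs]
  ring

lemma eq_cm (hQ : IsPD Q) {z : ℂ} (hz : 0 < z.im)
    (h : (Q 0 0 : ℂ) * z ^ 2 + 2 * (Q 0 1 : ℂ) * z + (Q 1 1 : ℂ) = 0) : z = cmPointC Q := by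
  have hr := hQ.cm_root
  have him := hQ.cm_im_pos
  generalize cmPointC Q = α at *
  have h0 : (z - α) * ((Q 0 0 : ℂ) * (z + α) + 2 * (Q 0 1 : ℂ)) = 0 := by
    linear_combination h - hr
  rcases mul_eq_zero.1 h0 with h1 | h1
  · exact sub_eq_zero.1 h1
  · have h2 := congrArg Complex.im h1
    simp at h2
    rcases h2 with h2 | h2
    · exact absurd h2 hQ.pos.ne'
    · linarith

lemma ext_cm (hQ : IsPD Q) (hQ' : IsPD Q') (hd : Q.det = Q'.det)
    (h : cmPointC Q = cmPointC Q') : Q = Q' := by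
  have h1 : Real.sqrt Q.det / Q 0 0 = Real.sqrt Q.det / Q' 0 0 := by
    rw [← cm_im, h, cm_im, hd]
  have h2 : -(Q 0 1) / Q 0 0 = -(Q' 0 1) / Q' 0 0 := by rw [← cm_re, h, cm_re]
  have hs := Real.sqrt_pos.2 hQ.det_pos
  have hA := hQ.pos
  have hA' := hQ'.pos
  have e1 : Q 0 0 = Q' 0 0 := by
    rw [div_eq_div_iff hA.ne' hA'.ne'] at h1
    exact (mul_left_cancel₀ hs.ne' h1).symm
  have e2 : Q 0 1 = Q' 0 1 := by
    rw [e1] at h2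
    field_simp at h2
    linarith
  have e3 : Q 1 1 = Q' 1 1 := by
    rw [det_fin_two, det_fin_two, hQ.symm, hQ'.symm, e1, e2] at hd
    exact mul_left_cancel₀ hA'.ne' (by linarith)
  ext i j
  fin_cases i <;> fin_cases j
  · exact e1
  · exact e2
  · exact hQ.symm.trans (e2.trans hQ'.symm.symm)
  · exact e3

lemma act (hQ : IsPD Q) (g : SL2R) : IsPD ((g.1)ᵀ * Q * g.1) := by
  have hg := g.2
  have hd := hQ.det_pos
  have hA := hQ.pos
  have hs := hQ.symm
  rw [det_fin_two] at hg hd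
  rw [hs] at hd
  refine ⟨?_, ?_, ?_⟩
  · simp only [mul_apply, Fin.sum_univ_two, transpose_apply, hs]
    ring
  · simp only [mul_apply, Fin.sum_univ_two, transpose_apply, hs]
    set x := g.1 0 0
    set y := g.1 1 0
    have key : 0 < (Q 0 0 * x + Q 0 1 * y) ^ 2 + (Q 0 0 * Q 1 1 - Q 0 1 * Q 0 1) * y ^ 2 := by
      rcases eq_or_ne y 0 with hy | hy
      · have hx : x ≠ 0 := by
          rintro hx
          rw [hx, hy] at hg
          simp at hg
        rw [hy]
        have : 0 < (Q 0 0 * x) ^ 2 := by positivity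
        simpa using this
      · have := mul_pos hd (by positivity : 0 < y ^ 2)
        positivity
    refine pos_of_mul_pos_right (a := Q 0 0) ?_ hA.le
    refine key.trans_eq ?_
    ring
  · rw [det_mul, det_mul, det_transpose, g.2]
    simpa using hQ.det_pos

end IsPD

lemma val_mul (g h : SL2R) : (g * h).1 = g.1 * h.1 := rfl

lemma val_inv (g : SL2R) : (g⁻¹).1 = g.1.adjugate := rfl

lemma val_one : (1 : SL2R).1 = 1 := rfl

lemma rden_ne_zero (g : SL2R) {z : ℂ} (hz : 0 < z.im) :
    ((g.1 1 0 : ℝ) : ℂ) * z + ((g.1 1 1 : ℝ) : ℂ) ≠ 0 := by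
  intro h
  have hg := g.2
  rw [det_fin_two] at hg
  have him := congrArg Complex.im h
  have hre := congrArg Complex.re h
  simp at him hre
  rcases him with hc | h0
  · rw [hc] at hre hg
    simp at hre
    rw [hre] at hg
    simp at hg
  · exact hz.ne' h0

lemma moebius_im_pos (g : SL2R) {z : ℂ} (hz : 0 < z.im) : 0 < (moebius g z).im := by
  have h := normSq_pos.2 (rden_ne_zero g hz)
  have hg := g.2
  rw [det_fin_two] at hg
  have : (moebius g z).im = z.im / normSq (((g.1 1 0 : ℝ) : ℂ) * z + ((g.1 1 1 : ℝ) : ℂ)) := by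
    rw [moebius, div_im, ← sub_div]
    congr 1
    simp
    linear_combination z.im * hg
  rw [this]
  positivity

lemma moebius_inj (g : SL2R) {z w : ℂ} (hz : 0 < z.im) (hw : 0 < w.im)
    (h : moebius g z = moebius g w) : z = w := by
  have hg : (g.1 0 0 : ℂ) * g.1 1 1 - (g.1 0 1 : ℂ) * g.1 1 0 = 1 := by
    have := g.2
    rw [det_fin_two] at this
    exact_mod_cast this
  rw [moebius, moebius, div_eq_div_iff (rden_ne_zero g hz) (rden_ne_zero g hw)] at h
  linear_combination h - (z - w) * hg

/-- The action of `SL(2, ℝ)` on forms corresponds to the action on points. -/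
lemma IsPD.moebius_cm {Q : Matrix (Fin 2) (Fin 2) ℝ} (hQ : IsPD Q) (g : SL2R) :
    moebius g (cmPointC ((g.1)ᵀ * Q * g.1)) = cmPointC Q := by
  have hQ' := hQ.act g
  have hi := hQ'.cm_im_pos
  have hr := hQ'.cm_root
  generalize cmPointC ((g.1)ᵀ * Q * g.1) = β at *
  refine hQ.eq_cm (moebius_im_pos g hi) ?_
  have hd := rden_ne_zero g hi
  simp only [mul_apply, Fin.sum_univ_two, transpose_apply, hQ.symm] at hr
  push_cast at hr
  rw [moebius]
  generalize hN : ((g.1 0 0 : ℝ) * β + ((g.1 0 1 : ℝ) : ℂ)) = N at *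
  generalize hD : ((g.1 1 0 : ℝ) * β + ((g.1 1 1 : ℝ) : ℂ)) = D at *
  have h0 : (Q 0 0 : ℂ) * N ^ 2 + 2 * (Q 0 1 : ℂ) * N * D + (Q 1 1 : ℂ) * D ^ 2 = 0 := by
    rw [← hN, ← hD]
    linear_combination hr
  field_simp
  linear_combination h0

lemma IsPD.act_eq_iff {Q Q' : Matrix (Fin 2) (Fin 2) ℝ} (hQ : IsPD Q) (hQ' : IsPD Q')
    (hd : Q.det = Q'.det) (g : SL2R) :
    Q' = (g.1)ᵀ * Q * g.1 ↔ moebius g (cmPointC Q') = cmPointC Q := by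
  constructor
  · rintro rfl
    exact hQ.moebius_cm g
  · intro h
    refine hQ'.ext_cm (hQ.act g) ?_ ?_
    · rw [det_mul, det_mul, det_transpose, g.2, hd]
      simp
    · exact moebius_inj g hQ'.cm_im_pos (hQ.act g).cm_im_pos (h.trans (hQ.moebius_cm g).symm)

lemma isPD_of_mem {d : ℤ} (hd : 0 < d) {p : ℕ} {Q : Matrix (Fin 2) (Fin 2) ℝ} (hQ : Q ∈ QdN d p) :
    IsPD Q ∧ Q.det = (d : ℝ) / 4 := by
  obtain ⟨a, b, c, rfl, ha, hb, -⟩ := hQ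
  have h1 : (formMat a b c).det = (d : ℝ) / 4 := by
    have : (b : ℝ) ^ 2 - 4 * a * c = -d := by exact_mod_cast hb
    rw [det_fin_two]
    simp [formMat]
    linarith
  refine ⟨⟨by simp [formMat], by simpa [formMat] using ha, ?_⟩, h1⟩
  rw [h1]
  have : (0 : ℝ) < d := by exact_mod_cast hd
  positivity

/-- Integral matrices as real matrices. -/
noncomputable def toR : M2 →+* Matrix (Fin 2) (Fin 2) ℝ := (Int.castRingHom ℝ).mapMatrix

@[simp] lemma toR_apply (M : M2) (i j : Fin 2) : toR M i j = (M i j : ℝ) := rfl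

lemma toR_injective : Function.Injective toR := by
  intro A B h
  ext i j
  have := congrFun (congrFun h i) j
  simpa using this

lemma det_toR (M : M2) : (toR M).det = (M.det : ℝ) := by
  rw [det_fin_two, det_fin_two]
  simp

lemma mem_gamma0 {p : ℕ} {g : SL2R} :
    g ∈ Gamma0SL2R p ↔ ∃ γ : M2, IsG0 p γ ∧ g.1 = toR γ := by
  constructor
  · rintro ⟨γ, hγ, rfl⟩
    refine ⟨γ.1, ⟨γ.2, ?_⟩, rfl⟩
    have := CongruenceSubgroup.Gamma0_mem.1 hγ
    exact (ZMod.intCast_zmod_eq_zero_iff_dvd _ _).1 this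
  · rintro ⟨γ, hγ, h⟩
    refine ⟨⟨γ, hγ.1⟩, ?_, ?_⟩
    · refine CongruenceSubgroup.Gamma0_mem.2 ?_
      exact (ZMod.intCast_zmod_eq_zero_iff_dvd _ _).2 hγ.2
    · ext i j
      rw [h]
      rfl

/-- The two cosets making up the Fricke group of prime level. -/
def IsFricke (p : ℕ) (g : SL2R) : Prop :=
  (∃ γ : M2, IsG0 p γ ∧ g.1 = toR γ) ∨
    ∃ γ : M2, IsG0 p γ ∧ g.1 = (Real.sqrt p)⁻¹ • toR (γ * wMat p)

lemma wMat_mul {p : ℕ} (hp : 0 < p) {M : M2} (hM : (p : ℤ) ∣ M 1 0) :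
    wMat p * M = conjW p M * wMat p := by
  conv_lhs => rw [← conjW_conjW hp hM]
  refine wMat_mul_conjW hp ?_
  simp [conjW]

lemma wMat_sq (p : ℕ) : wMat p * wMat p = -((p : ℤ) • (1 : M2)) := by
  rw [wMat, one_fin_two, Matrix.smul_of]
  ext i j
  fin_cases i <;> fin_cases j <;> simp

lemma sqrt_inv_sq {p : ℕ} (hp : 0 < p) :
    (Real.sqrt p)⁻¹ * (Real.sqrt p)⁻¹ * (p : ℝ) = 1 := by
  have h : (0 : ℝ) < p := by exact_mod_cast hp
  have h2 := Real.mul_self_sqrt h.le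
  have h3 := Real.sqrt_pos.2 h
  rw [← mul_inv, h2]
  field_simp

lemma twist_mul {p : ℕ} (hp : 0 < p) {M : M2} (N : M2) (hM : (p : ℤ) ∣ M 1 0) :
    ((Real.sqrt p)⁻¹ • toR (N * wMat p)) * ((Real.sqrt p)⁻¹ • toR (M * wMat p)) =
      toR (-(N * conjW p M)) := by
  rw [smul_mul_smul_comm, ← map_mul]
  have : N * wMat p * (M * wMat p) = (p : ℤ) • -(N * conjW p M) := by
    calc N * wMat p * (M * wMat p) = N * (wMat p * M) * wMat p := by
          simp only [Matrix.mul_assoc]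
      _ = N * (conjW p M * (wMat p * wMat p)) := by
          rw [wMat_mul hp hM]; simp only [Matrix.mul_assoc]
      _ = _ := by rw [wMat_sq]; rw [Matrix.mul_neg, Matrix.mul_neg, Matrix.mul_smul, Matrix.mul_smul,
            Matrix.mul_one, smul_neg]
  rw [this]
  ext i j
  simp only [Matrix.smul_apply, toR_apply, smul_eq_mul]
  push_cast
  linear_combination (((-(N * conjW p M)) i j : ℤ) : ℝ) * sqrt_inv_sq hp

namespace IsFricke

variable {p : ℕ}

lemma one : IsFricke p 1 := Or.inl ⟨1, IsG0.one, by rw [val_one, map_one]⟩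

lemma mul (hp : 0 < p) {g h : SL2R} (hg : IsFricke p g) (hh : IsFricke p h) :
    IsFricke p (g * h) := by
  rcases hg with ⟨γ, hγ, e⟩ | ⟨γ, hγ, e⟩ <;> rcases hh with ⟨δ, hδ, e'⟩ | ⟨δ, hδ, e'⟩
  · exact Or.inl ⟨γ * δ, hγ.mul hδ, by rw [val_mul, e, e', map_mul]⟩
  · refine Or.inr ⟨γ * δ, hγ.mul hδ, ?_⟩
    rw [val_mul, e, e', mul_smul_comm, ← map_mul, Matrix.mul_assoc]
  · refine Or.inr ⟨γ * TraceFormula.conjW p δ, hγ.mul (hδ.conjW hp), ?_⟩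
    rw [val_mul, e, e', smul_mul_assoc, ← map_mul, Matrix.mul_assoc,
      wMat_mul hp hδ.2, Matrix.mul_assoc]
  · refine Or.inl ⟨-(γ * TraceFormula.conjW p δ), (hγ.mul (hδ.conjW hp)).neg, ?_⟩
    rw [val_mul, e, e', twist_mul hp _ hδ.2]

lemma inv (hp : 0 < p) {g : SL2R} (hg : IsFricke p g) : IsFricke p g⁻¹ := by
  rcases hg with ⟨γ, hγ, e⟩ | ⟨γ, hγ, e⟩
  · refine Or.inl ⟨γ.adjugate, hγ.inv, ?_⟩
    rw [val_inv, e, toR, RingHom.map_adjugate]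
  · have hc : IsG0 p (-(TraceFormula.conjW p γ.adjugate)) := (hγ.inv.conjW hp).neg
    refine Or.inr ⟨-(TraceFormula.conjW p γ.adjugate), hc, ?_⟩
    have h1 : g.1 * ((Real.sqrt p)⁻¹ • toR (-(TraceFormula.conjW p γ.adjugate) * wMat p)) = 1 := by
      rw [e, twist_mul hp _ hc.2]
      have : TraceFormula.conjW p (-(TraceFormula.conjW p γ.adjugate)) = -γ.adjugate := by
        have := conjW_smul hp (-1) (hγ.inv.conjW hp).2
        rw [conjW_conjW hp hγ.inv.2] at this
        simpa using this
      rw [this, Matrix.mul_neg, neg_neg, hγ.mul_inv, map_one]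
    have h2 : (g⁻¹).1 * g.1 = 1 := by
      rw [← val_mul, inv_mul_cancel, val_one]
    calc (g⁻¹).1 = (g⁻¹).1 * (g.1 * _) := by rw [h1, Matrix.mul_one]
      _ = _ := by rw [← Matrix.mul_assoc, h2, Matrix.one_mul]

end IsFricke

lemma mem_frickeGroup {p : ℕ} (hp : p.Prime) {g : SL2R} :
    g ∈ FrickeGroup p ↔ IsFricke p g := by
  constructor
  · intro h
    refine Subgroup.closure_induction (p := fun g _ => IsFricke p g) ?_ IsFricke.one
      (fun _ _ _ _ => IsFricke.mul hp.pos) (fun _ _ => IsFricke.inv hp.pos) h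
    rintro g (hg | hg)
    · exact Or.inl (mem_gamma0.1 hg)
    · simp only [Set.mem_iUnion] at hg
      obtain ⟨e, ⟨he, -⟩, x, y, z, w, hg⟩ := hg
      have hdet := g.2
      rcases (Nat.dvd_prime hp).1 he with rfl | rfl
      · refine Or.inl ⟨!![x, y; z * p, w], ?_⟩
        have hm : g.1 = toR !![x, y; z * p, w] := by
          rw [hg]
          ext i j
          fin_cases i <;> fin_cases j <;> simp
        rw [hm, det_toR] at hdet
        exact ⟨⟨by exact_mod_cast hdet, by simp⟩, hm⟩
      · refine Or.inr ⟨!![-y, x; -(w * e), z], ?_⟩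
        have hm : g.1 = (Real.sqrt e)⁻¹ • toR (!![-y, x; -(w * e), z] * wMat e) := by
          rw [hg]
          congr 1
          ext i j
          fin_cases i <;> fin_cases j <;> simp [wMat]
        refine ⟨⟨?_, by simp⟩, hm⟩
        rw [hm, det_smul, det_toR, det_mul, det_wMat] at hdet
        have h1 := sqrt_inv_sq hp.pos
        have h2 : ((Matrix.det !![-y, x; -(w * e), z] : ℤ) : ℝ) = 1 := by
          simp only [Fintype.card_fin, Int.cast_mul, Int.cast_natCast] at hdet
          rw [← hdet]
          linear_combination (-((Matrix.det !![-y, x; -(w * e), z] : ℤ) : ℝ)) * h1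
        exact_mod_cast h2
  · rintro (h | ⟨γ, hγ, h⟩)
    · exact Subgroup.subset_closure (Or.inl (mem_gamma0.2 h))
    · refine Subgroup.subset_closure (Or.inr ?_)
      simp only [Set.mem_iUnion]
      obtain ⟨z, hz⟩ := hγ.2
      refine ⟨p, ⟨dvd_rfl, by rw [Nat.div_self hp.pos]; exact Nat.coprime_one_right p⟩,
        γ 0 1, -γ 0 0, γ 1 1, -z, ?_⟩
      rw [h]
      congr 1
      ext i j
      fin_cases i <;> fin_cases j <;> simp [wMat, mul_apply, Fin.sum_univ_two, hz, mul_comm]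

lemma moebius_of_eq {g : SL2R} {γ : M2} (h : g.1 = toR γ) (z : ℂ) : moebius g z = mob γ z := by
  rw [moebius, mob, mden, h]
  simp

lemma moebius_of_twist {p : ℕ} (hp : 0 < p) {g : SL2R} {γ : M2} 
    (h : g.1 = (Real.sqrt p)⁻¹ • toR (γ * wMat p)) {z : ℂ} (hz : 0 < z.im) :
    moebius g z = mob γ (mob (wMat p) z) := by
  have hdet : 0 < (wMat p).det := by rw [det_wMat]; exact_mod_cast hp
  rw [← mob_mul γ hdet hz, moebius, mob, mden, h]
  have h0 : (((Real.sqrt p)⁻¹ : ℝ) : ℂ) ≠ 0 := by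
    have : (0 : ℝ) < p := by exact_mod_cast hp
    have := (Real.sqrt_pos.2 this).ne'
    exact_mod_cast inv_ne_zero this
  simp only [Matrix.smul_apply, toR_apply, smul_eq_mul, ofReal_mul, ofReal_intCast]
  rw [mul_assoc, mul_assoc, ← mul_add, ← mul_add, mul_div_mul_left _ _ h0]

lemma det_twist {p : ℕ} (hp : 0 < p) {γ : M2} (hγ : IsG0 p γ) :
    ((Real.sqrt p)⁻¹ • toR (γ * wMat p)).det = 1 := by
  rw [det_smul, det_toR, det_mul, det_wMat, hγ.1, Fintype.card_fin, sq, one_mul, Int.cast_natCast,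
    sqrt_inv_sq hp]

lemma toR_ne_twist {p : ℕ} (hp : p.Prime) {γ δ : M2} (hγ : IsG0 p γ) :
    toR γ ≠ (Real.sqrt p)⁻¹ • toR δ := by
  intro h
  have h0 : Real.sqrt p ≠ 0 := (Real.sqrt_pos.2 (by exact_mod_cast hp.pos)).ne'
  have hz : ∀ i j, γ i j = 0 := by
    intro i j
    have h1 := congrFun (congrFun h i) j
    simp only [Matrix.smul_apply, toR_apply, smul_eq_mul] at h1
    by_contra hne
    have hne' : (γ i j : ℝ) ≠ 0 := by exact_mod_cast hne
    refine hp.irrational_sqrt ⟨(δ i j : ℚ) / γ i j, ?_⟩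
    push_cast
    rw [div_eq_iff hne', h1, ← mul_assoc, mul_inv_cancel₀ h0, one_mul]
  have := hγ.1
  rw [det_fin_two, hz, hz, hz] at this
  simp at this

/-- The CM points of discriminant `-d` and level `p`. -/
def IsPt (p : ℕ) (d : ℤ) (z : ℂ) : Prop :=
  0 < z.im ∧ ∃ a b c : ℤ, 0 < a ∧ (p : ℤ) ∣ a ∧ b ^ 2 - 4 * a * c = -d ∧
    (a : ℂ) * z ^ 2 + b * z + c = 0

lemma isPt_iff {p : ℕ} {d : ℤ} (hd : 0 < d) {z : ℂ} :
    IsPt p d z ↔ ∃ Q ∈ QdN d p, cmPointC Q = z := by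
  constructor
  · rintro ⟨hz, a, b, c, ha, hpa, hb, h⟩
    have hQ : formMat a b c ∈ QdN d p := ⟨a, b, c, rfl, ha, hb, hpa⟩
    refine ⟨_, hQ, ((isPD_of_mem hd hQ).1.eq_cm hz ?_).symm⟩
    rw [← h]
    change ((a : ℝ) : ℂ) * _ + 2 * (((b : ℝ) / 2 : ℝ) : ℂ) * _ + ((c : ℝ) : ℂ) = _
    push_cast
    ring
  · rintro ⟨Q, hQ, rfl⟩
    have hpd := (isPD_of_mem hd hQ).1
    have hr := hpd.cm_root
    refine ⟨hpd.cm_im_pos, ?_⟩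
    obtain ⟨a, b, c, rfl, ha, hb, hpa⟩ := hQ
    refine ⟨a, b, c, ha, hpa, hb, ?_⟩
    rw [← hr]
    change _ = ((a : ℝ) : ℂ) * _ + 2 * (((b : ℝ) / 2 : ℝ) : ℂ) * _ + ((c : ℝ) : ℂ)
    push_cast
    ring

lemma IsPt.of_mob {p : ℕ} {d : ℤ} (hd : 0 < d) {γ : M2} (hγ : IsG0 p γ) {z : ℂ} (hz : 0 < z.im)
    (h : IsPt p d (mob γ z)) : IsPt p d z := by
  obtain ⟨-, a, b, c, ha, hpa, hb, h⟩ := h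
  have hm := mden_ne_zero hγ.det_pos hz
  have hdet := hγ.1
  rw [det_fin_two] at hdet
  set x := γ 0 0 with hx
  set u := γ 0 1 with hu
  set y := γ 1 0 with hy
  set v := γ 1 1 with hv
  refine ⟨hz, a * x ^ 2 + b * x * y + c * y ^ 2, 2 * a * x * u + b * (x * v + u * y) + 2 * c * y * v,
    a * u ^ 2 + b * u * v + c * v ^ 2, ?_, ?_, ?_, ?_⟩
  · have key : 0 < (2 * a * x + b * y) ^ 2 + d * y ^ 2 := by
      rcases eq_or_ne y 0 with h0 | h0
      · have hx0 : x ≠ 0 := by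
          rintro h1
          rw [h0, h1] at hdet
          simp at hdet
        rw [h0]
        have : 0 < (2 * a * x) ^ 2 := by positivity
        simpa using this
      · positivity
    have : (2 * a * x + b * y) ^ 2 + d * y ^ 2 =
        (4 * a) * (a * x ^ 2 + b * x * y + c * y ^ 2) := by
      linear_combination y ^ 2 * hb
    rw [this] at key
    exact pos_of_mul_pos_right key (by positivity)
  · exact dvd_add (dvd_add (hpa.mul_right _) (hγ.2.mul_left _))
      ((hγ.2.trans (dvd_pow_self _ two_ne_zero)).mul_left _)
  · linear_combination (x * v - u * y) ^ 2 * hb - d * (x * v - u * y + 1) * hdet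
  · have hN : mob γ z = ((x : ℂ) * z + u) / ((y : ℂ) * z + v) := rfl
    have hm' : (y : ℂ) * z + v ≠ 0 := hm
    rw [hN] at h
    have h0 : (a : ℂ) * (x * z + u) ^ 2 + b * (x * z + u) * (y * z + v) + c * (y * z + v) ^ 2 = 0 := by
      generalize (x : ℂ) * z + u = N at *
      generalize (y : ℂ) * z + v = D at *
      field_simp at h
      linear_combination h
    push_cast
    linear_combination h0

lemma IsPt.of_wMat {p : ℕ} (hp : 0 < p) {d : ℤ} (hd : 0 < d) {z : ℂ} (hz : 0 < z.im)
    (h : IsPt p d (mob (wMat p) z)) : IsPt p d z := by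
  obtain ⟨-, a, b, c, ha, ⟨a', hpa⟩, hb, h⟩ := h
  have hp0 : (p : ℂ) ≠ 0 := by exact_mod_cast hp.ne'
  have hz0 : z ≠ 0 := by rintro rfl; simp at hz
  refine ⟨hz, p * c, -b, a', ?_, by simp, ?_, ?_⟩
  · have h1 : 0 < a * c := by nlinarith [sq_nonneg b]
    have := pos_of_mul_pos_right h1 ha.le
    positivity
  · rw [← hb, hpa]
    ring
  · rw [mob_wMat, hpa] at h
    push_cast at h ⊢
    field_simp at h
    linear_combination h

lemma eq_of_sq_eq {a b a' b' : ℤ} (ha : 0 < a) (ha' : 0 < a') {z : ℂ} (hz : 0 < z.im)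
    (h : (2 * (a : ℂ) * z + b) ^ 2 = (2 * (a' : ℂ) * z + b') ^ 2) : a = a' ∧ b = b' := by
  have hA : (0 : ℝ) < a := by exact_mod_cast ha
  have hA' : (0 : ℝ) < a' := by exact_mod_cast ha'
  rcases sq_eq_sq_iff_eq_or_eq_neg.1 h with h | h
  · have h1 := congrArg Complex.im h
    have h2 := congrArg Complex.re h
    simp at h1 h2
    have h3 : a = a' := by
      rcases h1 with h1 | h1
      · exact h1
      · exact absurd h1 hz.ne'
    subst h3
    refine ⟨rfl, ?_⟩
    have : (b : ℝ) = b' := by linarith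
    exact_mod_cast this
  · have h1 := congrArg Complex.im h
    simp at h1
    have := mul_pos hA hz
    have := mul_pos hA' hz
    linarith

lemma mob_eq_self_iff {M : M2} (hM : 0 < M.det) {z : ℂ} (hz : 0 < z.im) :
    mob M z = z ↔ (M 1 0 : ℂ) * z ^ 2 + ((M 1 1 - M 0 0 : ℤ) : ℂ) * z + ((-M 0 1 : ℤ) : ℂ) = 0 := by
  rw [mob, div_eq_iff (mden_ne_zero hM hz), mden]
  push_cast
  constructor <;> intro h <;> linear_combination -h

lemma disc_neg {a b c : ℤ} (ha : 0 < a) {z : ℂ} (hz : 0 < z.im)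
    (h : (a : ℂ) * z ^ 2 + b * z + c = 0) : b ^ 2 - 4 * a * c < 0 := by
  have hA : (0 : ℝ) < a := by exact_mod_cast ha
  have h1 : (2 * (a : ℂ) * z + b) ^ 2 = ((b ^ 2 - 4 * a * c : ℤ) : ℂ) := by
    push_cast
    linear_combination 4 * (a : ℂ) * h
  have him : (2 * (a : ℂ) * z + b).im = 2 * a * z.im := by simp
  have hi := congrArg Complex.im h1
  have hr := congrArg Complex.re h1
  rw [sq, mul_im, him, intCast_im] at hi
  rw [sq, mul_re, him, intCast_re] at hr
  have h0 : (2 * (a : ℂ) * z + b).re = 0 := by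
    have : 0 < 2 * a * z.im := by positivity
    have h2 : (2 * (a : ℂ) * z + b).re * (2 * a * z.im) = 0 := by linarith
    exact (mul_eq_zero.1 h2).resolve_right this.ne'
  rw [h0] at hr
  have : ((b ^ 2 - 4 * a * c : ℤ) : ℝ) < 0 := by
    rw [← hr]
    have : 0 < 2 * a * z.im := by positivity
    nlinarith
  exact_mod_cast this

/-- Matrices of determinant `n` fixing `z` correspond to their traces. -/
lemma fixCount_eq {p n : ℕ} (hn : 0 < n) {z : ℂ} (hz : 0 < z.im) :
    fixCount p n z = {r : ℤ | r ^ 2 < 4 * n ∧ IsPt p (4 * n - r ^ 2) z}.ncard := by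
  have hn' : (0 : ℤ) < n := by exact_mod_cast hn
  refine Set.ncard_congr (fun M _ => M 0 0 + M 1 1) ?_ ?_ ?_
  · rintro M ⟨⟨hd, hp⟩, hM, h0⟩
    rw [mob_eq_self_iff (by rw [hd]; exact hn') hz] at hM
    have h1 := disc_neg h0 hz hM
    rw [det_fin_two] at hd
    have h2 : (M 1 1 - M 0 0) ^ 2 - 4 * M 1 0 * (-M 0 1) = -(4 * n - (M 0 0 + M 1 1) ^ 2) := by
      linear_combination -4 * hd
    refine ⟨by linarith, hz, _, _, _, h0, hp, h2, hM⟩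
  · rintro M N ⟨⟨hd, hp⟩, hM, h0⟩ ⟨⟨hd', hp'⟩, hM', h0'⟩ htr
    rw [mob_eq_self_iff (by rw [hd]; exact hn') hz] at hM
    rw [mob_eq_self_iff (by rw [hd']; exact hn') hz] at hM'
    rw [det_fin_two] at hd hd'
    have hdC : (M 0 0 : ℂ) * M 1 1 - M 0 1 * M 1 0 = n := by exact_mod_cast hd
    have hdC' : (N 0 0 : ℂ) * N 1 1 - N 0 1 * N 1 0 = n := by exact_mod_cast hd'
    have htrC : (M 0 0 : ℂ) + M 1 1 = N 0 0 + N 1 1 := by exact_mod_cast htr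
    have hsq : (2 * (M 1 0 : ℂ) * z + ((M 1 1 - M 0 0 : ℤ) : ℂ)) ^ 2 =
        (2 * (N 1 0 : ℂ) * z + ((N 1 1 - N 0 0 : ℤ) : ℂ)) ^ 2 := by
      push_cast at hM hM' ⊢
      linear_combination 4 * (M 1 0 : ℂ) * hM - 4 * (N 1 0 : ℂ) * hM' - 4 * hdC + 4 * hdC' +
        ((M 0 0 : ℂ) + M 1 1 + (N 0 0 + N 1 1)) * htrC
    obtain ⟨e1, e2⟩ := eq_of_sq_eq h0 h0' hz hsq
    have e3 : M 0 0 = N 0 0 := by omega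
    have e4 : M 1 1 = N 1 1 := by omega
    have e5 : M 0 1 = N 0 1 := by
      rw [e1, e3, e4] at hd
      exact mul_right_cancel₀ h0'.ne' (by linarith)
    ext i j
    fin_cases i <;> fin_cases j
    exacts [e3, e5, e1, e4]
  · rintro r ⟨-, -, a, b, c, ha, hpa, hb, h⟩
    obtain ⟨m, hm⟩ : ∃ m, r = b + 2 * m := by
      have h1 : (2 : ℤ) ∣ (r - b) * (r + b) := ⟨2 * n - 2 * a * c, by linear_combination -hb⟩
      rcases Int.prime_two.dvd_or_dvd h1 with ⟨m, hm⟩ | ⟨m, hm⟩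
      · exact ⟨m, by omega⟩
      · exact ⟨m - b, by omega⟩
    have hdet : Matrix.det !![m, -c; a, m + b] = (n : ℤ) := by
      rw [det_fin_two_of]
      rw [hm] at hb
      have : 4 * (m * (m + b) - -c * a) = 4 * (n : ℤ) := by linear_combination -hb
      linarith
    refine ⟨!![m, -c; a, m + b], ⟨⟨hdet, by simpa using hpa⟩, ?_, by simpa using ha⟩, ?_⟩
    · rw [mob_eq_self_iff (by rw [hdet]; exact hn') hz]
      simpa using h
    · simp
      omega

namespace Haupt

variable {p : ℕ} {k C : ℂ} {c : ℤ → ℂ} {t D G : ℂ → ℂ} (H : Haupt p k C c t D G)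
include H

lemma isPt_of_eq {d : ℤ} (hd : 0 < d) {z w : ℂ} (hz : 0 < z.im) (hw : IsPt p d w) (h : t z = t w) :
    IsPt p d z := by
  obtain ⟨γ, hγ, rfl⟩ := H.equiv_of_eq hz hw.1 h
  exact hw.of_mob hd hγ hz

lemma isPt_wMat {d : ℤ} (hd : 0 < d) {z : ℂ} (hz : IsPt p d z) : IsPt p d (mob (wMat p) z) := by
  have h1 := mob_im_pos H.det_wMat_pos hz.1
  refine IsPt.of_wMat H.prime.pos hd h1 ?_
  rwa [mob_wMat_wMat H.prime.pos]

lemma finite_stab {z : ℂ} (hz : 0 < z.im) : {γ : M2 | IsG0 p γ ∧ mob γ z = z}.Finite := by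
  refine Set.finite_of_ncard_pos ?_
  rw [H.card_stabilizer hz]
  have := H.ram_pos hz
  omega

lemma ram_mob {γ : M2} (hγ : IsG0 p γ) {z : ℂ} (hz : 0 < z.im) : ram t (mob γ z) = ram t z := by
  have key : ∀ (δ : M2), IsG0 p δ → ∀ w : ℂ, 0 < w.im → ram t w ≤ ram t (mob δ w) := by
    intro δ hδ w hw
    have hw' := mob_im_pos hδ.det_pos hw
    have : {γ : M2 | IsG0 p γ ∧ mob γ w = w}.ncard ≤
        {γ : M2 | IsG0 p γ ∧ mob γ (mob δ w) = mob δ w}.ncard := by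
      refine Set.ncard_le_ncard_of_injOn (fun γ => δ * γ * δ.adjugate) ?_ ?_ (H.finite_stab hw')
      · rintro γ ⟨hγ, hf⟩
        refine ⟨(hδ.mul hγ).mul hδ.inv, ?_⟩
        rw [← mob_mul _ hδ.det_pos hw, Matrix.mul_assoc, hδ.inv_mul, Matrix.mul_one,
          mob_mul _ hγ.det_pos hw, hf]
      · rintro γ - γ' - h
        have h1 := congrArg (fun M => δ.adjugate * M * δ) h
        simpa only [Matrix.mul_assoc, hδ.inv_mul, Matrix.mul_one, ← Matrix.mul_assoc δ.adjugate,
          Matrix.one_mul] using h1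
    rw [H.card_stabilizer hw, H.card_stabilizer hw'] at this
    omega
  refine le_antisymm ?_ (key γ hγ z hz)
  have := key _ hγ.inv _ (mob_im_pos hγ.det_pos hz)
  rwa [hγ.mob_inv hz] at this

lemma ram_wMat {z : ℂ} (hz : 0 < z.im) : ram t (mob (wMat p) z) = ram t z := by
  have hp := H.prime.pos
  have key : ∀ w : ℂ, 0 < w.im → ram t w ≤ ram t (mob (wMat p) w) := by
    intro w hw
    have hw' := mob_im_pos H.det_wMat_pos hw
    have : {γ : M2 | IsG0 p γ ∧ mob γ w = w}.ncard ≤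
        {γ : M2 | IsG0 p γ ∧ mob γ (mob (wMat p) w) = mob (wMat p) w}.ncard := by
      refine Set.ncard_le_ncard_of_injOn (conjW p) ?_ ?_ (H.finite_stab hw')
      · rintro γ ⟨hγ, hf⟩
        refine ⟨hγ.conjW hp, ?_⟩
        rw [← mob_mul _ H.det_wMat_pos hw, ← wMat_mul hp hγ.2, mob_mul _ hγ.det_pos hw, hf]
      · rintro γ ⟨hγ, -⟩ γ' ⟨hγ', -⟩ h
        rw [← conjW_conjW hp hγ.2, h, conjW_conjW hp hγ'.2]
    rw [H.card_stabilizer hw, H.card_stabilizer hw'] at this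
    omega
  refine le_antisymm ?_ (key z hz)
  have := key _ (mob_im_pos H.det_wMat_pos hz)
  rwa [mob_wMat_wMat hp] at this

lemma ram_eq {z w : ℂ} (hz : 0 < z.im) (hw : 0 < w.im) (h : t z = t w) : ram t z = ram t w := by
  obtain ⟨γ, hγ, rfl⟩ := H.equiv_of_eq hz hw h
  exact (H.ram_mob hγ hz).symm

/-- Equivalence of points under the Fricke group, in terms of the hauptmodul. -/
lemma exists_moebius_iff {z w : ℂ} (hz : 0 < z.im) (hw : 0 < w.im) :
    (∃ g ∈ FrickeGroup p, moebius g z = w) ↔ t w = t z ∨ t w = C / t z := by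
  have hW := mob_im_pos H.det_wMat_pos hz
  have hp := H.prime.pos
  have hp' : (0 : ℝ) < p := by exact_mod_cast hp
  constructor
  · rintro ⟨g, hg, rfl⟩
    rcases (mem_frickeGroup H.prime).1 hg with ⟨γ, hγ, e⟩ | ⟨γ, hγ, e⟩
    · left
      rw [moebius_of_eq e, H.inv γ hγ z hz]
    · right
      rw [moebius_of_twist hp e hz, H.inv γ hγ _ hW, H.fricke z hz]
  · rintro (h | h)
    · obtain ⟨γ, hγ, h⟩ := H.equiv_of_eq hz hw h.symm
      let g : SL2R := ⟨toR γ, by rw [det_toR, hγ.1]; simp⟩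
      refine ⟨g, (mem_frickeGroup H.prime).2 (Or.inl ⟨γ, hγ, rfl⟩), ?_⟩
      rw [moebius_of_eq (g := g) rfl, h]
    · obtain ⟨γ, hγ, h⟩ := H.equiv_of_eq hW hw (by rw [h, H.fricke z hz])
      let g : SL2R := ⟨(Real.sqrt p)⁻¹ • toR (γ * wMat p), det_twist hp hγ⟩
      refine ⟨g, (mem_frickeGroup H.prime).2 (Or.inr ⟨γ, hγ, rfl⟩), ?_⟩
      rw [moebius_of_twist (g := g) hp rfl hz, h]

open Classical in
lemma card_frickeStab {z : ℂ} (hz : 0 < z.im) :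
    Nat.card {g : SL2R // g ∈ FrickeGroup p ∧ moebius g z = z} =
      2 * (ram t z * if t z = C / t z then 2 else 1) := by
  have hW := mob_im_pos H.det_wMat_pos hz
  have hp := H.prime.pos
  set A := {γ : M2 | IsG0 p γ ∧ mob γ z = z} with hA
  set B := {γ : M2 | IsG0 p γ ∧ mob γ (mob (wMat p) z) = z} with hB
  have hBcard : B.ncard = if t z = C / t z then A.ncard else 0 := by
    split_ifs with h
    · obtain ⟨δ, hδ, hδz⟩ := H.equiv_of_eq hW hz (by rw [H.fricke z hz, ← h])
      have hi : mob δ.adjugate z = mob (wMat p) z := by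
        conv_lhs => rw [← hδz, hδ.mob_inv hW]
      refine (Set.ncard_congr (fun γ _ => γ * δ) ?_ ?_ ?_).symm
      · rintro γ ⟨hγ, h⟩
        exact ⟨hγ.mul hδ, by rw [mob_mul _ hδ.det_pos hW, hδz, h]⟩
      · rintro γ γ' - - h
        exact mul_left_injective_of_det hδ.det_pos.ne' h
      · rintro γ ⟨hγ, h⟩
        refine ⟨γ * δ.adjugate, ⟨hγ.mul hδ.inv, ?_⟩, ?_⟩
        · rw [mob_mul _ hδ.inv.det_pos hz, hi, h]
        · rw [Matrix.mul_assoc, hδ.inv_mul, Matrix.mul_one]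
    · have : B = ∅ := by
        rw [Set.eq_empty_iff_forall_notMem]
        rintro γ ⟨hγ, h'⟩
        refine h ?_
        rw [← H.fricke z hz, ← H.inv γ hγ _ hW, h']
      rw [this, Set.ncard_empty]
  have hAf : A.Finite := H.finite_stab hz
  have hBf : B.Finite := by
    by_cases h : t z = C / t z
    · refine Set.finite_of_ncard_pos ?_
      rw [hBcard, if_pos h, H.card_stabilizer hz]
      have := H.ram_pos hz
      omega
    · rw [if_neg h] at hBcard
      by_contra hinf
      obtain ⟨γ, hγ, h'⟩ := (show B.Infinite from hinf).nonempty
      refine h ?_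
      rw [← H.fricke z hz, ← H.inv γ hγ _ hW, h']
  have hs : ((fun g : SL2R => g.1) '' {g : SL2R | g ∈ FrickeGroup p ∧ moebius g z = z} :
      Set (Matrix (Fin 2) (Fin 2) ℝ)) =
      toR '' A ∪ (fun γ => (Real.sqrt p)⁻¹ • toR (γ * wMat p)) '' B := by
    ext M
    constructor
    · rintro ⟨g, ⟨hg, hgz⟩, rfl⟩
      rcases (mem_frickeGroup H.prime).1 hg with ⟨γ, hγ, e⟩ | ⟨γ, hγ, e⟩
      · exact Or.inl ⟨γ, ⟨hγ, by rw [← moebius_of_eq e, hgz]⟩, e.symm⟩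
      · exact Or.inr ⟨γ, ⟨hγ, by rw [← moebius_of_twist hp e hz, hgz]⟩, e.symm⟩
    · rintro (⟨γ, ⟨hγ, h⟩, rfl⟩ | ⟨γ, ⟨hγ, h⟩, rfl⟩)
      · let g : SL2R := ⟨toR γ, by rw [det_toR, hγ.1]; simp⟩
        refine ⟨g, ⟨(mem_frickeGroup H.prime).2 (Or.inl ⟨γ, hγ, rfl⟩), ?_⟩, rfl⟩
        rw [moebius_of_eq (g := g) rfl, h]
      · let g : SL2R := ⟨(Real.sqrt p)⁻¹ • toR (γ * wMat p), det_twist hp hγ⟩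
        refine ⟨g, ⟨(mem_frickeGroup H.prime).2 (Or.inr ⟨γ, hγ, rfl⟩), ?_⟩, rfl⟩
        rw [moebius_of_twist (g := g) hp rfl hz, h]
  have hdisj : Disjoint (toR '' A) ((fun γ => (Real.sqrt p)⁻¹ • toR (γ * wMat p)) '' B) := by
    rw [Set.disjoint_left]
    rintro M ⟨γ, ⟨hγ, -⟩, rfl⟩ ⟨δ, ⟨hδ, -⟩, h⟩
    exact toR_ne_twist H.prime hγ h.symm
  have hinj : Set.InjOn (fun γ : M2 => (Real.sqrt p)⁻¹ • toR (γ * wMat p)) B := by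
    rintro γ - γ' - h
    have h0 : (Real.sqrt p)⁻¹ ≠ 0 := by
      have : (0 : ℝ) < p := by exact_mod_cast hp
      exact inv_ne_zero (Real.sqrt_pos.2 this).ne'
    have h1 := toR_injective (smul_right_injective _ h0 h)
    exact mul_left_injective_of_det H.det_wMat_pos.ne' h1
  change Nat.card {g : SL2R | g ∈ FrickeGroup p ∧ moebius g z = z} = _
  rw [Nat.card_coe_set_eq, ← Set.ncard_image_of_injective (f := fun g : SL2R => g.1) _ Subtype.val_injective, hs,
    Set.ncard_union_eq hdisj (hAf.image _) (hBf.image _),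
    Set.ncard_image_of_injective _ toR_injective, hinj.ncard_image, hBcard,
    H.card_stabilizer hz]
  split_ifs <;> ring

open Classical in
lemma stabOrder_eq {Q : Matrix (Fin 2) (Fin 2) ℝ} (hQ : IsPD Q) :
    stabOrder (FrickeGroup p) Q =
      ram t (cmPointC Q) * if t (cmPointC Q) = C / t (cmPointC Q) then 2 else 1 := by
  have h : {g : SL2R | g ∈ FrickeGroup p ∧ (g.1)ᵀ * Q * g.1 = Q} =
      {g : SL2R | g ∈ FrickeGroup p ∧ moebius g (cmPointC Q) = cmPointC Q} := by
    ext g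
    refine and_congr_right fun _ => ?_
    rw [eq_comm, hQ.act_eq_iff hQ rfl]
  have h2 := H.card_frickeStab hQ.cm_im_pos
  change Nat.card {g : SL2R | g ∈ FrickeGroup p ∧ moebius g (cmPointC Q) = cmPointC Q} = _ at h2
  rw [stabOrder]
  change Nat.card {g : SL2R | g ∈ FrickeGroup p ∧ (g.1)ᵀ * Q * g.1 = Q} / 2 = _
  rw [h, h2]
  omega

end Haupt

lemma formRel_equivalence (Γ : Subgroup SL2R) (S : Set (Matrix (Fin 2) (Fin 2) ℝ)) :
    Equivalence (formRel Γ S) := by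
  refine ⟨fun Q => ⟨1, one_mem _, ?_⟩, ?_, ?_⟩
  · rw [val_one]
    simp
  · rintro Q Q' ⟨g, hg, h⟩
    refine ⟨g⁻¹, inv_mem hg, ?_⟩
    have h1 : g.1 * (g⁻¹).1 = 1 := by rw [← val_mul, mul_inv_cancel, val_one]
    have h2 : ((g⁻¹).1)ᵀ * (g.1)ᵀ = 1 := by rw [← transpose_mul, h1, transpose_one]
    rw [h]
    calc Q.1 = 1 * Q.1 * 1 := by simp
      _ = (((g⁻¹).1)ᵀ * (g.1)ᵀ) * Q.1 * (g.1 * (g⁻¹).1) := by rw [h1, h2]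
      _ = _ := by simp only [Matrix.mul_assoc]
  · rintro Q Q' Q'' ⟨g, hg, h⟩ ⟨g', hg', h'⟩
    refine ⟨g * g', mul_mem hg hg', ?_⟩
    rw [h', h, val_mul, transpose_mul]
    simp only [Matrix.mul_assoc]

namespace Haupt

variable {p : ℕ} {k C : ℂ} {c : ℤ → ℂ} {t D G : ℂ → ℂ} (H : Haupt p k C c t D G)
include H

lemma formRel_iff {d : ℤ} (hd : 0 < d) (Q Q' : QdN d p) :
    formRel (FrickeGroup p) (QdN d p) Q Q' ↔
      t (cmPointC Q.1) = t (cmPointC Q'.1) ∨ t (cmPointC Q.1) = C / t (cmPointC Q'.1) := by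
  obtain ⟨h1, h2⟩ := isPD_of_mem hd Q.2
  obtain ⟨h1', h2'⟩ := isPD_of_mem hd Q'.2
  rw [← H.exists_moebius_iff h1'.cm_im_pos h1.cm_im_pos, formRel]
  refine exists_congr fun g => and_congr_right fun _ => ?_
  exact h1.act_eq_iff h1' (h2.trans h2'.symm) g

lemma quot_eq_iff {d : ℤ} (hd : 0 < d) (Q Q' : QdN d p) :
    Quot.mk (formRel (FrickeGroup p) (QdN d p)) Q = Quot.mk _ Q' ↔
      t (cmPointC Q.1) = t (cmPointC Q'.1) ∨ t (cmPointC Q.1) = C / t (cmPointC Q'.1) := by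
  rw [Quot.eq, (formRel_equivalence _ _).eqvGen_iff, H.formRel_iff hd]

open Classical in
/-- The modular trace as a sum over values of the hauptmodul. -/
lemma classTrace_eq {d : ℤ} (hd : 0 < d) {f φ : ℂ → ℂ} (hf : ∀ z : ℂ, 0 < z.im → f z = φ (t z))
    (hφ : ∀ x, x ≠ 0 → φ (C / x) = φ x) {X : Finset ℂ} (hX : ∀ z, IsPt p d z → t z ∈ X)
    {e : ℂ → ℕ} (he : ∀ z : ℂ, 0 < z.im → e (t z) = ram t z) :
    classTrace (FrickeGroup p) f (QdN d p) =
      ∑ x ∈ X.filter (fun x => ∃ z, IsPt p d z ∧ t z = x), φ x / (2 * e x) := by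
  set T := Quot (formRel (FrickeGroup p) (QdN d p)) with hT
  let α : T → ℂ := fun O => cmPointC (Quot.out O).1
  have hα : ∀ O, IsPt p d (α O) := fun O => (isPt_iff hd).2 ⟨_, (Quot.out O).2, rfl⟩
  have hα0 : ∀ O, t (α O) ≠ 0 := fun O => H.t_ne _ (hα O).1
  have hinj : ∀ O O' : T, t (α O) = t (α O') ∨ t (α O) = C / t (α O') → O = O' := by
    intro O O' h
    rw [← Quot.out_eq O, ← Quot.out_eq O']
    exact (H.quot_eq_iff hd _ _).2 h
  have hsurj : ∀ z, IsPt p d z → ∃ O, t z = t (α O) ∨ t z = C / t (α O) := by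
    intro z hz
    obtain ⟨Q, hQ, rfl⟩ := (isPt_iff hd).1 hz
    refine ⟨Quot.mk _ ⟨Q, hQ⟩, ?_⟩
    refine (H.quot_eq_iff hd ⟨Q, hQ⟩ _).1 ?_
    exact (Quot.out_eq (Quot.mk (formRel (FrickeGroup p) (QdN d p)) ⟨Q, hQ⟩)).symm
  have : Finite T := by
    refine Finite.of_injective (fun O : T => (⟨t (α O), hX _ (hα O)⟩ : X)) ?_
    intro O O' h
    exact hinj _ _ (Or.inl (congrArg Subtype.val h))
  have := Fintype.ofFinite T
  have hfil : X.filter (fun x => ∃ z, IsPt p d z ∧ t z = x) =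
      Finset.univ.biUnion (fun O : T => {t (α O), C / t (α O)}) := by
    ext x
    simp only [Finset.mem_filter, Finset.mem_biUnion, Finset.mem_univ, true_and,
      Finset.mem_insert, Finset.mem_singleton]
    constructor
    · rintro ⟨-, z, hz, rfl⟩
      exact hsurj z hz
    · rintro ⟨O, rfl | rfl⟩
      · exact ⟨hX _ (hα O), _, hα O, rfl⟩
      · have h := H.isPt_wMat hd (hα O)
        rw [← H.fricke _ (hα O).1]
        exact ⟨hX _ h, _, h, rfl⟩
  rw [classTrace, finsum_eq_sum_of_fintype, hfil, Finset.sum_biUnion]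
  · refine Finset.sum_congr rfl fun O _ => ?_
    change f (α O) / (stabOrder (FrickeGroup p) (Quot.out O).1 : ℂ) = _
    rw [H.stabOrder_eq (isPD_of_mem hd (Quot.out O).2).1, hf _ (hα O).1]
    change φ (t (α O)) / ((ram t (α O) * if t (α O) = C / t (α O) then 2 else 1 : ℕ) : ℂ) = _
    have h0 : (ram t (α O) : ℂ) ≠ 0 := by exact_mod_cast (H.ram_pos (hα O).1).ne'
    split_ifs with h
    · rw [← h, Finset.pair_eq_singleton, Finset.sum_singleton, he _ (hα O).1]
      push_cast
      rw [mul_comm]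
    · have h3 : e (C / t (α O)) = ram t (α O) := by
        rw [← H.fricke _ (hα O).1, he _ (mob_im_pos H.det_wMat_pos (hα O).1), H.ram_wMat (hα O).1]
      rw [Finset.sum_pair h, he _ (hα O).1, h3, hφ _ (hα0 O)]
      push_cast
      field_simp
      ring
  · intro O _ O' _ hne
    rw [Function.onFun, Finset.disjoint_left]
    intro x hx hx'
    simp only [Finset.mem_insert, Finset.mem_singleton] at hx hx'
    refine hne (hinj _ _ ?_)
    have hC := H.C_ne
    have h1 := hα0 O
    have h2 := hα0 O'
    rcases hx with hx | hx <;> rcases hx' with hx' | hx' <;> rw [hx] at hx'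
    · exact Or.inl hx'
    · exact Or.inr hx'
    · right
      rw [← hx']
      field_simp
    · left
      field_simp at hx'
      exact hx'.symm

lemma frickeFaber_div (x : ℂ) :
    frickeFaber k (c 1) C (C / x) = frickeFaber k (c 1) C x := by
  have := H.C_ne
  rw [frickeFaber, frickeFaber, div_div_cancel₀ this]
  ring

/-- The traces of positive index sum to the contribution of the elliptic matrices. -/
lemma sum_classTrace {n : ℕ} (hn : 0 < n) {f : ℂ → ℂ}
    (hf : ∀ z : ℂ, 0 < z.im → f z = frickeFaber k (c 1) C (t z)) {I : Finset ℤ}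
    (hI : ∀ r, r ∈ I ↔ r ^ 2 < 4 * n) :
    ∑ r ∈ I, classTrace (FrickeGroup p) f (QdN (4 * n - r ^ 2) p) =
      ∑ a ∈ n.divisors, gap ((a : ℤ) - (n / a : ℕ)).natAbs +
        2 * n * c n - faber k (c 1) 0 * (∑ a ∈ n.divisors.filter (¬ p ∣ ·), (a : ℂ)) -
        if IsSquare n then 6 + 4 * (if p = 2 then 1 else 0) else 0 := by
  classical
  obtain ⟨R, hR0, hR, hsum⟩ := H.exists_fixed_divisor hn
  set φ := frickeFaber k (c 1) C with hφ
  have hex : ∀ x : ℂ, ∃ e : ℕ, ∀ z : ℂ, 0 < z.im → t z = x → e = ram t z := by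
    intro x
    by_cases h : ∃ z : ℂ, 0 < z.im ∧ t z = x
    · obtain ⟨w, hw, hwx⟩ := h
      exact ⟨ram t w, fun z hz hzx => H.ram_eq hw hz (hwx.trans hzx.symm)⟩
    · exact ⟨0, fun z hz hzx => absurd ⟨z, hz, hzx⟩ h⟩
  choose e he using hex
  have he' : ∀ z : ℂ, 0 < z.im → e (t z) = ram t z := fun z hz => he _ z hz rfl
  have hd : ∀ r ∈ I, 0 < 4 * (n : ℤ) - r ^ 2 := fun r hr => by have := (hI r).1 hr; omega
  have hset : ∀ z, {r : ℤ | r ^ 2 < 4 * n ∧ IsPt p (4 * n - r ^ 2) z} =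
      ((I.filter fun r => IsPt p (4 * n - r ^ 2) z : Finset ℤ) : Set ℤ) := by
    intro z
    ext r
    simp [hI]
  have hX : ∀ r ∈ I, ∀ z, IsPt p (4 * n - r ^ 2) z → t z ∈ R.toFinset := by
    intro r hr z hz
    rw [Multiset.mem_toFinset, ← Multiset.count_pos]
    refine Nat.pos_of_ne_zero fun h0 => ?_
    have h1 := hR z hz.1
    rw [h0, fixCount_eq hn hz.1, hset, Set.ncard_coe_finset, zero_mul] at h1
    have h2 : 0 < (I.filter fun r => IsPt p (4 * n - r ^ 2) z).card :=
      Finset.card_pos.2 ⟨r, Finset.mem_filter.2 ⟨hr, hz⟩⟩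
    omega
  have key : ∑ r ∈ I, classTrace (FrickeGroup p) f (QdN (4 * n - r ^ 2) p) =
      (1 / 24) * (R.map φ).sum := by
    calc _ = ∑ r ∈ I, ∑ x ∈ R.toFinset,
          if ∃ z, IsPt p (4 * n - r ^ 2) z ∧ t z = x then φ x / (2 * e x) else 0 := by
          refine Finset.sum_congr rfl fun r hr => ?_
          rw [H.classTrace_eq (hd r hr) hf (fun x _ => H.frickeFaber_div x) (hX r hr) he',
            Finset.sum_filter]
      _ = ∑ x ∈ R.toFinset, ∑ r ∈ I,
          if ∃ z, IsPt p (4 * n - r ^ 2) z ∧ t z = x then φ x / (2 * e x) else 0 :=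
          Finset.sum_comm
      _ = ∑ x ∈ R.toFinset, (1 / 24) * (R.count x • φ x) := by
          refine Finset.sum_congr rfl fun x hx => ?_
          obtain ⟨w, hw, rfl⟩ := H.exists_eq (hR0 x (Multiset.mem_toFinset.1 hx))
          have h1 : ∀ r ∈ I, (∃ z, IsPt p (4 * n - r ^ 2) z ∧ t z = t w) ↔
              IsPt p (4 * n - r ^ 2) w := by
            intro r hr
            constructor
            · rintro ⟨z, hz, hzw⟩
              exact H.isPt_of_eq (hd r hr) hw hz hzw.symm
            · exact fun h => ⟨w, h, rfl⟩
          have h2 : (I.filter fun r => ∃ z, IsPt p (4 * n - r ^ 2) z ∧ t z = t w) =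
              I.filter fun r => IsPt p (4 * n - r ^ 2) w := Finset.filter_congr h1
          rw [← Finset.sum_filter, Finset.sum_const, h2]
          have h3 := hR w hw
          rw [fixCount_eq hn hw, hset, Set.ncard_coe_finset, ← he' w hw] at h3
          have h4 : (e (t w) : ℂ) ≠ 0 := by
            rw [he' w hw]
            exact_mod_cast (H.ram_pos hw).ne'
          have h5 : (R.count (t w) : ℂ) * e (t w) =
              12 * ((I.filter fun r => IsPt p (4 * n - r ^ 2) w).card : ℂ) := by exact_mod_cast h3
          rw [nsmul_eq_mul, nsmul_eq_mul]
          field_simp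
          linear_combination -2 * φ (t w) * h5
      _ = _ := by rw [← Finset.mul_sum, Finset.sum_multiset_map_count]
  rw [key, hsum]
  ring

end Haupt

lemma jnStar_eq_hm {p : ℕ} (hp : p ∈ ({2, 3, 5, 7, 13} : Set ℕ)) (z : ℂ) :
    jnStar p z = hm p z + 24 / ((p : ℂ) - 1) + p ^ (12 / (p - 1)) / hm p z := by
  have h6 : p ≠ 6 := by rcases hp with rfl | rfl | rfl | rfl | rfl <;> norm_num
  have h10 : p ≠ 10 := by rcases hp with rfl | rfl | rfl | rfl | rfl <;> norm_num
  simp only [jnStar, hm, h6, h10, if_false]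
  rw [div_eq_mul_inv _ ((dedekindEta z / dedekindEta (p * z)) ^ (24 / (p - 1))), ← inv_pow, inv_div]

lemma HasQExp.tendsto_sub_inv_sq {f : ℂ → ℂ} {e : ℤ → ℂ} (hf : HasQExp f e (-2))
    (he2 : e (-2) = 1) (he1 : e (-1) = 0) (he0 : e 0 = 0) :
    Tendsto (fun τ => f τ - (qc τ)⁻¹ ^ 2) cusp (𝓝 0) := by
  have hsum : ∀ τ : ℂ, 0 < τ.im → HasSum (fun m : ℕ => e (m - 2) * qc τ ^ m) (qc τ ^ 2 * f τ) := by
    intro τ hτ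
    refine (iff_of_eq (congrArg (HasSum · _) (funext fun m => ?_))).2
      ((hf.2 τ hτ).mul_left (qc τ ^ 2))
    have hq := qc_ne_zero τ
    rw [zpow_add₀ hq, zpow_natCast, show (-2 + (m : ℤ)) = m - 2 by ring,
      show (-2 : ℤ) = -((2 : ℕ) : ℤ) by norm_num, _root_.zpow_neg, zpow_natCast]
    field_simp
  obtain ⟨τ₀, hτ₀⟩ : ∃ τ : ℂ, qc τ = (1 / 2 : ℝ) := exists_qc_eq (by norm_num)
  have hτ₀' : 0 < τ₀.im := by
    by_contra! h
    have h1 := norm_qc τ₀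
    rw [hτ₀] at h1
    have : (1 : ℝ) ≤ Real.exp (-2 * Real.pi * τ₀.im) :=
      Real.one_le_exp (by nlinarith [Real.pi_pos])
    rw [← h1] at this
    norm_num at this
  have hs₀ : Summable fun m : ℕ => e (m - 2) * ((1 / 2 : ℝ) : ℂ) ^ m := by
    have := (hsum τ₀ hτ₀').summable
    rwa [hτ₀] at this
  obtain ⟨K, -, hK⟩ := exists_taylor_bound (by norm_num) hs₀
  have h0 := tendsto_div_sq_of_le (ε := fun τ => qc τ ^ 2 * f τ - 1) (K := K) (by
    filter_upwards [eventually_norm_qc_le (r := 1 / 2 / 2) (by norm_num), eventually_cusp_im 0]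
      with τ h1 h2
    have := hK _ _ h1 (hsum τ h2)
    norm_num [he2, he1, he0] at this
    exact this)
  refine h0.congr fun τ => ?_
  have := qc_ne_zero τ
  field_simp

namespace Haupt

variable {p : ℕ} {k C : ℂ} {c : ℤ → ℂ} {t D G : ℂ → ℂ} (H : Haupt p k C c t D G)
include H

lemma tendsto_frickeFaber_sub_inv_sq :
    Tendsto (fun τ => frickeFaber k (c 1) C (t τ) - (qc τ)⁻¹ ^ 2) cusp (𝓝 0) := by
  have h1 : Tendsto (fun τ => 2 * (G (qc τ) - c 1) + qc τ ^ 2 * G (qc τ) ^ 2 +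
      ((C * (t τ)⁻¹) ^ 2 + 2 * k * (C * (t τ)⁻¹))) cusp (𝓝 (2 * (c 1 - c 1) + 0 ^ 2 * c 1 ^ 2 +
      ((C * 0) ^ 2 + 2 * k * (C * 0)))) :=
    (((H.tendsto_G.sub_const _).const_mul 2).add ((tendsto_qc.pow 2).mul (H.tendsto_G.pow 2))).add
      (((H.tendsto_inv.const_mul C).pow 2).add ((H.tendsto_inv.const_mul C).const_mul (2 * k)))
  have h0 : 2 * (c 1 - c 1) + 0 ^ 2 * c 1 ^ 2 + ((C * 0) ^ 2 + 2 * k * (C * 0)) = 0 := by ring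
  rw [h0] at h1
  refine h1.congr' ?_
  filter_upwards [eventually_cusp_im 0] with τ hτ
  have hq := qc_ne_zero τ
  have h2 : t τ + k = (qc τ)⁻¹ + qc τ * G (qc τ) := by rw [H.qexp τ hτ]; ring
  have h3 : (qc τ)⁻¹ * qc τ = 1 := inv_mul_cancel₀ hq
  simp only [frickeFaber, faber, h2, div_eq_mul_inv]
  linear_combination (-2 * G (qc τ)) * h3

lemma tendsto_norm_frickeFun :
    Tendsto (fun τ => ‖t τ + k + C / t τ‖) cusp atTop := by
  have h1 : Tendsto (fun τ => k + C / t τ) cusp (𝓝 (k + C * 0)) := by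
    simpa only [div_eq_mul_inv] using (H.tendsto_inv.const_mul C).const_add k
  have h2 : Tendsto (fun τ => ‖t τ‖) cusp atTop :=
    tendsto_atTop.2 fun R => (H.eventually_norm_gt R).mono fun _ h => h.le
  have h3 := h2.atTop_add h1.norm.neg
  refine tendsto_atTop_mono (fun τ => ?_) h3
  have := norm_sub_le (t τ + (k + C / t τ)) (k + C / t τ)
  rw [add_sub_cancel_right] at this
  rw [add_assoc]
  linarith

lemma eval_eq_frickeFaber {f : ℂ → ℂ} (hf : ∀ z : ℂ, f z = t z + k + C / t z)
    {P : Polynomial ℂ}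
    (hP : Tendsto (fun τ => P.eval (f τ) - (qc τ)⁻¹ ^ 2) cusp (𝓝 0)) {z : ℂ} (hz : 0 < z.im) :
    P.eval (f z) = frickeFaber k (c 1) C (t z) := by
  set P₀ : Polynomial ℂ := Polynomial.X ^ 2 - Polynomial.C (2 * c 1 + 2 * C) with hP₀
  have h0 : ∀ w : ℂ, 0 < w.im → P₀.eval (f w) = frickeFaber k (c 1) C (t w) := by
    intro w hw
    have := H.t_ne w hw
    simp only [hP₀, hf, frickeFaber, faber, Polynomial.eval_sub, Polynomial.eval_pow,
      Polynomial.eval_X, Polynomial.eval_C]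
    field_simp
    ring
  have h1 : Tendsto (fun τ => (P - P₀).eval (f τ)) cusp (𝓝 0) := by
    have h2 := hP.sub H.tendsto_frickeFaber_sub_inv_sq
    rw [sub_zero] at h2
    refine h2.congr' ?_
    filter_upwards [eventually_cusp_im 0] with w hw
    rw [Polynomial.eval_sub, h0 w hw]
    ring
  have h2 : Tendsto (fun τ => ‖f τ‖) cusp atTop := by
    simpa only [hf] using H.tendsto_norm_frickeFun
  have h3 : (P - P₀).degree ≤ 0 := by
    by_contra! h
    exact not_tendsto_atTop_of_tendsto_nhds h1.norm (Polynomial.tendsto_norm_atTop _ h h2)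
  rw [Polynomial.eq_C_of_degree_le_zero h3] at h1
  simp only [Polynomial.eval_C] at h1
  have h4 : (P - P₀).coeff 0 = 0 := tendsto_nhds_unique tendsto_const_nhds h1
  have h5 : P - P₀ = 0 := by rw [Polynomial.eq_C_of_degree_le_zero h3, h4, Polynomial.C_0]
  rw [sub_eq_zero.1 h5, h0 z hz]

end Haupt

lemma card_sq_eq_add_sq {n s : ℕ} (hn : 0 < n) (hs : 0 < s) {J : Finset ℤ}
    (hJ : ∀ r : ℤ, r ^ 2 = 4 * n + s ^ 2 → r ∈ J) :
    (n.divisors.filter fun a : ℕ => ((a : ℤ) - (n / a : ℕ)).natAbs = s).card =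
      (J.filter fun r : ℤ => r ^ 2 = 4 * n + s ^ 2).card := by
  have hdiv : ∀ a ∈ n.divisors, a * (n / a) = n ∧ 0 < a := fun a ha =>
    ⟨Nat.mul_div_cancel' (Nat.dvd_of_mem_divisors ha), Nat.pos_of_mem_divisors ha⟩
  have hparam : ∀ r : ℤ, 0 < r → r ^ 2 = 4 * n + s ^ 2 →
      ∃ u : ℕ, 0 < u ∧ u * (u + s) = n ∧ r = 2 * u + s := by
    intro r hr h
    have h1 : Even (r - s) := by
      have : Even (r ^ 2 - (s : ℤ) ^ 2) := ⟨2 * n, by rw [h]; ring⟩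
      rw [Int.even_sub, Int.even_pow' two_ne_zero, Int.even_pow' two_ne_zero] at this
      rwa [Int.even_sub]
    obtain ⟨v, hv⟩ := h1
    have hv0 : 0 < v := by
      by_contra! h2
      have : r ≤ s := by linarith
      have : r ^ 2 ≤ (s : ℤ) ^ 2 := by gcongr
      have : (0 : ℤ) < n := by exact_mod_cast hn
      linarith
    obtain ⟨u, rfl⟩ := Int.eq_ofNat_of_zero_le hv0.le
    refine ⟨u, by exact_mod_cast hv0, ?_, by linarith⟩
    have hr' : r = 2 * u + s := by linarith
    rw [hr'] at h
    have : (u : ℤ) * (u + s) = n := by linarith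
    exact_mod_cast this
  refine Finset.card_bij (fun a _ => if n / a < a then ((a + n / a : ℕ) : ℤ) else -((a + n / a : ℕ) : ℤ))
    ?_ ?_ ?_
  · intro a ha
    obtain ⟨ha1, ha2⟩ := Finset.mem_filter.1 ha
    obtain ⟨h1, -⟩ := hdiv a ha1
    have h2 : ((a + n / a : ℕ) : ℤ) ^ 2 = 4 * n + s ^ 2 := by
      have h3 : ((a : ℤ) - (n / a : ℕ)) ^ 2 = (s : ℤ) ^ 2 := by
        rw [← ha2, Int.natAbs_sq]
      generalize n / a = d at *
      rw [← h3, ← h1]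
      push_cast
      ring
    rw [Finset.mem_filter]
    split_ifs
    · exact ⟨hJ _ h2, h2⟩
    · rw [← neg_sq] at h2
      exact ⟨hJ _ h2, h2⟩
  · intro a ha b hb h
    obtain ⟨ha1, ha2⟩ := Finset.mem_filter.1 ha
    obtain ⟨hb1, hb2⟩ := Finset.mem_filter.1 hb
    have h1 := (hdiv a ha1).2
    have h2 := (hdiv b hb1).2
    generalize n / a = d at *
    generalize n / b = d' at *
    split_ifs at h <;> omega
  · intro r hr
    obtain ⟨-, hr⟩ := Finset.mem_filter.1 hr
    have hr0 : r ≠ 0 := by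
      rintro rfl
      have : (0 : ℤ) < n := by exact_mod_cast hn
      nlinarith [sq_nonneg (s : ℤ)]
    rcases lt_or_gt_of_ne hr0 with h | h
    · obtain ⟨u, hu, hus, hru⟩ := hparam (-r) (by omega) (by rw [neg_sq, hr])
      have hd : n / u = u + s := Nat.div_eq_of_eq_mul_right hu hus.symm
      refine ⟨u, Finset.mem_filter.2 ⟨Nat.mem_divisors.2 ⟨⟨u + s, hus.symm⟩, hn.ne'⟩, ?_⟩, ?_⟩
      · rw [hd]; omega
      · rw [hd, if_neg (by omega)]; push_cast; omega
    · obtain ⟨u, hu, hus, hru⟩ := hparam r h hr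
      have hd : n / (u + s) = u := Nat.div_eq_of_eq_mul_left (by omega) hus.symm
      refine ⟨u + s, Finset.mem_filter.2 ⟨Nat.mem_divisors.2 ⟨⟨u, by rw [← hus]; ring⟩, hn.ne'⟩, ?_⟩, ?_⟩
      · rw [hd]; omega
      · rw [hd, if_pos (by omega)]; push_cast; omega

lemma card_sq_eq {n : ℕ} (hn : 0 < n) {J : Finset ℤ}
    (hJ : ∀ r : ℤ, r ^ 2 = 4 * n → r ∈ J) :
    (J.filter fun r : ℤ => r ^ 2 = 4 * n).card = if IsSquare n then 2 else 0 := by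
  split_ifs with h
  · obtain ⟨m, hm⟩ := h
    have hm0 : 0 < m := by
      rcases Nat.eq_zero_or_pos m with rfl | h
      · omega
      · exact h
    have h1 : (J.filter fun r : ℤ => r ^ 2 = 4 * n) = {2 * (m : ℤ), -(2 * (m : ℤ))} := by
      ext r
      have h2 : r ^ 2 = 4 * n ↔ r = 2 * m ∨ r = -(2 * m) := by
        rw [← sq_eq_sq_iff_eq_or_eq_neg, hm]
        push_cast
        rw [show (4 * ((m : ℤ) * m)) = (2 * m) ^ 2 by ring]
      simp only [Finset.mem_filter, Finset.mem_insert, Finset.mem_singleton]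
      exact ⟨fun h => h2.1 h.2, fun h => ⟨hJ r (h2.2 h), h2.2 h⟩⟩
    rw [h1, Finset.card_pair (by omega)]
  · rw [Finset.card_eq_zero, Finset.filter_eq_empty_iff]
    intro r _ hr
    have h1 : Even r := by
      have : Even (r ^ 2) := ⟨2 * n, by rw [hr]; ring⟩
      rwa [Int.even_pow' two_ne_zero] at this
    obtain ⟨m, rfl⟩ := h1
    refine h ⟨m.natAbs, ?_⟩
    zify
    rw [abs_mul_abs_self]
    linarith

lemma sum_gap_eq (n : ℕ) :
    ∑ a ∈ n.divisors, gap ((a : ℤ) - (n / a : ℕ)).natAbs =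
      (n.divisors.filter fun a : ℕ => ((a : ℤ) - (n / a : ℕ)).natAbs = 1).card +
        2 * (n.divisors.filter fun a : ℕ => ((a : ℤ) - (n / a : ℕ)).natAbs = 2).card := by
  have h : ∀ s : ℕ, gap s = (if s = 1 then 1 else 0) + 2 * if s = 2 then 1 else 0 := by
    intro s
    rw [gap]
    split_ifs with h1 h2 <;> first | (exfalso; omega) | ring
  simp only [h, Finset.sum_add_distrib, ← Finset.mul_sum, Finset.sum_boole]

lemma t2Star_eq {p : ℕ} (hp : p ∈ ({2, 3, 5, 7, 13} : Set ℕ)) (P : Polynomial ℂ) (d : ℤ) :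
    t2Star p P d =
      (if 0 < d then classTrace (FrickeGroup p) (fun z => P.eval (jnStar p z)) (QdN d p) else 0) +
        ((3 + 2 * if p = 2 then 1 else 0) * (if d = 0 then 1 else 0) - (if d = -1 then 1 else 0) -
          2 * if d = -4 then 1 else 0) := by
  have h6 : ¬ (p = 6 ∨ p = 10) := by rcases hp with rfl | rfl | rfl | rfl | rfl <;> norm_num
  rw [t2Star, if_neg h6]
  rcases lt_trichotomy d 0 with h | rfl | h
  · have h1 : ¬ 0 < d := by omega
    have h2 : d ≠ 0 := by omega
    simp only [h1, h2, if_false]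
    split_ifs <;> first | (exfalso; omega) | ring
  · split_ifs <;> norm_num at *
  · have h1 : d ≠ 0 := by omega
    have h2 : d ≠ -1 := by omega
    have h3 : d ≠ -4 := by omega
    simp only [h, h1, h2, h3, if_false, if_true]
    ring

lemma finsum_t2Star {p : ℕ} (hp : p ∈ ({2, 3, 5, 7, 13} : Set ℕ)) (P : Polynomial ℂ) (n : ℤ)
    {J : Finset ℤ} (hJ : ∀ r : ℤ, r ^ 2 ≤ 4 * n + 4 → r ∈ J) :
    ∑ᶠ r : ℤ, t2Star p P (4 * n - r ^ 2) =
      ∑ r ∈ J.filter (fun r : ℤ => r ^ 2 < 4 * n), classTrace (FrickeGroup p)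
          (fun z => P.eval (jnStar p z)) (QdN (4 * n - r ^ 2) p) +
        ((3 + 2 * if p = 2 then 1 else 0) * (J.filter fun r : ℤ => r ^ 2 = 4 * n).card -
          (J.filter fun r : ℤ => r ^ 2 = 4 * n + 1 ^ 2).card -
          2 * (J.filter fun r : ℤ => r ^ 2 = 4 * n + 2 ^ 2).card) := by
  rw [finsum_eq_sum_of_support_subset _ (s := J)]
  · simp only [t2Star_eq hp, Finset.sum_add_distrib, Finset.sum_sub_distrib, ← Finset.mul_sum,
      Finset.sum_boole, Finset.sum_filter, sub_pos]
    have h0 : ∀ r : ℤ, 4 * n - r ^ 2 = 0 ↔ r ^ 2 = 4 * n := fun r => by omega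
    have h1 : ∀ r : ℤ, 4 * n - r ^ 2 = -1 ↔ r ^ 2 = 4 * n + 1 ^ 2 := fun r => by omega
    have h2 : ∀ r : ℤ, 4 * n - r ^ 2 = -4 ↔ r ^ 2 = 4 * n + 2 ^ 2 := fun r => by omega
    simp only [h0, h1, h2]
  · intro r hr
    refine hJ r ?_
    by_contra! h
    refine hr ?_
    simp only [t2Star]
    rw [if_neg (by linarith), if_neg (by linarith), if_neg (by linarith), if_neg (by linarith)]

lemma trace_formula_of_pos {p : ℕ} (hp : p ∈ ({2, 3, 5, 7, 13} : Set ℕ)) {k C : ℂ} {c : ℤ → ℂ}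
    {t D G : ℂ → ℂ} (H : Haupt p k C c t D G) (hk : k = 24 / ((p : ℂ) - 1)) {P : Polynomial ℂ}
    (hP : ∀ z : ℂ, 0 < z.im → P.eval (jnStar p z) = frickeFaber k (c 1) C (t z))
    {n : ℕ} (hn : 0 < n) :
    2 * (n : ℂ) * c n = (∑ᶠ r : ℤ, t2Star p P (4 * n - r ^ 2)) +
      24 * (3 - (p : ℂ) * (if p = 2 then 1 else 0)) / ((p : ℂ) - 1) * sigmaN p ((n : ℤ) : ℚ) := by
  set J := Finset.Icc (-(2 * (n : ℤ) + 2)) (2 * n + 2) with hJ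
  have hmem : ∀ r : ℤ, r ^ 2 ≤ 4 * n + 4 → r ∈ J := by
    intro r hr
    have h1 : r ^ 2 ≤ (2 * (n : ℤ) + 2) ^ 2 := by nlinarith [sq_nonneg (n : ℤ)]
    rw [hJ, Finset.mem_Icc]
    exact abs_le.1 (abs_le_of_sq_le_sq h1 (by positivity))
  have hn' : (0 : ℤ) < n := by exact_mod_cast hn
  have h1 := H.sum_classTrace hn hP (I := J.filter fun r : ℤ => r ^ 2 < 4 * n) (by
    intro r
    rw [Finset.mem_filter]
    exact ⟨fun h => h.2, fun h => ⟨hmem r (by linarith), h⟩⟩)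
  have hg1 := card_sq_eq_add_sq (s := 1) hn one_pos (J := J) fun r hr => hmem r (by
    push_cast at hr; linarith)
  have hg2 := card_sq_eq_add_sq (s := 2) hn two_pos (J := J) fun r hr => hmem r (by
    push_cast at hr; linarith)
  rw [Nat.cast_one] at hg1
  rw [Nat.cast_ofNat] at hg2
  rw [finsum_t2Star hp P n hmem, h1, card_sq_eq hn fun r hr => hmem r (by linarith), sum_gap_eq,
    hg1, hg2]
  have h2 : sigmaN p ((n : ℤ) : ℚ) = ∑ a ∈ n.divisors.filter (¬ p ∣ ·), (a : ℂ) := by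
    rw [sigmaN, if_neg (by exact_mod_cast hn.ne'), if_pos ⟨by exact_mod_cast hn, Rat.den_intCast _⟩,
      Rat.num_intCast, Int.toNat_natCast]
  have h3 : faber k (c 1) 0 = 24 * (3 - (p : ℂ) * (if p = 2 then 1 else 0)) / ((p : ℂ) - 1) := by
    rw [faber, zero_add, H.k_rel, hk]
    split_ifs with h
    · subst h; norm_num
    · ring
  rw [h2, h3]
  split_ifs <;> push_cast <;> ring

lemma trace_formula_zero {p : ℕ} (hp : p ∈ ({2, 3, 5, 7, 13} : Set ℕ)) (P : Polynomial ℂ) :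
    (∑ᶠ r : ℤ, t2Star p P (4 * 0 - r ^ 2)) +
      24 * (3 - (p : ℂ) * (if p = 2 then 1 else 0)) / ((p : ℂ) - 1) * sigmaN p 0 = 0 := by
  rw [finsum_t2Star hp P 0 (J := Finset.Icc (-2) 2) fun r hr => by
    rw [Finset.mem_Icc]; constructor <;> nlinarith]
  have e1 : ((Finset.Icc (-2 : ℤ) 2).filter fun r : ℤ => r ^ 2 < 4 * 0) = ∅ := by decide
  have e2 : ((Finset.Icc (-2 : ℤ) 2).filter fun r : ℤ => r ^ 2 = 4 * 0).card = 1 := by decide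
  have e3 : ((Finset.Icc (-2 : ℤ) 2).filter fun r : ℤ => r ^ 2 = 4 * 0 + 1 ^ 2).card = 2 := by decide
  have e4 : ((Finset.Icc (-2 : ℤ) 2).filter fun r : ℤ => r ^ 2 = 4 * 0 + 2 ^ 2).card = 2 := by decide
  rw [e1, e2, e3, e4, sigmaN, if_pos rfl, Finset.sum_empty]
  rcases hp with rfl | rfl | rfl | rfl | rfl <;> norm_num

lemma trace_formula_neg_one {p : ℕ} (hp : p ∈ ({2, 3, 5, 7, 13} : Set ℕ)) (P : Polynomial ℂ) :
    ∑ᶠ r : ℤ, t2Star p P (4 * (-1) - r ^ 2) = -2 := by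
  rw [finsum_t2Star hp P (-1) (J := {0}) fun r hr => by
    rw [Finset.mem_singleton]; nlinarith]
  have e1 : (({0} : Finset ℤ).filter fun r : ℤ => r ^ 2 < 4 * (-1)) = ∅ := by decide
  have e2 : (({0} : Finset ℤ).filter fun r : ℤ => r ^ 2 = 4 * (-1)).card = 0 := by decide
  have e3 : (({0} : Finset ℤ).filter fun r : ℤ => r ^ 2 = 4 * (-1) + 1 ^ 2).card = 0 := by decide
  have e4 : (({0} : Finset ℤ).filter fun r : ℤ => r ^ 2 = 4 * (-1) + 2 ^ 2).card = 1 := by decide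
  rw [e1, e2, e3, e4, Finset.sum_empty]
  norm_num

end TraceFormula

/-- **Theorem 1.1, prime levels, part 1.**
For prime `p ∈ {2,3,5,7,13}` and any `n ≥ -1`,
`2n c_n^{(p)} = Σ_{r ∈ ℤ} t₂^{(p*)}(4n - r²) + (24(3 - p σ₁(2/p))/(p-1)) σ₁^{(p)}(n)`. -/
theorem trace_formula_jn_prime (p : ℕ) (hp : p ∈ ({2, 3, 5, 7, 13} : Set ℕ)) (hp' : p.Prime)
    (c : ℤ → ℂ) (hc : HasQExp (jn p) c (-1))
    (P : Polynomial ℂ) (e : ℤ → ℂ)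
    (hP : HasQExp (fun z => Polynomial.eval (jnStar p z) P) e (-2))
    (he2 : e (-2) = 1) (he1 : e (-1) = 0) (he0 : e 0 = 0)
    (n : ℤ) (hn : -1 ≤ n) :
    2 * (n : ℂ) * c n =
      (∑ᶠ r : ℤ, t2Star p P (4 * n - r ^ 2)) +
        24 * (3 - (p : ℂ) * (if p = 2 then 1 else 0)) / ((p : ℂ) - 1) * sigmaN p (n : ℚ) := by
  obtain ⟨hc1, -, G, H⟩ := TraceFormula.exists_haupt hp hp' hc
  have hQ : ∀ z : ℂ, 0 < z.im → P.eval (jnStar p z) = _ := fun z hz =>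
    H.eval_eq_frickeFaber (TraceFormula.jnStar_eq_hm hp)
      (TraceFormula.HasQExp.tendsto_sub_inv_sq hP he2 he1 he0) hz
  rcases lt_trichotomy n 0 with h | rfl | h
  · obtain rfl : n = -1 := by omega
    have h0 : sigmaN p ((-1 : ℤ) : ℚ) = 0 := by
      rw [sigmaN, if_neg (by norm_num), if_neg (by norm_num)]
    rw [TraceFormula.trace_formula_neg_one hp, hc1, h0]
    norm_num
  · have := TraceFormula.trace_formula_zero hp P
    rw [Int.cast_zero, Int.cast_zero, this]
    ring
  · obtain ⟨m, rfl⟩ := Int.eq_ofNat_of_zero_le h.le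
    rw [Int.cast_natCast]
    exact TraceFormula.trace_formula_of_pos hp H rfl hQ (by exact_mod_cast h)
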